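/- Let q be a prime power, n ≥ 3 and m₁, m₂ positive integers. Let ℓ be a divisor of qⁿ−1 and let {p₁,…,p_r} be the set of all primes dividing qⁿ−1 but not dividing ℓ. Let g ∈ F_q[x] be a divisor of xⁿ−1 and let {P₁,…,P_s} ⊂ F_q[x] be the set of all monic irreducible polynomials dividing xⁿ−1 but not dividing g. Suppose that δ := 1 − 2·Σ_{i=1}^{r} 1/p_i − Σ_{i=1}^{s} 1/q^{deg P_i} > 0 and set Δ := (2r + s − 1)/δ + 2. If q^{n/2} ≥ (m₁ + m₂ + 1) · W(ℓ)² · W_q(g) · Δ, then for each f ∈ Υ_{qⁿ}(m₁,m₂) there exists α ∈ F_{qⁿ}, primitive and normal over F_q, such that f(α) ∈ F_{qⁿ} is also a primitive element. -/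

import Mathlib

open Polynomial

noncomputable section

/-- An element of a finite field is *primitive* if it generates the multiplicative group. -/
def IsPrimitiveElem {L : Type} [Field L] [Fintype L] (α : L) : Prop :=
  orderOf α = Fintype.card L - 1

/-- `β` is a *normal element* of `L` over `K`, where `n = [L : K]`:
the conjugates `β, β^q, …, β^(q^(n-1))` form a `K`-basis of `L`. -/
def IsNormalElem (K : Type) {L : Type} [Field K] [Fintype K] [Field L] [Algebra K L]
    (n : ℕ) (β : L) : Prop :=
  LinearIndependent K (fun i : Fin n => β ^ Fintype.card K ^ (i : ℕ)) ∧
    Submodule.span K (Set.range fun i : Fin n => β ^ Fintype.card K ^ (i : ℕ)) = ⊤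

/-- The set `Υ_Q(m₁, m₂)` of rational functions over the field `F` with `Q` elements. -/
def Upsilon (F : Type) [Field F] [Fintype F] (m₁ m₂ : ℕ) : Set (RatFunc F) :=
  {f | ∃ f₁ f₂ : F[X], f₂ ≠ 0 ∧
      f = algebraMap F[X] (RatFunc F) f₁ / algebraMap F[X] (RatFunc F) f₂ ∧
      f₁.natDegree ≤ m₁ ∧ f₂.natDegree ≤ m₂ ∧ IsCoprime f₁ f₂ ∧
      ∃ (k : ℕ) (g : F[X]), 0 < k ∧ g.Monic ∧ Irreducible g ∧ g ≠ X ∧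
        Nat.gcd k (Fintype.card F - 1) = 1 ∧
        g ^ k ∣ f₁ * f₂ ∧ ¬ g ^ (k + 1) ∣ f₁ * f₂}

/-- Evaluation of a rational function at a point of the same field (`0` if undefined). -/
def ratEval {F : Type} [Field F] (f : RatFunc F) (α : F) : F :=
  f.eval (RingHom.id F) α

/-- `α` is `s`-free. -/
def IsFree {F : Type} [Field F] (s : ℕ) (α : F) : Prop :=
  α ≠ 0 ∧ ∀ d : ℕ, d ∣ s → d ≠ 1 → ¬ ∃ β : F, β ^ d = α

/-- The `F_q[x]`-module action `h ∘ β = ∑ hᵢ β^(qⁱ)` on `L`. -/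
def polyAct {K L : Type} [Field K] [Fintype K] [Field L] [Algebra K L]
    (h : K[X]) (β : L) : L :=
  h.sum fun i a => algebraMap K L a * β ^ Fintype.card K ^ i

/-- `α` is `g`-free with respect to the `F_q[x]`-module structure of `L`. -/
def IsPolyFree (K : Type) {L : Type} [Field K] [Fintype K] [Field L] [Algebra K L]
    (g : K[X]) (α : L) : Prop :=
  ∀ h : K[X], h.Monic → h ∣ g → (∃ lam : L, α = polyAct h lam) → h = 1

/-- `N_f(e₁, e₂, g)`: the number of `α ∈ L` such that `α` is `e₁`-free,
`f(α)` is `e₂`-free and `α` is `g`-free. -/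
def NElems (K : Type) {L : Type} [Field K] [Fintype K] [Field L] [Fintype L] [Algebra K L]
    (f : RatFunc L) (e₁ e₂ : ℕ) (g : K[X]) : ℕ :=
  Nat.card {α : L | IsFree e₁ α ∧ IsFree e₂ (ratEval f α) ∧ IsPolyFree K g α}

/-- `W(ℓ)`: the number of squarefree divisors of `ℓ`. -/
def Wnat (ℓ : ℕ) : ℕ := (ℓ.divisors.filter Squarefree).card

/-- `W_q(g)`: the number of monic squarefree divisors of `g` in `F_q[x]`. -/
def Wpoly {K : Type} [Field K] (g : K[X]) : ℕ :=
  Nat.card {h : K[X] // h.Monic ∧ Squarefree h ∧ h ∣ g}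

/-- `Φ(g) = |(F_q[x]/(g))ˣ|`. -/
def PhiPoly {K : Type} [Field K] (g : K[X]) : ℕ :=
  Nat.card ((K[X] ⧸ Ideal.span ({g} : Set K[X]))ˣ)

/-- `(q, n) ∈ B(m₁, m₂)`: for every `f ∈ Υ_{qⁿ}(m₁, m₂)` there is a primitive element
`α` of `F_{qⁿ}`, normal over `F_q`, with `f(α)` also primitive. -/
def memB (m₁ m₂ q n : ℕ) : Prop :=
  ∀ (K L : Type) [Field K] [Field L] [Fintype K] [Fintype L] [Algebra K L],
    Fintype.card K = q → Fintype.card L = q ^ n →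
    ∀ f ∈ Upsilon L m₁ m₂,
      ∃ α : L, IsPrimitiveElem α ∧ IsNormalElem K n α ∧ IsPrimitiveElem (ratEval f α)

/-- `𝔑(q, n)`: the number of primitive elements of `F_{qⁿ}` that are normal over `F_q`. -/
def NNum (K L : Type) [Field K] [Fintype K] [Field L] [Fintype L] [Algebra K L] (n : ℕ) : ℕ :=
  Nat.card {α : L | IsPrimitiveElem α ∧ IsNormalElem K n α}

end


theorem wl_pow_of_pow {F : Type} [Field F] (h k : F[X]) (hh : h.Monic) (hk : k.Monic) (d e : ℕ)
    (hd : 0 < d) (hde : d < e) (H : h ^ d = k ^ e) :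
    ∃ r, 1 < r ∧ r ∣ e ∧ ∃ k1 : F[X], k1.Monic ∧ h = k1 ^ r := by
  obtain ⟨g, d1, e1, hg0, hcop, rfl, rfl⟩ := Nat.exists_coprime' (m := d) (n := e)
    (Nat.gcd_pos_of_pos_left _ hd)
  have he1 : 1 < e1 := by
    have : d1 < e1 := lt_of_mul_lt_mul_right hde (Nat.zero_le _)
    have : 0 < d1 := Nat.pos_of_mul_pos_right hd
    omega
  have h1 : h ^ d1 = k ^ e1 := by
    have hA : (h ^ d1) ^ g = (k ^ e1) ^ g := by rw [← pow_mul, ← pow_mul, H]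
    have := (UniqueFactorizationMonoid.pow_dvd_pow_iff_dvd (hg0.ne')).1 (dvd_of_eq hA)
    have h2 := (UniqueFactorizationMonoid.pow_dvd_pow_iff_dvd (hg0.ne')).1 (dvd_of_eq hA.symm)
    exact eq_of_monic_of_associated (hh.pow _) (hk.pow _) (associated_of_dvd_dvd this h2)
  refine ⟨e1, he1, Dvd.intro _ rfl, ?_⟩
  obtain ⟨u, hu⟩ := Nat.exists_mul_mod_eq_one_of_coprime hcop he1
  set v := d1 * u / e1 with hv
  have hdu : d1 * u = 1 + e1 * v := by
    have := Nat.mod_add_div (d1 * u) e1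
    rw [hu.2] at this; exact this.symm
  have h2 : (h ^ v) ^ e1 * h = (k ^ u) ^ e1 := by
    calc (h ^ v) ^ e1 * h = h ^ (1 + e1 * v) := by ring
      _ = (h ^ d1) ^ u := by rw [← hdu, pow_mul]
      _ = (k ^ u) ^ e1 := by rw [h1]; ring
  have h3 : h ^ v ∣ k ^ u := (UniqueFactorizationMonoid.pow_dvd_pow_iff_dvd (by omega : e1 ≠ 0)).1 (Dvd.intro _ h2)
  obtain ⟨m, hm⟩ := h3
  refine ⟨m, ?_, ?_⟩
  · exact (hh.pow v).of_mul_monic_left (hm ▸ hk.pow u)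
  · rw [hm, mul_pow] at h2
    exact mul_left_cancel₀ (pow_ne_zero _ (hh.pow v).ne_zero) h2

theorem wl_frac_pow {F : Type} [Field F] (A : F[X]) (hA : A.Monic) (B : F[X][X]) (hB : B.Monic)
    (e : ℕ) (he : 0 < e) (w : FractionRing F[X][X])
    (H : w ^ e * algebraMap F[X][X] _ (C A) = algebraMap F[X][X] _ B) :
    ∃ k : F[X], k.Monic ∧ A = k ^ e := by
  obtain ⟨a, b, hrp, hw⟩ := IsFractionRing.exists_reduced_fraction (A := F[X][X]) w
  have hb0 : (b : F[X][X]) ≠ 0 := nonZeroDivisors.ne_zero b.2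
  have hab : a ^ e * C A = B * (b : F[X][X]) ^ e := by
    apply IsFractionRing.injective F[X][X] (FractionRing F[X][X])
    have hb' : algebraMap F[X][X] (FractionRing F[X][X]) b ≠ 0 := by
      simp
    have h1 : algebraMap F[X][X] (FractionRing F[X][X]) a = w * algebraMap F[X][X] _ b := by
      rw [← hw, IsFractionRing.mk'_eq_div]; field_simp
    rw [map_mul, map_mul, map_pow, map_pow, h1, ← H]; ring
  have hcop : IsRelPrime ((b : F[X][X]) ^ e) (a ^ e) := (hrp.symm).pow
  have hbA : (b : F[X][X]) ^ e ∣ C A := hcop.dvd_of_dvd_mul_left (Dvd.intro_left _ hab.symm)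
  obtain ⟨c, hc⟩ := hbA
  have hB2 : B = a ^ e * c := by
    have : B * (b : F[X][X]) ^ e = (a ^ e * c) * (b : F[X][X]) ^ e := by
      rw [← hab, hc]; ring
    exact mul_right_cancel₀ (pow_ne_zero _ hb0) this
  have hCA : (C A : F[X][X]) ≠ 0 := by simpa using hA.ne_zero
  have hc0 : c ≠ 0 := by rintro rfl; simp at hc; exact hA.ne_zero hc
  have hdeg : (C A : F[X][X]).natDegree = 0 := natDegree_C _
  rw [hc, natDegree_mul (pow_ne_zero _ hb0) hc0, natDegree_pow] at hdeg
  have hb1 : (b : F[X][X]).natDegree = 0 := by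
    have : e * (b : F[X][X]).natDegree = 0 := by omega
    simpa [he.ne'] using this
  have hc1 : c.natDegree = 0 := by omega
  obtain ⟨b', hb'⟩ := natDegree_eq_zero.1 hb1
  obtain ⟨c', hc'⟩ := natDegree_eq_zero.1 hc1
  have hlc : IsUnit c' := by
    have h1 : B.leadingCoeff = (a ^ e).leadingCoeff * c' := by
      rw [hB2, leadingCoeff_mul, ← hc', leadingCoeff_C]
    rw [hB.leadingCoeff] at h1
    exact .of_mul_eq_one_right _ h1.symm
  obtain ⟨c'', hc''u, rfl⟩ := Polynomial.isUnit_iff.1 hlc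
  have hA2 : A = b' ^ e * C c'' := by
    have : (C A : F[X][X]) = C (b' ^ e * C c'') := by rw [hc, ← hb', ← hc']; simp
    exact C_injective this
  have hb'0 : b' ≠ 0 := by rintro rfl; simp at hb'; exact hb0 hb'.symm
  refine ⟨b' * C b'.leadingCoeff⁻¹, monic_mul_leadingCoeff_inv hb'0, ?_⟩
  have h5 : b'.leadingCoeff ^ e * c'' = 1 := by
    have := hA.leadingCoeff
    rw [hA2, leadingCoeff_mul, leadingCoeff_pow, leadingCoeff_C] at this
    exact this
  rw [hA2, mul_pow, ← C_pow, inv_pow]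
  congr 2
  exact eq_inv_of_mul_eq_one_right h5

theorem wl_irred {K : Type} [Field K] (H : K) (e : ℕ) (he : 0 < e)
    (hne : ∀ d, 0 < d → d < e → ∀ c : K, c ^ e ≠ H ^ d) : Irreducible (X ^ e - C H : K[X]) := by
  set f : K[X] := X ^ e - C H with hf
  have hfm : f.Monic := monic_X_pow_sub_C H he.ne'
  have hfd : f.natDegree = e := natDegree_X_pow_sub_C
  have hnu : ¬ IsUnit f := by
    intro hu
    have := natDegree_eq_zero_of_isUnit hu
    omega
  obtain ⟨p, hp, hpf⟩ := WfDvdMonoid.exists_irreducible_factor hnu hfm.ne_zero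
  obtain ⟨p, hpm, hp, hpf⟩ : ∃ p : K[X], p.Monic ∧ Irreducible p ∧ p ∣ f :=
    ⟨p * C p.leadingCoeff⁻¹, monic_mul_leadingCoeff_inv hp.ne_zero,
      irreducible_mul_leadingCoeff_inv.2 hp, by
        refine (Associated.dvd_iff_dvd_left ?_).1 hpf
        refine associated_mul_unit_right p _ ?_
        simpa using hp.ne_zero⟩
  have hpd : 0 < p.natDegree := hp.natDegree_pos
  have hple : p.natDegree ≤ e := hfd ▸ natDegree_le_of_dvd hpf hfm.ne_zero
  by_cases hlt : p.natDegree < e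
  · exfalso
    let Ω := AlgebraicClosure K
    have hsp : (p.map (algebraMap K Ω)).Splits := IsAlgClosed.splits _
    set s := (p.map (algebraMap K Ω)).roots with hs
    have hcard : s.card = p.natDegree := by
      rw [hs, ← hsp.natDegree_eq_card_roots, natDegree_map]
    have hroot : ∀ y ∈ s, y ^ e = algebraMap K Ω H := by
      intro y hy
      have h1 : (p.map (algebraMap K Ω)).eval y = 0 := (mem_roots'.1 hy).2
      have h2 : (f.map (algebraMap K Ω)).eval y = 0 := by
        obtain ⟨q, hq⟩ := hpf
        rw [hq, Polynomial.map_mul, eval_mul, h1, zero_mul]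
      simpa [hf, sub_eq_zero] using h2
    have hprod : s.prod ^ e = algebraMap K Ω H ^ p.natDegree := by
      have h0 := Multiset.prod_map_pow (m := s) (f := fun y : Ω => y) (n := e)
      rw [Multiset.map_id'] at h0
      rw [← h0, Multiset.map_congr rfl hroot]
      simp [hcard]
    have hc : algebraMap K Ω (p.coeff 0) = (-1) ^ p.natDegree * s.prod := by
      have := hsp.coeff_zero_eq_leadingCoeff_mul_prod_roots
      rw [coeff_map, natDegree_map, (hpm.map _).leadingCoeff, mul_one] at this
      exact this
    refine hne p.natDegree hpd hlt ((-1) ^ p.natDegree * p.coeff 0) ?_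
    apply (algebraMap K Ω).injective
    rw [map_pow, map_pow, ← hprod, map_mul, hc, ← mul_assoc, map_pow, map_neg, map_one,
      ← mul_pow]
    norm_num [← mul_pow]
  · have : f = p := (eq_of_monic_of_dvd_of_natDegree_le hpm hfm hpf (by omega))
    exact this ▸ hp


def wlDg {F : Type} [Field F] (p : F[X][X]) (B : ℕ) : Prop := ∀ j, (p.coeff j).natDegree ≤ B

theorem wlDg_mono {F : Type} [Field F] {p : F[X][X]} {A B : ℕ} (h : wlDg p A) (hAB : A ≤ B) :
    wlDg p B := fun j => (h j).trans hAB

theorem wlDg_mul {F : Type} [Field F] {p q : F[X][X]} {A B : ℕ} (hp : wlDg p A) (hq : wlDg q B) :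
    wlDg (p * q) (A + B) := by
  intro j
  rw [coeff_mul]
  refine natDegree_sum_le_of_forall_le _ _ fun x _ => ?_
  exact natDegree_mul_le.trans (add_le_add (hp _) (hq _))

theorem wlDg_sum {F : Type} [Field F] {ι : Type*} (s : Finset ι) (f : ι → F[X][X]) {A : ℕ}
    (hf : ∀ i ∈ s, wlDg (f i) A) : wlDg (∑ i ∈ s, f i) A := by
  intro j
  rw [finsetSum_coeff]
  exact natDegree_sum_le_of_forall_le _ _ fun x hx => hf x hx j

theorem wlDg_one {F : Type} [Field F] : wlDg (1 : F[X][X]) 0 := by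
  intro j
  rw [coeff_one]; split_ifs <;> simp

theorem wlDg_C {F : Type} [Field F] (a : F[X]) : wlDg (C a) a.natDegree := by
  intro j
  rw [coeff_C]; split_ifs <;> simp

theorem wlDg_X {F : Type} [Field F] : wlDg (X : F[X][X]) 0 := by
  intro j
  rw [coeff_X]; split_ifs <;> simp

theorem wlDg_add {F : Type} [Field F] {p q : F[X][X]} {A : ℕ} (hp : wlDg p A) (hq : wlDg q A) :
    wlDg (p + q) A := fun j => by
  rw [coeff_add]; exact natDegree_add_le_of_degree_le (hp j) (hq j)

theorem wlDg_sub {F : Type} [Field F] {p q : F[X][X]} {A : ℕ} (hp : wlDg p A) (hq : wlDg q A) :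
    wlDg (p - q) A := fun j => by
  rw [coeff_sub]; exact (natDegree_sub_le _ _).trans (max_le (hp j) (hq j))

theorem wlDg_pow {F : Type} [Field F] {p : F[X][X]} {A : ℕ} (hp : wlDg p A) (n : ℕ) :
    wlDg (p ^ n) (n * A) := by
  induction n with
  | zero => simpa using wlDg_one
  | succ n ih => rw [pow_succ]; exact wlDg_mono (wlDg_mul ih hp) (by rw [Nat.succ_mul])

theorem wlDg_prod {F : Type} [Field F] {ι : Type*} (s : Finset ι) (f : ι → F[X][X]) {A : ℕ}
    (hf : ∀ i ∈ s, wlDg (f i) A) : wlDg (∏ i ∈ s, f i) (s.card * A) := by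
  classical
  induction s using Finset.induction_on with
  | empty => simpa using wlDg_one
  | insert a s ha ih =>
    rw [Finset.prod_insert ha, Finset.card_insert_of_notMem ha]
    refine wlDg_mono (wlDg_mul (hf a (by simp)) (ih fun i hi => hf i (by simp [hi]))) ?_
    rw [Nat.succ_mul, add_comm]

theorem wlDg_det {F : Type} [Field F] {e : ℕ} (M : Matrix (Fin e) (Fin e) F[X][X]) {A : ℕ}
    (hM : ∀ i j, wlDg (M i j) A) : wlDg M.det (e * A) := by
  rw [Matrix.det_apply']
  refine wlDg_sum _ _ fun σ _ => ?_
  have h1 : wlDg (∏ i, M (σ i) i) (e * A) := by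
    simpa using wlDg_prod Finset.univ (fun i => M (σ i) i) (fun i _ => hM _ _)
  rcases Int.units_eq_one_or (Equiv.Perm.sign σ) with h | h
  · simpa [h] using h1
  · intro j
    have h2 := h1 j
    rw [← natDegree_neg, ← coeff_neg] at h2
    have h3 : (((Equiv.Perm.sign σ : ℤˣ) : ℤ) : F[X][X]) * (∏ i, M (σ i) i) =
        - ∏ i, M (σ i) i := by rw [h]; simp; ring
    rw [h3]; exact h2

theorem wlDg_comp {F : Type} [Field F] (h : F[X]) {q : F[X][X]} {A : ℕ} (hq : wlDg q A) :
    wlDg ((h.map C).comp q) (h.natDegree * A) := by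
  rw [comp, eval₂_eq_sum_range]
  refine wlDg_sum _ _ fun i hi => ?_
  rw [coeff_map]
  have h0 : wlDg (C (C (h.coeff i)) : F[X][X]) 0 := by simpa using wlDg_C (C (h.coeff i))
  refine wlDg_mono (wlDg_mul h0 (wlDg_pow hq i)) ?_
  rw [zero_add]
  refine Nat.mul_le_mul_right _ ?_
  have := Finset.mem_range.1 hi
  have := natDegree_map_le (f := (C : F →+* F[X])) (p := h)
  omega

/-- a polynomial with small coefficients vanishing at `t` is zero. -/
theorem wl_eval_zero {F : Type} [Field F] (t : F[X]) (p : F[X][X]) (A : ℕ)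
    (hp : wlDg p A) (hA : A < t.natDegree) (h0 : p.eval t = 0) : p = 0 := by
  induction hn : p.natDegree using Nat.strong_induction_on generalizing p with
  | _ n ih =>
    have hdec := p.divX_mul_X_add
    have he : p.divX.eval t * t + p.coeff 0 = 0 := by
      rw [← hdec] at h0
      simpa using h0
    have hdvd : t ∣ p.coeff 0 := by
      have : p.coeff 0 = t * (- p.divX.eval t) := by linear_combination he
      exact Dvd.intro _ this.symm
    have hc0 : p.coeff 0 = 0 := eq_zero_of_dvd_of_natDegree_lt hdvd ((hp 0).trans_lt hA)
    have ht0 : t ≠ 0 := by rintro rfl; simp at hA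
    have he2 : p.divX.eval t = 0 := by
      rw [hc0, add_zero] at he
      exact (mul_eq_zero.1 he).resolve_right ht0
    by_cases hn0 : n = 0
    · rw [eq_C_of_natDegree_eq_zero (hn.trans hn0), hc0, C_0]
    · have hd : p.divX = 0 := by
        refine ih (p.divX.natDegree) ?_ p.divX ?_ he2 rfl
        · rw [natDegree_divX_eq_natDegree_tsub_one]; omega
        · intro j; rw [coeff_divX]; exact hp _
      rw [← hdec, hd, hc0]; simp

theorem wl_reindex {S : Type*} [CommRing S] {e : ℕ} [NeZero e] (hh HH : S) (G : Fin e → S) (y : S)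
    (k : Fin e) :
    ∑ l : Fin e, (if k ≤ l then hh else HH) * G (l - k) * y ^ (l : ℕ) =
      ∑ i : Fin e, if (k : ℕ) + i < e then hh * G i * y ^ ((k : ℕ) + i)
        else HH * G i * y ^ ((k : ℕ) + i - e) := by
  rw [← Equiv.sum_comp (Equiv.addLeft k)
    (fun l : Fin e => (if k ≤ l then hh else HH) * G (l - k) * y ^ (l : ℕ))]
  refine Finset.sum_congr rfl fun i _ => ?_
  show (if k ≤ k + i then hh else HH) * G (k + i - k) * y ^ ((k + i : Fin e) : ℕ) = _
  rw [add_sub_cancel_left]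
  have hk := k.2
  have hi := i.2
  by_cases h2 : (k : ℕ) + i < e
  · have h3 : ((k + i : Fin e) : ℕ) = k + i := by
      rw [Fin.val_add, Nat.mod_eq_of_lt h2]
    have h1 : k ≤ k + i := by rw [Fin.le_def]; omega
    rw [if_pos h1, if_pos h2, h3]
  · have h3 : ((k + i : Fin e) : ℕ) = k + i - e := by
      rw [Fin.val_add, Nat.mod_eq_sub_mod (by omega), Nat.mod_eq_of_lt (by omega)]
    have h1 : ¬ k ≤ k + i := by rw [Fin.le_def]; omega
    rw [if_neg h1, if_neg h2, h3]

theorem wl_nonvanish {F : Type} [Field F] (h : F[X]) (hh : h.Monic) (e : ℕ) [NeZero e]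
    (hprim : ∀ d, 0 < d → d < e → ∀ k : F[X], k.Monic → h ^ d ≠ k ^ e)
    (Q N : ℕ) (hQ : 1 < Q) (t z : F[X]) (ht : t ^ Q - t + X = X ^ N)
    (hz : z ^ e * h = h.comp (X ^ N)) (B : ℕ) (G : Fin e → F[X][X])
    (hG : ∀ i, wlDg (G i) B) (hB : e * (h.natDegree + B) < t.natDegree)
    (h0 : ∑ i : Fin e, (G i).eval t * z ^ (i : ℕ) = 0) : ∀ i, G i = 0 := by
  classical
  have he0 : 0 < e := Nat.pos_of_ne_zero (NeZero.ne e)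
  set T : F[X][X] := X ^ Q - X + C X with hT
  have hTeq : T = X ^ Q + (-(X : F[X][X]) + C (X : F[X])) := by rw [hT]; ring
  have hlow : (-(X : F[X][X]) + C (X : F[X])).degree < (Q : WithBot ℕ) := by
    refine lt_of_le_of_lt (b := ((1 : ℕ) : WithBot ℕ)) ?_ (by exact_mod_cast hQ)
    refine (degree_add_le _ _).trans (max_le ?_ ?_)
    · rw [degree_neg]; exact degree_X_le
    · exact degree_C_le.trans (by norm_num)
  have hTm : T.Monic := by rw [hTeq]; exact monic_X_pow_add hlow
  have hTd : T.natDegree = Q := by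
    rw [hTeq, natDegree_add_eq_left_of_degree_lt, natDegree_X_pow]
    rw [degree_X_pow]; exact hlow
  set hX : F[X][X] := C h
  set hTT : F[X][X] := (h.map C).comp T with hhTT
  have hTTm : hTT.Monic := (hh.map C).comp hTm (by omega)
  have hTTe : hTT.eval t = h.comp (X ^ N) := by
    rw [hhTT, eval_comp, hT]
    simp only [eval_add, eval_sub, eval_pow, eval_X, eval_C, ht]
    rw [eval_map, comp]
  have hdgT : wlDg T 1 := by
    refine wlDg_add (wlDg_sub ?_ (wlDg_mono wlDg_X (by omega))) ?_
    · exact wlDg_mono (wlDg_pow wlDg_X Q) (by omega)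
    · simpa using wlDg_C (X : F[X])
  have hdgTT : wlDg hTT h.natDegree := by simpa using wlDg_comp h hdgT
  let M : Matrix (Fin e) (Fin e) F[X][X] :=
    Matrix.of fun k l => (if k ≤ l then hX else hTT) * G (l - k)
  have hMdg : ∀ k l, wlDg (M k l) (h.natDegree + B) := by
    intro k l
    show wlDg ((if k ≤ l then hX else hTT) * G (l - k)) _
    refine wlDg_mul ?_ (hG _)
    split_ifs
    · exact wlDg_C h
    · exact hdgTT
  have hdet : M.det = 0 := by
    refine wl_eval_zero t _ _ (wlDg_det M hMdg) hB ?_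
    rw [← coe_evalRingHom, RingHom.map_det]
    refine Matrix.exists_mulVec_eq_zero_iff.1 ⟨fun l => z ^ (l : ℕ), ?_, ?_⟩
    · intro hc
      have := congrFun hc 0
      simp at this
    · ext1 k
      have hr := wl_reindex h (h.comp (X ^ N)) (fun i => (G i).eval t) z k
      have : ∑ l : Fin e, (if k ≤ l then h else h.comp (X ^ N)) * (G (l - k)).eval t * z ^ (l : ℕ)
          = 0 := by
        rw [hr]
        have : ∀ i : Fin e, (if (k : ℕ) + i < e then h * (G i).eval t * z ^ ((k : ℕ) + i)
          else h.comp (X ^ N) * (G i).eval t * z ^ ((k : ℕ) + i - e)) =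
            h * z ^ (k : ℕ) * ((G i).eval t * z ^ (i : ℕ)) := by
          intro i
          split_ifs with hki
          · ring
          · rw [← hz]
            have : z ^ (k : ℕ) * z ^ (i : ℕ) = z ^ e * z ^ ((k : ℕ) + i - e) := by
              rw [← pow_add, ← pow_add]; congr 1; omega
            linear_combination (- h * (G i).eval t) * this
        rw [Finset.sum_congr rfl fun i _ => this i, ← Finset.mul_sum, h0, mul_zero]
      simp only [Matrix.mulVec, dotProduct, Matrix.map_apply, RingHom.mapMatrix_apply,
        coe_evalRingHom, Pi.zero_apply, M, eval_mul, Matrix.of_apply]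
      rw [← this]
      refine Finset.sum_congr rfl fun l _ => ?_
      split_ifs
      · simp [hX]
      · rw [hTTe]
  obtain ⟨v, hv0, hv⟩ := Matrix.exists_vecMul_eq_zero_iff.2 hdet
  -- pass to the fraction field
  let Kf := FractionRing F[X][X]
  let ι : F[X][X] →+* Kf := algebraMap F[X][X] Kf
  have hιinj : Function.Injective ι := IsFractionRing.injective _ _
  have hXne : ι hX ≠ 0 := by
    rw [Ne, map_eq_zero_iff ι hιinj]; simpa [hX] using hh.ne_zero
  let H : Kf := ι hTT / ι hX
  have hHX : ι hX * H = ι hTT := mul_div_cancel₀ (ι hTT) hXne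
  have hirr : Irreducible (X ^ e - C H : Kf[X]) := by
    refine wl_irred H e he0 fun d hd hde c hc => ?_
    obtain ⟨k, hk, hk2⟩ := wl_frac_pow (h ^ d) (hh.pow d) (hTT ^ d) (hTTm.pow d) e he0 c (by
      rw [hc, C_pow, map_pow, map_pow, ← mul_pow]
      congr 1
      exact (mul_comm _ _).trans hHX)
    exact hprim d hd hde k hk hk2
  let p : Kf[X] := ∑ k : Fin e, C (ι (v k)) * X ^ (k : ℕ)
  let γ : Kf[X] := ∑ i : Fin e, C (ι (G i)) * X ^ (i : ℕ)
  have hcoef : ∀ (a : Fin e → Kf) (j : Fin e),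
      (∑ k : Fin e, C (a k) * X ^ (k : ℕ) : Kf[X]).coeff j = a j := by
    intro a j
    rw [finsetSum_coeff]
    simp only [coeff_C_mul_X_pow]
    rw [Finset.sum_eq_single j]
    · simp
    · intro b _ hb
      rw [if_neg]
      intro hc; exact hb (Fin.ext hc).symm
    · simp
  have hdegl : ∀ (a : Fin e → Kf),
      (∑ k : Fin e, C (a k) * X ^ (k : ℕ) : Kf[X]).degree < e := by
    intro a
    refine (degree_sum_le _ _).trans_lt ?_
    rw [Finset.sup_lt_iff (by exact WithBot.bot_lt_coe e)]
    intro k _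
    refine (degree_C_mul_X_pow_le _ _).trans_lt ?_
    exact_mod_cast k.2
  have hdvd : (X ^ e - C H : Kf[X]) ∣ C (ι hX) * (p * γ) := by
    have h1 : ∀ k : Fin e, (X ^ e - C H : Kf[X]) ∣
        C (ι hX) * (X ^ (k : ℕ) * γ) - ∑ l : Fin e, C (ι (M k l)) * X ^ (l : ℕ) := by
      intro k
      have hr := wl_reindex (C (ι hX)) (C (ι hTT)) (fun i => C (ι (G i))) (X : Kf[X]) k
      have h2 : ∑ l : Fin e, C (ι (M k l)) * (X : Kf[X]) ^ (l : ℕ) =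
          ∑ l : Fin e, (if k ≤ l then C (ι hX) else C (ι hTT)) * C (ι (G (l - k)))
            * X ^ (l : ℕ) := by
        refine Finset.sum_congr rfl fun l _ => ?_
        simp only [M, Matrix.of_apply]
        split_ifs <;> simp
      rw [h2, hr, Finset.mul_sum, Finset.mul_sum, ← Finset.sum_sub_distrib]
      refine Finset.dvd_sum fun i _ => ?_
      split_ifs with hki
      · convert dvd_zero (X ^ e - C H : Kf[X]) using 1
        ring
      · refine ⟨C (ι hX) * C (ι (G i)) * X ^ ((k : ℕ) + i - e), ?_⟩
        have h3 : (X : Kf[X]) ^ (k : ℕ) * X ^ (i : ℕ) = X ^ e * X ^ ((k : ℕ) + i - e) := by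
          rw [← pow_add, ← pow_add]; congr 1; omega
        rw [← hHX, map_mul]
        linear_combination (C (ι hX) * C (ι (G i))) * h3
    have h4 : C (ι hX) * (p * γ) = ∑ k : Fin e, C (ι (v k)) *
        (C (ι hX) * (X ^ (k : ℕ) * γ) - ∑ l : Fin e, C (ι (M k l)) * X ^ (l : ℕ)) := by
      simp only [mul_sub, Finset.sum_sub_distrib]
      have h5 : ∑ k : Fin e, C (ι (v k)) * ∑ l : Fin e, C (ι (M k l)) * (X : Kf[X]) ^ (l : ℕ)
          = 0 := by
        simp only [Finset.mul_sum]
        rw [Finset.sum_comm]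
        refine Finset.sum_eq_zero fun l _ => ?_
        have h6 : ∑ k, v k * M k l = 0 := congrFun hv l
        have h7 : ∑ k : Fin e, C (ι (v k)) * (C (ι (M k l)) * (X : Kf[X]) ^ (l : ℕ)) =
            C (ι (∑ k, v k * M k l)) * X ^ (l : ℕ) := by
          simp only [map_sum, map_mul, Finset.sum_mul, mul_assoc]
        rw [h7, h6]; simp
      rw [h5, sub_zero]
      simp only [p, Finset.sum_mul, Finset.mul_sum]
      refine Finset.sum_congr rfl fun k _ => ?_
      ring
    rw [h4]
    exact Finset.dvd_sum fun k _ => Dvd.dvd.mul_left (h1 k) _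
  have hdege : (X ^ e - C H : Kf[X]).degree = e := degree_X_pow_sub_C he0 H
  have hsmall : ∀ (a : Fin e → Kf), (X ^ e - C H : Kf[X]) ∣ ∑ k : Fin e, C (a k) * X ^ (k : ℕ) →
      ∀ k, a k = 0 := by
    intro a ha k
    have := eq_zero_of_dvd_of_degree_lt ha (by rw [hdege]; exact hdegl a)
    rw [← hcoef a k, this, coeff_zero]
  rcases hirr.prime.dvd_or_dvd hdvd with h1 | h1
  · exfalso
    have := eq_zero_of_dvd_of_degree_lt h1 (by
      rw [hdege]; exact degree_C_le.trans_lt (by exact_mod_cast he0))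
    exact hXne (by simpa using this)
  · rcases hirr.prime.dvd_or_dvd h1 with h2 | h2
    · exfalso
      apply hv0
      ext1 k
      exact hιinj ((hsmall _ h2 k).trans (map_zero ι).symm)
    · intro i
      exact hιinj ((hsmall _ h2 i).trans (map_zero ι).symm)


theorem wl_frob_dvd {E : Type} [Field E] (p : ℕ) [Fact p.Prime] [CharP E p] (k : ℕ)
    (f : E[X]) (w : ℕ) :
    X ^ (p ^ k) ∣ (f ^ (p ^ k)) ^ w - (C (f.eval 0) ^ (p ^ k)) ^ w := by
  refine dvd_trans ?_ (sub_dvd_pow_sub_pow _ _ w)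
  rw [← sub_pow_char_pow]
  refine pow_dvd_pow_of_dvd ?_ _
  rw [X_dvd_iff]
  simp [coeff_zero_eq_eval_zero]

/-- basis vectors for the bivariate auxiliary function -/
noncomputable def wlPsi {F : Type} [Field F] (h t : F[X]) (e u : ℕ) (a b : F) (i j k : ℕ) :
    F[X][X] :=
  (C X + X) ^ k * (C (C b) + t.map C) ^ j * C (C (a ^ i)) *
    ((h.map C).comp (C X + X)) ^ (u * i) * C (h ^ (u * (e - 1 - i)))

theorem wlPsi_dg {F : Type} [Field F] (h t : F[X]) (e u : ℕ) (a b : F) (i j k : ℕ) (hi : i < e) :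
    wlDg (wlPsi h t e u a b i j k) (k + u * e * h.natDegree) := by
  unfold wlPsi
  have h1 : wlDg (C X + X : F[X][X]) 1 :=
    wlDg_add (by simpa using wlDg_C (X : F[X])) (wlDg_mono wlDg_X (by omega))
  have h2 : wlDg (C (C b) + t.map C : F[X][X]) 0 := by
    refine wlDg_add (by simpa using wlDg_C (C b)) ?_
    intro l; simp
  have h3 : wlDg (C (C (a ^ i)) : F[X][X]) 0 := by simpa using wlDg_C (C (a ^ i))
  have h4 := wlDg_pow (wlDg_comp h h1) (u * i)
  have h5 : wlDg (C (h ^ (u * (e - 1 - i)))) (u * (e - 1 - i) * h.natDegree) :=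
    wlDg_mono (wlDg_C _) (natDegree_pow_le)
  refine wlDg_mono (wlDg_mul (wlDg_mul (wlDg_mul (wlDg_mul (wlDg_pow h1 k) (wlDg_pow h2 j)) h3) h4)
    h5) ?_
  have : u * i + u * (e - 1 - i) ≤ u * e := by
    rw [← mul_add]; exact Nat.mul_le_mul_left _ (by omega)
  nlinarith [Nat.mul_le_mul_right h.natDegree this]

theorem wlPsi_eval {F : Type} [Field F] (h t : F[X]) (e u : ℕ) (a b : F) (i j k : ℕ) (hi : i < e)
    {E : Type} [Field E] [Algebra F E] (p : ℕ) [Fact p.Prime] [CharP E p] (r : ℕ) (w v : ℕ)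
    (hw : w = u + p ^ r * v) (x : E)
    (hx : (aeval x h) ^ w = algebraMap F E a) (ht : aeval x t = algebraMap F E b)
    (hta : (t.map (algebraMap F E)).comp (X + C x) = t.map (algebraMap F E) + C (aeval x t)) :
    X ^ (p ^ r) ∣ C ((aeval x h) ^ (u * (e - 1))) *
      ((X ^ k * t ^ j * (h ^ w) ^ i).map (algebraMap F E)).comp (X + C x) -
      (wlPsi h t e u a b i j k).map (aeval x : F[X] →ₐ[F] E).toRingHom := by
  have e1 : (wlPsi h t e u a b i j k).map (aeval x : F[X] →ₐ[F] E).toRingHom =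
      (X + C x) ^ k * (t.map (algebraMap F E) + C (aeval x t)) ^ j * C (algebraMap F E a) ^ i *
      ((h.map (algebraMap F E)).comp (X + C x)) ^ (u * i) * C (aeval x h) ^ (u * (e - 1 - i)) := by
    have e2 : ((aeval x : F[X] →ₐ[F] E).toRingHom).comp (C : F →+* F[X]) = algebraMap F E := by
      ext c; simp
    have e3 : ∀ c : F, (aeval x : F[X] →ₐ[F] E).toRingHom (C c) = algebraMap F E c := by simp
    have e4 : ∀ c : F[X], (aeval x : F[X] →ₐ[F] E).toRingHom c = aeval x c := fun _ => rfl
    unfold wlPsi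
    simp only [Polynomial.map_mul, Polynomial.map_pow, Polynomial.map_add, map_C, map_X,
      Polynomial.map_map, map_comp, e2, e3, map_pow]
    rw [e4, e4, aeval_X, ht, add_comm (C x) X, add_comm (C (algebraMap F E b))]
  rw [e1]
  set H := (h.map (algebraMap F E)).comp (X + C x) with hH
  have hH0 : H.eval 0 = aeval x h := by
    rw [hH, eval_comp]; simp
  have hd := wl_frob_dvd p r H (v * i)
  rw [hH0] at hd
  simp only [Polynomial.map_mul, Polynomial.map_pow, map_X, mul_comp, pow_comp, X_comp, hta, ← hH]
  set y := aeval x h with hy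
  set T := t.map (algebraMap F E) + C (aeval x t)
  obtain ⟨d, hd⟩ := hd
  have ha : C (algebraMap F E a) = C y ^ (u + p ^ r * v) := by rw [← hx, hw, map_pow]
  have hexp : u * (e - 1) = u * i + u * (e - 1 - i) := by rw [← mul_add]; congr 1; omega
  rw [ha, hw, hexp]
  refine ⟨d * C y ^ (u * i + u * (e - 1 - i)) * H ^ (u * i) * (X + C x) ^ k * T ^ j, ?_⟩
  rw [map_pow]
  have e5 : ∀ z : E[X], (z ^ (u + p ^ r * v)) ^ i = z ^ (u * i) * (z ^ p ^ r) ^ (v * i) := by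
    intro z; rw [← pow_mul, ← pow_mul, ← pow_add]; congr 1; ring
  rw [e5, e5]
  linear_combination (C y ^ (u * i + u * (e - 1 - i)) * H ^ (u * i) * (X + C x) ^ k * T ^ j) * hd

theorem wl_stepanov {F : Type} [Field F] (h : F[X]) (hh : h.Monic) (e : ℕ) [NeZero e]
    (hprim : ∀ d, 0 < d → d < e → ∀ k : F[X], k.Monic → h ^ d ≠ k ^ e)
    {E : Type} [Field E] [Algebra F E] (p : ℕ) [Fact p.Prime] [CharP E p]
    (Q N : ℕ) (hQ : 1 < Q) (t : F[X]) (ht : t ^ Q - t + X = X ^ N)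
    (r w u v : ℕ) (hw : w = u + p ^ r * v) (hu : u ≤ p ^ r)
    (hz : (h ^ w) ^ e * h = h.comp (X ^ N))
    (hta : ∀ x : E, (t.map (algebraMap F E)).comp (X + C x) =
      t.map (algebraMap F E) + C (aeval x t))
    (B J : ℕ) (hB : e * (h.natDegree + B) < t.natDegree)
    (hJ : p ^ r * (B + p ^ r * e * h.natDegree) < e * (J * B))
    (a b : F) (ha : a ≠ 0) (Z : Finset E)
    (hZ : ∀ x ∈ Z, (aeval x h) ^ w = algebraMap F E a ∧ aeval x t = algebraMap F E b) :
    Z.card * p ^ r ≤ B + (J - 1) * t.natDegree + e * (w * h.natDegree) := by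
  classical
  set M := p ^ r with hM
  set D := B + M * e * h.natDegree with hD
  let V := Fin e × Fin J × Fin B
  let Ψ : V → F[X][X] := fun v => wlPsi h t e u a b v.1 v.2.1 v.2.2
  let Φ : (V → F) →ₗ[F] (Fin M × Fin D → F) :=
    { toFun := fun P md => ∑ v, P v * ((Ψ v).coeff md.1).coeff md.2
      map_add' := by
        intro P P'; ext md; simp [add_mul, Finset.sum_add_distrib]
      map_smul' := by
        intro c P; ext md; simp [mul_assoc, Finset.mul_sum] }
  have hker : LinearMap.ker Φ ≠ ⊥ := by
    apply LinearMap.ker_ne_bot_of_finrank_lt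
    simpa [V] using hJ
  obtain ⟨P, hPk, hP0⟩ := (Submodule.ne_bot_iff _).1 hker
  have hΨ : ∀ m < M, (∑ v, C (C (P v)) * Ψ v).coeff m = 0 := by
    intro m hm
    ext d
    rw [finsetSum_coeff, finsetSum_coeff, coeff_zero]
    simp only [coeff_C_mul]
    by_cases hd : d < D
    · have := congrFun (LinearMap.mem_ker.1 hPk) (⟨m, hm⟩, ⟨d, hd⟩)
      simpa [Φ] using this
    · refine Finset.sum_eq_zero fun v _ => ?_
      rw [coeff_eq_zero_of_natDegree_lt, mul_zero]
      refine (wlPsi_dg h t e u a b v.1 v.2.1 v.2.2 v.1.2 m).trans_lt ?_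
      have h1 := v.2.2.2
      have : u * e * h.natDegree ≤ M * e * h.natDegree := by gcongr
      omega
  let R : F[X] := ∑ v : V, C (P v) * (X ^ (v.2.2 : ℕ) * t ^ (v.2.1 : ℕ) * (h ^ w) ^ (v.1 : ℕ))
  have hR0 : R ≠ 0 := by
    intro hR
    apply hP0
    let G : Fin e → F[X][X] := fun i => ∑ jk : Fin J × Fin B,
      C (C (P (i, jk)) * X ^ (jk.2 : ℕ)) * X ^ (jk.1 : ℕ)
    have hG := wl_nonvanish h hh e hprim Q N hQ t (h ^ w) ht hz B G (by
      intro i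
      refine wlDg_sum _ _ fun jk _ => ?_
      refine wlDg_mono (wlDg_mul (wlDg_C _) (wlDg_pow wlDg_X _)) ?_
      have := natDegree_C_mul_X_pow_le (P (i, jk)) (jk.2 : ℕ)
      have := jk.2.2
      omega) hB (by
      rw [← hR]
      simp only [R, V]
      rw [Fintype.sum_prod_type]
      refine Finset.sum_congr rfl fun i _ => ?_
      simp only [G, eval_finsetSum, Finset.sum_mul]
      refine Finset.sum_congr rfl fun jk _ => ?_
      simp only [eval_mul, eval_C, eval_pow, eval_X]
      ring)
    ext ⟨i, j, k⟩
    have h1 : ((G i).coeff j).coeff k = 0 := by rw [hG]; simp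
    simp only [G, finsetSum_coeff, coeff_C_mul_X_pow] at h1
    rw [Finset.sum_eq_single (j, k)] at h1
    · simpa using h1
    · rintro ⟨j1, k1⟩ _ hne
      by_cases hj : (j : ℕ) = j1
      · have hk : ¬ (k : ℕ) = k1 := by
          intro hk; exact hne (Prod.ext (Fin.ext hj.symm) (Fin.ext hk.symm))
        simp [hj, coeff_C_mul_X_pow, hk]
      · simp [hj]
    · simp
  have hRd : R.natDegree ≤ B + (J - 1) * t.natDegree + e * (w * h.natDegree) := by
    refine natDegree_sum_le_of_forall_le _ _ fun v _ => ?_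
    refine (natDegree_C_mul_le _ _).trans ?_
    refine natDegree_mul_le.trans (add_le_add (natDegree_mul_le.trans (add_le_add ?_ ?_)) ?_)
    · exact (natDegree_X_pow_le _).trans v.2.2.2.le
    · refine natDegree_pow_le.trans (Nat.mul_le_mul_right _ ?_)
      have := v.2.1.2; omega
    · refine natDegree_pow_le.trans (Nat.mul_le_mul v.1.2.le ?_)
      exact natDegree_pow_le
  have hroot : ∀ x ∈ Z, (X - C x) ^ M ∣ R.map (algebraMap F E) := by
    intro x hx
    rw [X_sub_C_pow_dvd_iff]
    obtain ⟨hx1, hx2⟩ := hZ x hx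
    have hy : (aeval x h) ^ (u * (e - 1)) ≠ 0 := by
      by_cases hw0 : w = 0
      · have : u = 0 := by omega
        simp [this]
      · apply pow_ne_zero
        intro h0
        rw [h0, zero_pow hw0] at hx1
        exact ha ((map_eq_zero _).1 hx1.symm)
    have hunit : IsUnit (C ((aeval x h) ^ (u * (e - 1)))) := isUnit_C.2 hy.isUnit
    rw [← hunit.dvd_mul_left]
    have h1 : X ^ M ∣ (∑ v, C (C (P v)) * Ψ v).map (aeval x : F[X] →ₐ[F] E).toRingHom := by
      rw [X_pow_dvd_iff]
      intro d hd
      rw [coeff_map, hΨ d hd, map_zero]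
    rw [← dvd_iff_dvd_of_dvd_sub (?_ : X ^ M ∣ _ - _)] at h1
    · exact h1
    · have h2 : (∑ v, C (C (P v)) * Ψ v).map (aeval x : F[X] →ₐ[F] E).toRingHom =
          ∑ v, C (algebraMap F E (P v)) * (Ψ v).map (aeval x : F[X] →ₐ[F] E).toRingHom := by
        rw [Polynomial.map_sum]
        refine Finset.sum_congr rfl fun v _ => ?_
        rw [Polynomial.map_mul, map_C]
        congr 2
        exact aeval_C x (P v)
      have h3 : (R.map (algebraMap F E)).comp (X + C x) = ∑ v : V, C (algebraMap F E (P v)) *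
          ((X ^ (v.2.2 : ℕ) * t ^ (v.2.1 : ℕ) * (h ^ w) ^ (v.1 : ℕ)).map
            (algebraMap F E)).comp (X + C x) := by
        simp only [R]
        rw [Polynomial.map_sum, Polynomial.sum_comp]
        refine Finset.sum_congr rfl fun v _ => ?_
        rw [Polynomial.map_mul, map_C, mul_comp, C_comp]
      rw [h2, h3, Finset.mul_sum, ← Finset.sum_sub_distrib]
      refine Finset.dvd_sum fun q _ => ?_
      have h4 := wlPsi_eval h t e u a b q.1 q.2.1 q.2.2 q.1.2 p r w v hw x hx1 hx2 (hta x)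
      convert h4.mul_left (C (algebraMap F E (P q))) using 1
      ring
  have hprod : ∏ x ∈ Z, (X - C x) ^ M ∣ R.map (algebraMap F E) := by
    refine Finset.prod_dvd_of_coprime ?_ hroot
    intro x _ y _ hxy
    exact (isCoprime_X_sub_C_of_isUnit_sub (sub_ne_zero.2 hxy).isUnit).pow
  have hle := natDegree_le_of_dvd hprod ((Polynomial.map_ne_zero_iff (algebraMap F E).injective).2 hR0)
  rw [natDegree_prod_of_monic _ _ (fun x _ => (monic_X_sub_C x).pow M), natDegree_map] at hle
  simp only [natDegree_pow, natDegree_X_sub_C, Finset.sum_const, smul_eq_mul, mul_one] at hle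
  exact hle.trans hRd


/-- the trace polynomial -/
noncomputable def wlT (F : Type) [Field F] [Fintype F] (ν : ℕ) : F[X] :=
  ∑ i ∈ Finset.range ν, X ^ (Fintype.card F ^ i)

theorem wlT_rel (F : Type) [Field F] [Fintype F] (ν : ℕ) :
    wlT F ν ^ Fintype.card F - wlT F ν + X = X ^ (Fintype.card F ^ ν) := by
  rw [← FiniteField.expand_card]
  unfold wlT
  rw [map_sum]
  simp only [map_pow, expand_X, ← pow_mul]
  have h1 := Finset.sum_range_succ (fun i => (X : F[X]) ^ (Fintype.card F ^ i)) ν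
  have h2 := Finset.sum_range_succ' (fun i => (X : F[X]) ^ (Fintype.card F ^ i)) ν
  simp only [pow_zero, pow_one] at h2
  have h3 : ∀ i, Fintype.card F * Fintype.card F ^ i = Fintype.card F ^ (i + 1) := by
    intro i; rw [pow_succ, mul_comm]
  simp only [h3]
  linear_combination h1 - h2

theorem wlT_natDegree (F : Type) [Field F] [Fintype F] (ν : ℕ) :
    (wlT F (ν + 1)).natDegree = Fintype.card F ^ ν := by
  have hQ : 1 < Fintype.card F := Fintype.one_lt_card
  unfold wlT
  rw [Finset.sum_range_succ, natDegree_add_eq_right_of_degree_lt, natDegree_X_pow]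
  rw [degree_X_pow]
  refine (degree_sum_le _ _).trans_lt ?_
  rw [Finset.sup_lt_iff (by exact WithBot.bot_lt_coe _)]
  intro i hi
  rw [degree_X_pow]
  exact_mod_cast Nat.pow_lt_pow_right hQ (Finset.mem_range.1 hi)

theorem wl_expand (F : Type) [Field F] [Fintype F] (h : F[X]) (ν : ℕ) :
    h.comp (X ^ (Fintype.card F ^ ν)) = h ^ (Fintype.card F ^ ν) := by
  rw [← expand_eq_comp_X_pow]
  induction ν with
  | zero => simp
  | succ n ih => rw [pow_succ, mul_comm, expand_mul, ih, map_pow, FiniteField.expand_card,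
      ← pow_mul]

theorem wlT_add (F : Type) [Field F] [Fintype F] {E : Type} [Field E] [Algebra F E]
    (ν : ℕ) (x : E) : ((wlT F ν).map (algebraMap F E)).comp (X + C x) =
      (wlT F ν).map (algebraMap F E) + C (aeval x (wlT F ν)) := by
  obtain ⟨p, hp⟩ := CharP.exists F
  obtain ⟨f, hpp, hf⟩ := FiniteField.card F p
  have := Fact.mk hpp
  have : CharP E p := charP_of_injective_algebraMap (algebraMap F E).injective p
  unfold wlT
  simp only [Polynomial.map_sum, Polynomial.map_pow, map_X, Polynomial.sum_comp, pow_comp, X_comp,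
    map_sum, map_pow, aeval_X, ← Finset.sum_add_distrib]
  refine Finset.sum_congr rfl fun i _ => ?_
  rw [hf, ← pow_mul, add_pow_char_pow]

theorem wl_stepanov_bound (F : Type) [Field F] [Fintype F] (h : F[X]) (hh : h.Monic) (e : ℕ)
    (he : e ∣ Fintype.card F - 1)
    (hprim : ∀ d, 0 < d → d < e → ∀ k : F[X], k.Monic → h ^ d ≠ k ^ e)
    (E : Type) [Field E] [Algebra F E] :
    ∃ (c : ℝ) (μ₀ : ℕ), ∀ μ ≥ μ₀, ∀ a b : F, a ≠ 0 → ∀ Z : Finset E,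
      (∀ x ∈ Z, (aeval x h) ^ ((Fintype.card F ^ (2 * μ) - 1) / e) = algebraMap F E a ∧
        aeval x (wlT F (2 * μ)) = algebraMap F E b) →
      (Z.card : ℝ) ≤ (Fintype.card F : ℝ) ^ (2 * μ) / (e * Fintype.card F) +
        c * (Fintype.card F : ℝ) ^ μ := by
  classical
  obtain ⟨p, hp⟩ := CharP.exists F
  obtain ⟨f, hpp, hf⟩ := FiniteField.card F p
  have := Fact.mk hpp
  have : CharP E p := charP_of_injective_algebraMap (algebraMap F E).injective p
  have hQ : 1 < Fintype.card F := Fintype.one_lt_card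
  set Q := Fintype.card F with hQdef
  have he0 : 0 < e := Nat.pos_of_dvd_of_pos he (by omega)
  have : NeZero e := ⟨he0.ne'⟩
  set D := h.natDegree with hD
  set K := e * (D + e * D + 1) with hK
  set c := K + 1 with hc
  have hKc : K < Q ^ c := (Nat.lt_pow_self hQ).trans (Nat.pow_lt_pow_right hQ (by omega))
  refine ⟨(1 + D) * (Q : ℝ) ^ c, c + 1, fun μ hμ a b ha Z hZ => ?_⟩
  set M := Q ^ (μ - c) with hM
  have hMp : M = p ^ (f * (μ - c)) := by rw [hM, hf, pow_mul]
  have hM0 : 0 < M := by positivity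
  set N := Q ^ (2 * μ) with hN
  set w := (N - 1) / e with hw
  set B := M ^ 2 * e * D + 1 with hB
  have hdt : (wlT F (2 * μ)).natDegree = Q ^ (2 * μ - 1) := by
    have := wlT_natDegree F (2 * μ - 1)
    rwa [Nat.sub_add_cancel (by omega)] at this
  have hB2 : e * (D + B) < Q ^ (2 * μ - 1) := by
    have h1 : e * (D + B) ≤ K * M ^ 2 := by
      have : 1 ≤ M ^ 2 := Nat.one_le_pow _ _ hM0
      calc e * (D + B) = e * (D * 1 + M ^ 2 * e * D + 1) := by rw [hB]; ring
        _ ≤ e * (D * M ^ 2 + M ^ 2 * e * D + M ^ 2) := by gcongr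
        _ = K * M ^ 2 := by rw [hK]; ring
    have h2 : K * M ^ 2 < Q ^ c * M ^ 2 := Nat.mul_lt_mul_of_pos_right hKc (by positivity)
    have h3 : Q ^ c * M ^ 2 ≤ Q ^ (2 * μ - 1) := by
      rw [hM, ← pow_mul, ← pow_add]
      exact Nat.pow_le_pow_right (by omega) (by omega)
    omega
  have hwe : w * e = N - 1 := by
    refine Nat.div_mul_cancel (he.trans ?_)
    have := Nat.sub_dvd_pow_sub_pow Q 1 (2 * μ)
    rwa [one_pow] at this
  have hN0 : 0 < N := by positivity
  have key := wl_stepanov h hh e hprim (E := E) p Q N hQ (wlT F (2 * μ)) (wlT_rel F _)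
    (f * (μ - c)) w (w % M) (w / M) (by rw [← hMp]; exact (Nat.mod_add_div w M).symm)
    (by rw [← hMp]; exact (Nat.mod_lt _ hM0).le)
    (by rw [← pow_mul, hwe, ← pow_succ, Nat.sub_add_cancel hN0, hN, wl_expand])
    (fun x => wlT_add F _ x) B (M / e + 1) (by rw [hdt]; exact hB2)
    (by
      rw [← hMp]
      have h1 : M + 1 ≤ e * (M / e + 1) := Nat.lt_mul_div_succ M he0
      calc M * (B + M * e * D) < M * B + B := by
            rw [mul_add]; gcongr; rw [hB]; nlinarith
        _ = (M + 1) * B := by ring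
        _ ≤ e * (M / e + 1) * B := by gcongr
        _ = _ := by ring) a b ha Z hZ
  rw [← hMp, hdt, Nat.add_sub_cancel, ← mul_assoc e w, mul_comm e w, hwe] at key
  have hBN : B ≤ N := by
    have h1 : B ≤ e * (D + B) := by nlinarith
    have h2 : Q ^ (2 * μ - 1) ≤ N := Nat.pow_le_pow_right (by omega) (by omega)
    omega
  have key2 : (Z.card : ℝ) * M ≤ N + (M / e) * (N / Q) + N * D := by
    have h1 : ((Q ^ (2 * μ - 1) : ℕ) : ℝ) = N / Q := by
      have : N = Q ^ (2 * μ - 1) * Q := by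
        rw [← pow_succ, hN]; congr 1; omega
      rw [this]; push_cast; field_simp
    have h2 : ((M / e : ℕ) : ℝ) ≤ M / e := Nat.cast_div_le
    have h3 : ((N - 1 : ℕ) : ℝ) ≤ N := by exact_mod_cast Nat.sub_le N 1
    have h4 : (Z.card : ℝ) * M ≤ B + (M / e : ℕ) * (Q ^ (2 * μ - 1) : ℕ) + (N - 1 : ℕ) * D := by
      exact_mod_cast key
    have h5 : (B : ℝ) ≤ N := by exact_mod_cast hBN
    refine h4.trans ?_
    rw [h1]
    gcongr
  have hMr : (0 : ℝ) < M := by exact_mod_cast hM0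
  have hQr : (0 : ℝ) < Q := by positivity
  have her : (0 : ℝ) < e := by exact_mod_cast he0
  have hNM : (N : ℝ) = (Q : ℝ) ^ c * (Q : ℝ) ^ μ * M := by
    rw [hN, hM]; push_cast
    rw [← pow_add, ← pow_add]; congr 1; omega
  have e1 : (Q : ℝ) ^ (2 * μ) = N := by rw [hN]; push_cast; rfl
  rw [e1, ← mul_le_mul_iff_left₀ hMr]
  refine key2.trans (le_of_eq ?_)
  have e2 : (N : ℝ) / (e * Q) * M = (M / e) * (N / Q) := by field_simp
  rw [add_mul, e2]
  linear_combination (1 + (D : ℝ)) * hNM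


section
variable (F : Type) [Field F] [Fintype F] {E : Type} [Field E] [Algebra F E]

theorem wl_charE : ∃ p f : ℕ, p.Prime ∧ CharP E p ∧ 0 < f ∧ Fintype.card F = p ^ f := by
  obtain ⟨p, hp⟩ := CharP.exists F
  obtain ⟨f, hpp, hf⟩ := FiniteField.card F p
  exact ⟨p, f, hpp, charP_of_injective_algebraMap (algebraMap F E).injective p, f.2, hf⟩

/-- Frobenius on polynomials and elements: `x ↦ x^Q` is a ring hom. -/
theorem wl_frob_hom : ∃ φ : E →+* E, ∀ x, φ x = x ^ Fintype.card F := by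
  obtain ⟨p, f, hp, hc, hf, hQ⟩ := wl_charE F (E := E)
  have := Fact.mk hp
  refine ⟨iterateFrobenius E p f, fun x => ?_⟩
  rw [iterateFrobenius_def, hQ]

theorem wl_fixed (x : E) (hx : x ^ Fintype.card F = x) : ∃ a : F, algebraMap F E a = x := by
  have h1 : (X ^ Fintype.card F - X : F[X]) = ∏ a : F, (X - C a) := by
    have h := FiniteField.roots_X_pow_card_sub_X F
    have hm : (X ^ Fintype.card F - X : F[X]).Monic :=
      monic_X_pow_sub (by rw [degree_X]; exact_mod_cast Fintype.one_lt_card)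
    rw [← prod_multiset_X_sub_C_of_monic_of_roots_card_eq hm (by
      rw [h, FiniteField.X_pow_card_sub_X_natDegree_eq F Fintype.one_lt_card]
      exact Finset.card_univ), h]
    rfl
  have h2 := congrArg (aeval x) h1
  simp only [map_sub, map_pow, aeval_X, hx, sub_self, map_prod, aeval_C] at h2
  obtain ⟨a, -, ha⟩ := Finset.prod_eq_zero_iff.1 h2.symm
  exact ⟨a, (sub_eq_zero.1 ha).symm⟩

theorem wl_aeval_pow (h : F[X]) (x : E) (i : ℕ) :
    aeval (x ^ (Fintype.card F ^ i)) h = (aeval x h) ^ (Fintype.card F ^ i) := by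
  have := congrArg (aeval x) (wl_expand F h i)
  rw [aeval_comp] at this
  simpa using this

open Classical in
/-- points over the extension of degree ν -/
noncomputable def wlE (E : Type) [Field E] [Algebra F E] (ν : ℕ) : Finset E :=
  (X ^ (Fintype.card F ^ ν) - X : E[X]).roots.toFinset

theorem mem_wlE {ν : ℕ} (hν : ν ≠ 0) {x : E} : x ∈ wlE F E ν ↔ x ^ (Fintype.card F ^ ν) = x := by
  classical
  unfold wlE
  rw [Multiset.mem_toFinset, mem_roots
    (FiniteField.X_pow_card_pow_sub_X_ne_zero E hν Fintype.one_lt_card)]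
  simp [sub_eq_zero]

theorem card_wlE [IsAlgClosed E] {ν : ℕ} (hν : ν ≠ 0) :
    (wlE F E ν).card = Fintype.card F ^ ν := by
  classical
  obtain ⟨p, f, hp, hc, hf, hQ⟩ := wl_charE F (E := E)
  have hsep : (X ^ (Fintype.card F ^ ν) - X : E[X]).Separable := by
    refine galois_poly_separable p _ ?_
    rw [hQ, ← pow_mul]
    exact dvd_pow_self p (Nat.mul_ne_zero hf.ne' hν)
  unfold wlE
  rw [Multiset.toFinset_card_of_nodup (nodup_roots hsep)]
  rw [splits_iff_card_roots.1 (IsAlgClosed.splits _),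
    FiniteField.X_pow_card_pow_sub_X_natDegree_eq E hν Fintype.one_lt_card]

/-- lift to F[X] -/
theorem wl_lift (P : E[X]) (hP : ∀ k, P.coeff k ^ Fintype.card F = P.coeff k) :
    ∃ c : F[X], c.map (algebraMap F E) = P := by
  have : P ∈ lifts (algebraMap F E) := by
    rw [lifts_iff_coeff_lifts]
    intro k
    obtain ⟨a, ha⟩ := wl_fixed F _ (hP k)
    exact ⟨a, ha⟩
  exact (mem_lifts P).1 this

noncomputable def wlcE (ν : ℕ) (x : E) : E[X] :=
  ∏ i ∈ Finset.range ν, (X - C (x ^ (Fintype.card F ^ i)))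

theorem wlcE_lift {ν : ℕ} (hν : ν ≠ 0) {x : E} (hx : x ^ (Fintype.card F ^ ν) = x) :
    ∃ c : F[X], c.map (algebraMap F E) = wlcE F ν x := by
  obtain ⟨φ, hφ⟩ := wl_frob_hom F (E := E)
  refine wl_lift F _ fun k => ?_
  rw [← hφ, ← coeff_map]
  congr 1
  unfold wlcE
  rw [Polynomial.map_prod]
  obtain ⟨n, rfl⟩ := Nat.exists_eq_succ_of_ne_zero hν
  rw [Finset.prod_range_succ, Finset.prod_range_succ']
  simp only [Polynomial.map_sub, map_X, map_C, hφ, ← pow_mul, ← pow_succ]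
  rw [hx]; simp

open Classical in
noncomputable def wlc (ν : ℕ) (x : E) : F[X] :=
  if h : ∃ c : F[X], c.map (algebraMap F E) = wlcE F ν x then h.choose else 1

theorem wlc_map {ν : ℕ} (hν : ν ≠ 0) {x : E} (hx : x ^ (Fintype.card F ^ ν) = x) :
    (wlc F ν x).map (algebraMap F E) = wlcE F ν x := by
  have h := wlcE_lift F hν hx
  unfold wlc
  rw [dif_pos h]; exact h.choose_spec

theorem wlcE_monic (ν : ℕ) (x : E) : (wlcE F ν x).Monic := monic_prod_X_sub_C _ _

theorem wlcE_natDegree (ν : ℕ) (x : E) : (wlcE F ν x).natDegree = ν := by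
  unfold wlcE
  rw [natDegree_prod_of_monic _ _ fun i _ => monic_X_sub_C _]
  simp only [natDegree_X_sub_C]
  simp

theorem wlc_monic {ν : ℕ} (hν : ν ≠ 0) {x : E} (hx : x ^ (Fintype.card F ^ ν) = x) :
    (wlc F ν x).Monic := by
  have := wlcE_monic F ν x
  rw [← wlc_map F hν hx] at this
  exact monic_of_injective (algebraMap F E).injective this

theorem wlc_natDegree {ν : ℕ} (hν : ν ≠ 0) {x : E} (hx : x ^ (Fintype.card F ^ ν) = x) :
    (wlc F ν x).natDegree = ν := by
  rw [← natDegree_map (algebraMap F E), wlc_map F hν hx, wlcE_natDegree]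

theorem wlc_nextCoeff {ν : ℕ} (hν : ν ≠ 0) {x : E} (hx : x ^ (Fintype.card F ^ ν) = x) :
    algebraMap F E (-(wlc F ν x).nextCoeff) = aeval x (wlT F ν) := by
  rw [map_neg, ← nextCoeff_map_eq, wlc_map F hν hx, wlcE, prod_X_sub_C_nextCoeff, neg_neg]
  simp [wlT]

/-- resultant -/
noncomputable def wlRes {F : Type} [Field F] (h u : F[X]) : F := resultant h u h.natDegree u.natDegree

theorem wlRes_eq [IsAlgClosed E] (h u : F[X]) (hh : h.Monic) :
    algebraMap F E (wlRes h u) = ((h.map (algebraMap F E)).roots.map (fun z => aeval z u)).prod := by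
  unfold wlRes
  rw [← resultant_map_map]
  have h1 := resultant_eq_prod_eval (h.map (algebraMap F E)) (u.map (algebraMap F E)) u.natDegree
    (natDegree_map_le) (IsAlgClosed.splits _)
  rw [natDegree_map, (hh.map _).leadingCoeff, one_pow, one_mul] at h1
  rw [h1]
  simp

theorem wlRes_mul (h u v : F[X]) (hh : h.Monic) : wlRes h (u * v) = wlRes h u * wlRes h v := by
  apply (algebraMap F (AlgebraicClosure F)).injective
  rw [map_mul, wlRes_eq F _ _ hh, wlRes_eq F _ _ hh, wlRes_eq F _ _ hh, ← Multiset.prod_map_mul]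
  simp

theorem wlRes_one (h : F[X]) (hh : h.Monic) : wlRes h 1 = 1 := by
  apply (algebraMap F (AlgebraicClosure F)).injective
  rw [wlRes_eq F _ _ hh]
  simp

theorem wlRes_congr (h s u v : F[X]) (hh : h.Monic) (hs : ∃ k, h ∣ s ^ k) (huv : s ∣ u - v) :
    wlRes h u = wlRes h v := by
  apply (algebraMap F (AlgebraicClosure F)).injective
  rw [wlRes_eq F _ _ hh, wlRes_eq F _ _ hh]
  congr 1
  refine Multiset.map_congr rfl fun z hz => ?_
  have hz2 : aeval z h = 0 := by
    have := (mem_roots'.1 hz).2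
    simpa using this
  obtain ⟨k, w, hk⟩ := hs
  have h1 : aeval z s ^ k = 0 := by
    rw [← map_pow, hk, map_mul, hz2, zero_mul]
  obtain ⟨q, hq⟩ := huv
  have : aeval z (u - v) = 0 := by rw [hq, map_mul, eq_zero_of_pow_eq_zero h1, zero_mul]
  rw [map_sub] at this
  exact sub_eq_zero.1 this

theorem wlRes_ne_zero (h s u : F[X]) (hh : h.Monic) (hs : ∃ k, h ∣ s ^ k) (hu : IsCoprime u s) :
    wlRes h u ≠ 0 := by
  intro h0
  have h1 := wlRes_eq F (E := AlgebraicClosure F) h u hh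
  rw [h0, map_zero] at h1
  obtain ⟨z, hz, hz0⟩ := Multiset.mem_map.1 (Multiset.prod_eq_zero_iff.1 h1.symm)
  have hz2 : aeval z h = 0 := by
    have := (mem_roots'.1 hz).2
    simpa using this
  obtain ⟨k, w, hk⟩ := hs
  have h1 : aeval z s ^ k = 0 := by
    rw [← map_pow, hk, map_mul, hz2, zero_mul]
  obtain ⟨a, b, hab⟩ := hu
  have := congrArg (aeval z) hab
  rw [map_add, map_mul, map_mul, hz0, eq_zero_of_pow_eq_zero h1] at this
  simp at this

theorem wlRes_wlc [IsAlgClosed E] (h : F[X]) (hh : h.Monic) {ν : ℕ} (hν : ν ≠ 0) (h2 : Even ν) {x : E}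
    (hx : x ^ (Fintype.card F ^ ν) = x) :
    algebraMap F E (wlRes h (wlc F ν x)) = (aeval x h) ^ (∑ i ∈ Finset.range ν, Fintype.card F ^ i) := by
  rw [wlRes_eq F _ _ hh]
  have h1 : ∀ z : E, aeval z (wlc F ν x) =
      ∏ i ∈ Finset.range ν, (x ^ (Fintype.card F ^ i) - z) := by
    intro z
    rw [← eval_map_algebraMap, wlc_map F hν hx, wlcE, eval_prod]
    have : ∀ i ∈ Finset.range ν, eval z (X - C (x ^ (Fintype.card F ^ i))) =
      (-1) * (x ^ (Fintype.card F ^ i) - z) := by intro i _; simp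
    rw [Finset.prod_congr rfl this, Finset.prod_mul_distrib]
    simp [h2]
  simp only [h1]
  rw [Multiset.prod_map_prod, ← Finset.prod_pow_eq_pow_sum]
  refine Finset.prod_congr rfl fun i _ => ?_
  rw [← wl_aeval_pow, ← eval_map_algebraMap,
    (IsAlgClosed.splits (h.map (algebraMap F E))).eval_eq_prod_roots_of_monic (hh.map _)]
end


theorem wl_abs {ι : Type*} (s : Finset ι) (c : ι → ℂ) (n : ι → ℝ) (U V : ℝ)
    (hc : ∀ i ∈ s, ‖c i‖ ≤ 1) (hsum : ∑ i ∈ s, c i = 0) (hn : ∀ i ∈ s, n i ≤ U)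
    (hV : s.card * U - ∑ i ∈ s, n i ≤ V) : ‖∑ i ∈ s, c i * n i‖ ≤ V := by
  have h1 : ∑ i ∈ s, c i * n i = - ∑ i ∈ s, c i * ((U - n i : ℝ) : ℂ) := by
    push_cast
    simp only [mul_sub, Finset.sum_sub_distrib, ← Finset.sum_mul, hsum]
    ring
  rw [h1, norm_neg]
  refine (norm_sum_le _ _).trans (le_trans ?_ hV)
  have : (s.card : ℝ) * U - ∑ i ∈ s, n i = ∑ i ∈ s, (U - n i) := by
    rw [Finset.sum_sub_distrib]; simp
  rw [this]
  refine Finset.sum_le_sum fun i hi => ?_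
  have h0 : 0 ≤ U - n i := sub_nonneg.2 (hn i hi)
  rw [norm_mul, Complex.norm_real, Real.norm_of_nonneg h0]
  exact mul_le_of_le_one_left h0 (hc i hi)

theorem wl_mulChar_norm {F : Type} [Field F] [Fintype F] (χ : MulChar F ℂ) (a : F) : ‖χ a‖ ≤ 1 := by
  by_cases ha : a = 0
  · rw [ha, MulChar.map_zero]; simp
  · have h1 : χ a ^ (Fintype.card F - 1) = 1 := by
      rw [← map_pow, FiniteField.pow_card_sub_one_eq_one a ha, map_one]
    have h2 : 1 < Fintype.card F := Fintype.one_lt_card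
    exact (Complex.norm_eq_one_of_pow_eq_one h1 (by omega)).le

theorem wl_addChar_norm {F : Type} [Field F] [Fintype F] (ψ : AddChar F ℂ) (a : F) : ‖ψ a‖ = 1 :=
  ψ.norm_apply a

/-- the fibres of the `K`-th power map -/
theorem wl_fiber_card {F : Type} [Field F] [Fintype F] [DecidableEq F] (e K : ℕ)
    (heK : K * e = Fintype.card F - 1) (y : Fˣ) :
    (Finset.univ.filter fun v : Fˣ => (y : F) ^ K = (v : F) ^ K).card = K := by
  have hQ : 1 < Fintype.card F := Fintype.one_lt_card
  have hK : K ≠ 0 := by rintro rfl; omega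
  have hcard : Nat.card Fˣ = K * e := by rw [heK, Nat.card_eq_fintype_card, Fintype.card_units]
  have h1 := IsCyclic.index_powMonoidHom_ker (G := Fˣ) K
  have h2 := Subgroup.card_mul_index (powMonoidHom K : Fˣ →* Fˣ).ker
  rw [h1, hcard, Nat.gcd_mul_right_left, Nat.mul_div_cancel_left _ (Nat.pos_of_ne_zero hK)] at h2
  have he : 0 < e := Nat.pos_of_ne_zero (by rintro rfl; omega)
  have h3 := Nat.eq_of_mul_eq_mul_right he h2
  rw [Nat.card_eq_fintype_card, Fintype.card_subtype] at h3
  refine Eq.trans ?_ h3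
  refine Finset.card_bij' (fun v _ => v * y⁻¹) (fun v _ => v * y) ?_ ?_ ?_ ?_
  · intro v hv
    simp only [Finset.mem_filter, Finset.mem_univ, true_and, MonoidHom.mem_ker,
      powMonoidHom_apply] at hv ⊢
    have : y ^ K = v ^ K := Units.ext (by simpa using hv)
    rw [mul_pow, ← this, ← mul_pow]; simp
  · intro v hv
    simp only [Finset.mem_filter, Finset.mem_univ, true_and, MonoidHom.mem_ker,
      powMonoidHom_apply] at hv ⊢
    have : (y : Fˣ) ^ K = (v * y) ^ K := by rw [mul_pow, hv, one_mul]
    simpa using congrArg Units.val this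
  · intro v _; simp
  · intro v _; simp

theorem wl_fiber_char {F : Type} [Field F] [Fintype F] (e K : ℕ)
    (heK : K * e = Fintype.card F - 1) (χ : MulChar F ℂ) (hχ : χ ^ e = 1) (y v : Fˣ)
    (h : (y : F) ^ K = (v : F) ^ K) : χ v = χ y := by
  classical
  have hQ : 1 < Fintype.card F := Fintype.one_lt_card
  have hcard : Fintype.card Fˣ = K * e := by rw [heK, Fintype.card_units]
  obtain ⟨g, hg⟩ := IsCyclic.exists_generator (α := Fˣ)
  have hord : orderOf g = K * e := by
    rw [orderOf_eq_card_of_forall_mem_zpowers hg, Nat.card_eq_fintype_card, hcard]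
  obtain ⟨j, hj⟩ := (mem_powers_iff_mem_zpowers.2 (hg (v * y⁻¹)) : v * y⁻¹ ∈ Submonoid.powers g)
  have h1 : (v * y⁻¹) ^ K = 1 := by
    have : y ^ K = v ^ K := Units.ext (by simpa using h)
    rw [mul_pow, ← this, ← mul_pow]; simp
  have hK : 0 < K := Nat.pos_of_ne_zero (by rintro rfl; omega)
  have he : e ≠ 0 := by rintro rfl; omega
  have h2 : e ∣ j := by
    simp only at hj
    rw [← hj, ← pow_mul, ← orderOf_dvd_iff_pow_eq_one, hord, mul_comm j K] at h1
    exact Nat.dvd_of_mul_dvd_mul_left hK h1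
  obtain ⟨l, rfl⟩ := h2
  have h3 : v = (g ^ l) ^ e * y := by
    rw [← pow_mul, mul_comm l e]; simp only at hj; rw [hj]; simp
  rw [h3]
  push_cast
  rw [map_mul, map_pow, ← MulChar.pow_apply' _ he, hχ, ← Units.val_pow_eq_pow_val, MulChar.one_apply_coe,
    one_mul]

theorem wlRes_pow {F : Type} [Field F] [Fintype F] (h u : F[X]) (hh : h.Monic) (k : ℕ) :
    wlRes (h ^ k) u = wlRes h u ^ k := by
  apply (algebraMap F (AlgebraicClosure F)).injective
  rw [map_pow, wlRes_eq F _ _ hh, wlRes_eq F _ _ (hh.pow k), Polynomial.map_pow, roots_pow,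
    Multiset.map_nsmul, Multiset.prod_nsmul]

noncomputable def wlLam {F : Type} [Field F] (χ : MulChar F ℂ) (ψ : AddChar F ℂ) (h u : F[X]) : ℂ :=
  χ (wlRes h u) * ψ (-u.nextCoeff)

noncomputable def wlS {F : Type} [Field F] [Fintype F] (χ : MulChar F ℂ) (ψ : AddChar F ℂ)
    (h : F[X]) (ν : ℕ) : ℂ :=
  ∑ x ∈ wlE F (AlgebraicClosure F) ν, wlLam χ ψ h (wlc F ν x)

/-- bound in the primitive case -/
theorem wlS_bound_prim {F : Type} [Field F] [Fintype F] (χ : MulChar F ℂ) (ψ : AddChar F ℂ)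
    (h : F[X]) (hh : h.Monic) (hnt : χ ≠ 1 ∨ ψ ≠ 1)
    (hprim : ∀ d, 0 < d → d < orderOf χ → ∀ k : F[X], k.Monic → h ^ d ≠ k ^ (orderOf χ)) :
    ∃ (c : ℝ) (μ₀ : ℕ), ∀ μ ≥ μ₀, ‖wlS χ ψ h (2 * μ)‖ ≤ c * (Fintype.card F : ℝ) ^ μ := by
  classical
  set e := orderOf χ with he
  have hed : e ∣ Fintype.card F - 1 := χ.orderOf_dvd_card_sub_one
  obtain ⟨c, μ₀, hst⟩ := wl_stepanov_bound F h hh e hed hprim (AlgebraicClosure F)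
  have hQ : 1 < Fintype.card F := Fintype.one_lt_card
  set Q := Fintype.card F with hQdef
  obtain ⟨K, hK⟩ := hed
  rw [mul_comm] at hK
  have hK0 : 0 < K := Nat.pos_of_ne_zero (by rintro rfl; omega)
  have he0 : 0 < e := Nat.pos_of_ne_zero (by rintro h0; rw [h0] at hK; omega)
  set D := h.natDegree with hD
  refine ⟨D + (Q - 1) * Q * |c|, μ₀ + 1, fun μ hμ => ?_⟩
  have hν : 2 * μ ≠ 0 := by omega
  set ν := 2 * μ with hνdef
  have hst := hst μ (by omega)
  set X' := wlE F (AlgebraicClosure F) ν with hX'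
  let y : AlgebraicClosure F → F := fun x => wlRes h (wlc F ν x)
  let b : AlgebraicClosure F → F := fun x => -(wlc F ν x).nextCoeff
  let n : Fˣ × F → ℕ := fun vb => (X'.filter fun x => y x ^ K = (vb.1 : F) ^ K ∧ b x = vb.2).card
  have hgs : (∑ i ∈ Finset.range ν, Q ^ i) * K = (Q ^ ν - 1) / e := by
    have h1 := geom_sum_mul_add (Q - 1) ν
    rw [Nat.sub_add_cancel hQ.le] at h1
    have h2 : Q ^ ν - 1 = (∑ i ∈ Finset.range ν, Q ^ i) * (Q - 1) := by omega
    rw [h2, hK, ← mul_assoc, Nat.mul_div_cancel _ he0]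
  have hyA : ∀ x ∈ X', algebraMap F (AlgebraicClosure F) (y x) =
      (aeval x h) ^ (∑ i ∈ Finset.range ν, Q ^ i) := fun x hx =>
    wlRes_wlc F h hh hν ⟨μ, by omega⟩ ((mem_wlE F hν).1 hx)
  have hn : ∀ vb, (n vb : ℝ) ≤ (Q : ℝ) ^ ν / (e * Q) + |c| * (Q : ℝ) ^ μ := by
    rintro ⟨v, b'⟩
    refine (hst ((v : F) ^ K) b' (pow_ne_zero _ v.ne_zero) _ ?_).trans ?_
    · intro x hx
      obtain ⟨hx1, hx2, hx3⟩ := Finset.mem_filter.1 hx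
      constructor
      · rw [← hgs, pow_mul, ← hyA x hx1, ← map_pow, hx2]
      · rw [← wlc_nextCoeff F hν ((mem_wlE F hν).1 hx1)]
        exact congrArg _ hx3
    · gcongr; exact le_abs_self c
  have hfib : ∀ x, ∑ v : Fˣ, (if y x ^ K = (v : F) ^ K then χ v else 0) = K * χ (y x) := by
    intro x
    by_cases hy : y x = 0
    · rw [hy, MulChar.map_zero, mul_zero]
      refine Finset.sum_eq_zero fun v _ => ?_
      rw [if_neg]
      rw [zero_pow hK0.ne']
      exact (pow_ne_zero _ v.ne_zero).symm
    · rw [← Finset.sum_filter]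
      have h1 := wl_fiber_card e K hK.symm (Units.mk0 _ hy)
      rw [Finset.sum_congr rfl (g := fun _ => χ (y x))]
      · rw [Finset.sum_const, nsmul_eq_mul]
        congr 2
      · intro v hv
        exact wl_fiber_char e K hK.symm χ (pow_orderOf_eq_one χ) (Units.mk0 _ hy) v
          (Finset.mem_filter.1 hv).2
  have hS : (K : ℂ) * wlS χ ψ h ν = ∑ vb : Fˣ × F, (χ vb.1 * ψ vb.2) * ((n vb : ℝ) : ℂ) := by
    have h1 : ∀ vb : Fˣ × F, (χ vb.1 * ψ vb.2) * ((n vb : ℝ) : ℂ) =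
        ∑ x ∈ X', if y x ^ K = (vb.1 : F) ^ K then (if b x = vb.2 then χ vb.1 * ψ vb.2 else 0)
          else 0 := by
      intro vb
      simp only [n]
      rw [← Finset.sum_filter, ← Finset.sum_filter, Finset.filter_filter, Finset.sum_const,
        nsmul_eq_mul]
      push_cast
      ring
    rw [Finset.sum_congr rfl fun vb _ => h1 vb, Finset.sum_comm]
    unfold wlS
    rw [Finset.mul_sum]
    refine Finset.sum_congr rfl fun x _ => ?_
    rw [Fintype.sum_prod_type]
    have h2 : ∀ v : Fˣ, ∑ b' : F, (if y x ^ K = (v : F) ^ K then (if b x = b' then χ v * ψ b' else 0)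
        else 0) = (if y x ^ K = (v : F) ^ K then χ v else 0) * ψ (b x) := by
      intro v
      split_ifs
      · simp
      · simp
    rw [Finset.sum_congr rfl fun v _ => h2 v, ← Finset.sum_mul, hfib]
    simp only [wlLam, y, b]
    ring
  have hsum0 : ∑ vb : Fˣ × F, (χ vb.1 * ψ vb.2) = 0 := by
    rw [Fintype.sum_prod_type]
    simp only [← Finset.mul_sum, ← Finset.sum_mul]
    rcases hnt with h1 | h1
    · have h2 := MulChar.sum_eq_zero_of_ne_one h1
      rw [Fintype.sum_eq_add_sum_subtype_ne _ (0 : F), MulChar.map_zero, zero_add] at h2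
      rw [← Equiv.sum_comp unitsEquivNeZero] at h2
      have h3 : ∑ v : Fˣ, χ v = 0 := h2
      rw [h3, zero_mul]
    · rw [AddChar.sum_eq_zero_iff_ne_zero.2 h1, mul_zero]
  have htot : (K : ℝ) * ((Q : ℝ) ^ ν - D) ≤ ∑ vb : Fˣ × F, (n vb : ℝ) := by
    have h1 : ∑ vb : Fˣ × F, n vb = ∑ x ∈ X', if y x = 0 then 0 else K := by
      simp only [n, Finset.card_filter]
      rw [Finset.sum_comm]
      refine Finset.sum_congr rfl fun x _ => ?_
      rw [Fintype.sum_prod_type]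
      have h2 : ∀ v : Fˣ, ∑ b' : F, (if y x ^ K = (v : F) ^ K ∧ b x = b' then 1 else 0) =
        if y x ^ K = (v : F) ^ K then 1 else 0 := by
        intro v
        by_cases h3 : y x ^ K = (v : F) ^ K <;> simp [h3]
      rw [Finset.sum_congr rfl fun v _ => h2 v, ← Finset.card_filter]
      split_ifs with hy
      · rw [Finset.card_eq_zero, Finset.filter_eq_empty_iff]
        intro v _
        rw [hy, zero_pow hK0.ne']
        exact (pow_ne_zero _ v.ne_zero).symm
      · exact wl_fiber_card e K hK.symm (Units.mk0 _ hy)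
    have h2 : X'.card ≤ (X'.filter fun x => ¬ y x = 0).card + D := by
      rw [← Finset.card_filter_add_card_filter_not (s := X') (fun x => ¬ y x = 0)]
      gcongr
      have : (X'.filter fun x => ¬ ¬ y x = 0) ⊆ (h.map (algebraMap F (AlgebraicClosure F))).roots.toFinset := by
        intro x hx
        obtain ⟨hx1, hx2⟩ := Finset.mem_filter.1 hx
        have h3 := hyA x hx1
        rw [not_not.1 hx2, map_zero] at h3
        rw [Multiset.mem_toFinset, mem_roots (hh.map _).ne_zero]
        have := eq_zero_of_pow_eq_zero h3.symm
        simpa using this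
      refine (Finset.card_le_card this).trans ((Multiset.toFinset_card_le _).trans ?_)
      refine (card_roots' _).trans ?_
      rw [natDegree_map]
    rw [card_wlE F hν] at h2
    have h4 : ∑ vb : Fˣ × F, (n vb : ℝ) = (X'.filter fun x => ¬ y x = 0).card * K := by
      have : ∑ x ∈ X', (if y x = 0 then 0 else K) = (X'.filter fun x => ¬ y x = 0).card * K := by
        have : ∀ x, (if y x = 0 then 0 else K) = if ¬ y x = 0 then K else 0 := by
          intro x; split_ifs <;> simp_all
        simp only [this]
        rw [← Finset.sum_filter]; simp
      exact_mod_cast h1.trans this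
    rw [h4, mul_comm]
    gcongr
    have : ((Q ^ ν : ℕ) : ℝ) ≤ (X'.filter fun x => ¬ y x = 0).card + D := by exact_mod_cast h2
    push_cast at this
    linarith
  have hKr : (1 : ℝ) ≤ K := by exact_mod_cast hK0
  have hQr : (1 : ℝ) < Q := by exact_mod_cast hQ
  have her : (0 : ℝ) < e := by exact_mod_cast he0
  have hKe : (K : ℝ) * e = Q - 1 := by
    have : ((K * e : ℕ) : ℝ) = ((Q - 1 : ℕ) : ℝ) := by rw [hK]
    rw [Nat.cast_sub hQ.le] at this
    push_cast at this; exact this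
  have hfin := wl_abs Finset.univ (fun vb : Fˣ × F => χ vb.1 * ψ vb.2) (fun vb => (n vb : ℝ)) _
    (K * D + (Q - 1) * Q * |c| * (Q : ℝ) ^ μ)
    (fun vb _ => by
      rw [norm_mul, wl_addChar_norm, mul_one]; exact wl_mulChar_norm χ _) hsum0 (fun vb _ => hn vb)
    (by
      have hcard : ((Finset.univ : Finset (Fˣ × F)).card : ℝ) = (Q - 1) * Q := by
        rw [Finset.card_univ, Fintype.card_prod, Fintype.card_units, Nat.cast_mul,
          Nat.cast_sub hQ.le]; simp [hQdef]
      rw [hcard]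
      have h1 : ((Q : ℝ) - 1) * Q * ((Q : ℝ) ^ ν / (e * Q)) = K * (Q : ℝ) ^ ν := by
        rw [← hKe]; field_simp
      rw [mul_add, h1]
      linarith)
  rw [← hS, norm_mul, Complex.norm_natCast] at hfin
  have hQμ : (1 : ℝ) ≤ (Q : ℝ) ^ μ := one_le_pow₀ hQr.le
  have hR : (K : ℝ) * D + (Q - 1) * Q * |c| * (Q : ℝ) ^ μ ≤
      K * ((D + (Q - 1) * Q * |c|) * (Q : ℝ) ^ μ) := by
    have hz : 0 ≤ ((Q : ℝ) - 1) * Q * |c| * (Q : ℝ) ^ μ :=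
      mul_nonneg (mul_nonneg (mul_nonneg (by linarith) (by linarith)) (abs_nonneg _)) (by linarith)
    have h1 : (D : ℝ) ≤ D * (Q : ℝ) ^ μ := le_mul_of_one_le_right (by positivity) hQμ
    have h2 : (K : ℝ) * D ≤ K * (D * (Q : ℝ) ^ μ) := by gcongr
    have h3 : ((Q : ℝ) - 1) * Q * |c| * (Q : ℝ) ^ μ ≤ K * (((Q : ℝ) - 1) * Q * |c| * (Q : ℝ) ^ μ) :=
      le_mul_of_one_le_left hz hKr
    nlinarith
  exact le_of_mul_le_mul_left (hfin.trans hR) (by linarith)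


theorem wlS_bound {F : Type} [Field F] [Fintype F] (χ : MulChar F ℂ) (ψ : AddChar F ℂ)
    (h : F[X]) (hh : h.Monic)
    (hnt : ψ ≠ 1 ∨ ¬ ∃ k : F[X], k.Monic ∧ h = k ^ (orderOf χ)) :
    ∃ (c : ℝ) (μ₀ : ℕ), ∀ μ ≥ μ₀, ‖wlS χ ψ h (2 * μ)‖ ≤ c * (Fintype.card F : ℝ) ^ μ := by
  classical
  set o := orderOf χ with ho
  have ho0 : 0 < o := χ.orderOf_pos
  obtain ⟨t, ht, hmax⟩ := Finset.exists_max_image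
    (o.divisors.filter fun t => ∃ k : F[X], k.Monic ∧ h = k ^ t) id
    ⟨1, by simp [ho0.ne', hh]⟩
  obtain ⟨ht1, h0, hh0, rfl⟩ := Finset.mem_filter.1 ht
  obtain ⟨⟨e, hte⟩, -⟩ := Nat.mem_divisors.1 ht1
  have ht0 : 0 < t := Nat.pos_of_ne_zero (by rintro rfl; omega)
  have he0 : 0 < e := Nat.pos_of_ne_zero (by rintro rfl; omega)
  have hord : orderOf (χ ^ t) = e := by
    rw [orderOf_pow_of_dvd ht0.ne' ⟨e, hte⟩, ← ho, hte, Nat.mul_div_cancel_left _ ht0]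
  have hS : ∀ ν, wlS χ ψ (h0 ^ t) ν = wlS (χ ^ t) ψ h0 ν := by
    intro ν
    refine Finset.sum_congr rfl fun x _ => ?_
    simp only [wlLam]
    rw [wlRes_pow _ _ hh0, map_pow, MulChar.pow_apply' _ ht0.ne']
  simp only [hS]
  refine wlS_bound_prim (χ ^ t) ψ h0 hh0 ?_ ?_
  · by_contra hc
    push Not at hc
    obtain ⟨h1, h2⟩ := hc
    rcases hnt with h3 | h3
    · exact h3 h2
    · apply h3
      have : e = 1 := by rw [← hord, h1, orderOf_one]
      rw [this, mul_one] at hte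
      exact ⟨h0, hh0, by rw [hte]⟩
  · rw [hord]
    intro d hd hde k hk heq
    obtain ⟨r, hr1, ⟨l, hl⟩, k1, hk1, hk2⟩ := wl_pow_of_pow h0 k hh0 hk d e hd hde heq
    have := hmax (t * r) (by
      rw [Finset.mem_filter, Nat.mem_divisors]
      refine ⟨⟨⟨l, by rw [hte, hl, mul_assoc]⟩, ho0.ne'⟩, k1, hk1, ?_⟩
      rw [hk2, ← pow_mul, mul_comm])
    simp only [id] at this
    nlinarith

section
variable (F : Type) [Field F] [Fintype F]

open Classical in
noncomputable def wlM (d : ℕ) : Finset F[X] :=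
  Finset.univ.image fun c : Fin d → F => X ^ d + ∑ i : Fin d, C (c i) * X ^ (i : ℕ)

theorem mem_wlM {d : ℕ} {u : F[X]} : u ∈ wlM F d ↔ u.Monic ∧ u.natDegree = d := by
  classical
  unfold wlM
  rw [Finset.mem_image]
  constructor
  · rintro ⟨c, -, rfl⟩
    have hlt : (∑ i : Fin d, C (c i) * X ^ (i : ℕ) : F[X]).degree < d := by
      refine (degree_sum_le _ _).trans_lt ?_
      rw [Finset.sup_lt_iff (by exact WithBot.bot_lt_coe d)]
      intro k _
      refine (degree_C_mul_X_pow_le _ _).trans_lt ?_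
      exact_mod_cast k.2
    refine ⟨monic_X_pow_add hlt, ?_⟩
    rw [natDegree_add_eq_left_of_degree_lt (by rwa [degree_X_pow]), natDegree_X_pow]
  · rintro ⟨hm, rfl⟩
    refine ⟨fun i => u.coeff i, Finset.mem_univ _, ?_⟩
    conv_rhs => rw [hm.as_sum]
    rw [Finset.sum_range]

open Classical in
/-- for a fixed point the number of divisors `c_j(x)` of `u` is the multiplicity of `x`. -/
theorem wl_count_x {E : Type} [Field E] [Algebra F E] (u : F[X]) (hu : u.Monic) (x : E)
    (hper : ∃ j, 0 < j ∧ x ^ (Fintype.card F ^ j) = x) :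
    ((Finset.Icc 1 u.natDegree).filter fun j =>
      x ^ (Fintype.card F ^ j) = x ∧ wlcE F j x ∣ u.map (algebraMap F E)).card =
    (u.map (algebraMap F E)).rootMultiplicity x := by
  classical
  obtain ⟨φ, hφ⟩ := wl_frob_hom F (E := E)
  set Q := Fintype.card F
  set U := u.map (algebraMap F E) with hU
  have hUm : U.Monic := hu.map _
  have hUφ : U.map φ = U := by
    rw [hU, Polynomial.map_map]
    congr 1
    ext a
    simp only [RingHom.comp_apply, hφ]
    rw [← map_pow, FiniteField.pow_card]
  let fr : E → E := fun y => y ^ Q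
  have hiter : ∀ j y, fr^[j] y = y ^ (Q ^ j) := by
    intro j y; simp only [fr]; rw [pow_iterate]
  set m := Function.minimalPeriod fr x with hm
  have hperiff : ∀ j, x ^ (Q ^ j) = x ↔ m ∣ j := by
    intro j
    rw [hm, ← Function.isPeriodicPt_iff_minimalPeriod_dvd, Function.IsPeriodicPt,
      Function.IsFixedPt, hiter]
  have hm0 : 0 < m := by
    obtain ⟨j, hj, hj2⟩ := hper
    exact Nat.pos_of_dvd_of_pos ((hperiff j).1 hj2) hj
  have hxm : x ^ (Q ^ m) = x := (hperiff m).2 dvd_rfl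
  have hpow : ∀ k, wlcE F (m * k) x = wlcE F m x ^ k := by
    intro k
    induction k with
    | zero => simp [wlcE]
    | succ k ih =>
      rw [pow_succ, ← ih, Nat.mul_succ]
      unfold wlcE
      rw [Finset.prod_range_add]
      congr 1
      refine Finset.prod_congr rfl fun i _ => ?_
      rw [pow_add, pow_mul, (hperiff (m * k)).2 (dvd_mul_right _ _)]
  have hconj : ∀ k i, (X - C x) ^ k ∣ U → (X - C (x ^ (Q ^ i))) ^ k ∣ U := by
    intro k i hk
    induction i with
    | zero => simpa using hk
    | succ i ih =>
      have := map_dvd (mapRingHom φ) ih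
      simp only [coe_mapRingHom, hUφ, Polynomial.map_pow, Polynomial.map_sub, map_X, map_C, hφ,
        ← pow_mul] at this
      rwa [pow_succ]
  have hdvd : ∀ k, wlcE F (m * k) x ∣ U ↔ k ≤ U.rootMultiplicity x := by
    intro k
    rw [le_rootMultiplicity_iff hUm.ne_zero, hpow]
    constructor
    · intro h1
      refine dvd_trans (pow_dvd_pow_of_dvd ?_ k) h1
      have := Finset.dvd_prod_of_mem (fun i => (X - C (x ^ (Q ^ i)) : E[X])) (Finset.mem_range.2 hm0)
      simpa [wlcE] using this
    · intro h1
      unfold wlcE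
      rw [← Finset.prod_pow]
      refine Finset.prod_dvd_of_coprime ?_ fun i _ => hconj k i h1
      intro i hi j hj hij
      refine (isCoprime_X_sub_C_of_isUnit_sub (sub_ne_zero.2 ?_).isUnit).pow
      intro he
      apply hij
      refine Function.iterate_injOn_Iio_minimalPeriod (f := fr) (x := x) (Finset.mem_range.1 hi)
        (Finset.mem_range.1 hj) ?_
      simpa [hiter] using he
  have : (U.rootMultiplicity x) = (Finset.Icc 1 (U.rootMultiplicity x)).card := by simp
  rw [this]
  symm
  refine Finset.card_bij (fun k _ => m * k) ?_ ?_ ?_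
  · intro k hk
    rw [Finset.mem_Icc] at hk
    have h1 := (hdvd k).2 hk.2
    rw [Finset.mem_filter, Finset.mem_Icc]
    refine ⟨⟨Nat.mul_pos hm0 hk.1, ?_⟩, (hperiff _).2 (dvd_mul_right _ _), h1⟩
    have := natDegree_le_of_dvd h1 hUm.ne_zero
    rwa [wlcE_natDegree, hU, natDegree_map] at this
  · intro a _ b _ hab
    exact Nat.eq_of_mul_eq_mul_left hm0 hab
  · intro j hj
    rw [Finset.mem_filter, Finset.mem_Icc] at hj
    obtain ⟨⟨h1, h2⟩, h3, h4⟩ := hj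
    obtain ⟨k, rfl⟩ := (hperiff j).1 h3
    refine ⟨k, ?_, rfl⟩
    rw [Finset.mem_Icc]
    refine ⟨?_, (hdvd k).1 h4⟩
    by_contra hk
    have : k = 0 := by omega
    subst this; simp at h1

theorem wl_periodic (x : AlgebraicClosure F) : ∃ j, 0 < j ∧ x ^ (Fintype.card F ^ j) = x := by
  have hx : IsIntegral F x := Algebra.IsIntegral.isIntegral x
  let K := IntermediateField.adjoin F {x}
  have : FiniteDimensional F K := IntermediateField.adjoin.finiteDimensional hx
  have : Finite K := Module.finite_of_finite F
  have := Fintype.ofFinite K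
  refine ⟨Module.finrank F K, Module.finrank_pos, ?_⟩
  have h1 := FiniteField.pow_card (⟨x, IntermediateField.mem_adjoin_simple_self F x⟩ : K)
  rw [Module.card_eq_pow_finrank (K := F) (V := K)] at h1
  exact congrArg Subtype.val h1

open Classical in
theorem wl_count (u : F[X]) (hu : u.Monic) :
    ∑ j ∈ Finset.Icc 1 u.natDegree, ((wlE F (AlgebraicClosure F) j).filter fun x =>
      wlc F j x ∣ u).card = u.natDegree := by
  classical
  set A := algebraMap F (AlgebraicClosure F)
  set U := u.map A with hU
  have hUm : U.Monic := hu.map _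
  have h1 : ∀ j ∈ Finset.Icc 1 u.natDegree, ((wlE F (AlgebraicClosure F) j).filter fun x =>
      wlc F j x ∣ u) = U.roots.toFinset.filter fun x =>
        x ^ (Fintype.card F ^ j) = x ∧ wlcE F j x ∣ U := by
    intro j hj
    have hj0 : j ≠ 0 := by have := (Finset.mem_Icc.1 hj).1; omega
    ext x
    rw [Finset.mem_filter, Finset.mem_filter, mem_wlE F hj0, Multiset.mem_toFinset]
    constructor
    · rintro ⟨h1, h2⟩
      have h3 : wlcE F j x ∣ U := by
        rw [← wlc_map F hj0 h1]; exact map_dvd (mapRingHom A) h2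
      refine ⟨?_, h1, h3⟩
      rw [mem_roots hUm.ne_zero, ← dvd_iff_isRoot]
      refine dvd_trans ?_ h3
      have := Finset.dvd_prod_of_mem (fun i => (X - C (x ^ (Fintype.card F ^ i)) :
        (AlgebraicClosure F)[X])) (Finset.mem_range.2 (Nat.pos_of_ne_zero hj0))
      simpa [wlcE] using this
    · rintro ⟨-, h1, h2⟩
      refine ⟨h1, ?_⟩
      rw [← wlc_map F hj0 h1] at h2
      exact (map_dvd_map' A).1 h2
  rw [Finset.sum_congr rfl fun j hj => by rw [h1 j hj]]
  simp only [Finset.card_filter]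
  rw [Finset.sum_comm]
  have h2 : ∀ x ∈ U.roots.toFinset, (∑ j ∈ Finset.Icc 1 u.natDegree,
      if x ^ (Fintype.card F ^ j) = x ∧ wlcE F j x ∣ U then 1 else 0) = U.roots.count x := by
    intro x _
    rw [← Finset.card_filter, count_roots]
    exact wl_count_x F u hu x (wl_periodic F x)
  rw [Finset.sum_congr rfl h2, Multiset.toFinset_sum_count_eq]
  rw [splits_iff_card_roots.1 (IsAlgClosed.splits U), hU, natDegree_map]

variable {F}

noncomputable def wlL (χ : MulChar F ℂ) (ψ : AddChar F ℂ) (h : F[X]) (d : ℕ) : ℂ :=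
  ∑ u ∈ wlM F d, wlLam χ ψ h u

theorem wlLam_mul (χ : MulChar F ℂ) (ψ : AddChar F ℂ) (h : F[X]) (hh : h.Monic) (u v : F[X])
    (hu : u.Monic) (hv : v.Monic) :
    wlLam χ ψ h (u * v) = wlLam χ ψ h u * wlLam χ ψ h v := by
  unfold wlLam
  rw [wlRes_mul F _ _ _ hh, map_mul, hu.nextCoeff_mul hv, neg_add, AddChar.map_add_eq_mul]
  ring

theorem wl_newton (χ : MulChar F ℂ) (ψ : AddChar F ℂ) (h : F[X]) (hh : h.Monic) (d : ℕ) :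
    (d : ℂ) * wlL χ ψ h d = ∑ j ∈ Finset.Icc 1 d, wlS χ ψ h j * wlL χ ψ h (d - j) := by
  classical
  have h1 : ∀ j ∈ Finset.Icc 1 d, wlS χ ψ h j * wlL χ ψ h (d - j) =
      ∑ u ∈ wlM F d, wlLam χ ψ h u *
        (((wlE F (AlgebraicClosure F) j).filter fun x => wlc F j x ∣ u).card : ℂ) := by
    intro j hj
    obtain ⟨hj1, hj2⟩ := Finset.mem_Icc.1 hj
    have hj0 : j ≠ 0 := by omega
    simp only [Finset.card_filter, Nat.cast_sum, Finset.mul_sum]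
    rw [Finset.sum_comm]
    unfold wlS
    rw [Finset.sum_mul]
    refine Finset.sum_congr rfl fun x hx => ?_
    have hx := (mem_wlE F hj0).1 hx
    have hcm := wlc_monic F hj0 hx
    have hcd := wlc_natDegree F hj0 hx
    unfold wlL
    rw [Finset.mul_sum]
    have : ∀ u, wlLam χ ψ h u * (((if wlc F j x ∣ u then 1 else 0 : ℕ)) : ℂ) =
        if wlc F j x ∣ u then wlLam χ ψ h u else 0 := by
      intro u; split_ifs <;> simp
    simp only [this]
    rw [← Finset.sum_filter]
    refine Finset.sum_bij (fun v _ => wlc F j x * v) ?_ ?_ ?_ ?_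
    · intro v hv
      obtain ⟨hv1, hv2⟩ := (mem_wlM F).1 hv
      rw [Finset.mem_filter, mem_wlM]
      refine ⟨⟨hcm.mul hv1, ?_⟩, dvd_mul_right _ _⟩
      rw [hcm.natDegree_mul hv1, hcd, hv2]; omega
    · intro a _ b _ hab
      exact mul_left_cancel₀ hcm.ne_zero hab
    · intro u hu
      rw [Finset.mem_filter, mem_wlM] at hu
      obtain ⟨⟨hu1, hu2⟩, v, rfl⟩ := hu
      have hv1 := hcm.of_mul_monic_left hu1
      refine ⟨v, ?_, rfl⟩
      rw [mem_wlM]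
      refine ⟨hv1, ?_⟩
      rw [hcm.natDegree_mul hv1, hcd] at hu2; omega
    · intro v hv
      exact (wlLam_mul χ ψ h hh _ _ hcm ((mem_wlM F).1 hv).1).symm
  rw [Finset.sum_congr rfl h1, Finset.sum_comm]
  unfold wlL
  rw [Finset.mul_sum]
  refine Finset.sum_congr rfl fun u hu => ?_
  obtain ⟨hu1, rfl⟩ := (mem_wlM F).1 hu
  rw [← Finset.mul_sum, ← Nat.cast_sum, wl_count F u hu1, mul_comm]
end


section
variable {F : Type} [Field F] [Fintype F]

theorem wlL_zero_of_map (χ : MulChar F ℂ) (ψ : AddChar F ℂ) (h : F[X]) (d : ℕ) (T : F[X] → F[X])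
    (c : ℂ) (hc : c ≠ 1) (hT : ∀ u ∈ wlM F d, T u ∈ wlM F d)
    (hinj : ∀ u ∈ wlM F d, ∀ v ∈ wlM F d, T u = T v → u = v)
    (hL : ∀ u ∈ wlM F d, wlLam χ ψ h (T u) = c * wlLam χ ψ h u) : wlL χ ψ h d = 0 := by
  classical
  have himg : (wlM F d).image T = wlM F d := by
    apply Finset.eq_of_subset_of_card_le
    · intro v hv
      obtain ⟨u, hu, rfl⟩ := Finset.mem_image.1 hv
      exact hT u hu
    · rw [Finset.card_image_of_injOn]
      intro u hu v hv huv
      exact hinj u hu v hv huv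
  have h1 : wlL χ ψ h d = c * wlL χ ψ h d := by
    conv_lhs => unfold wlL; rw [← himg]
    rw [Finset.sum_image (fun u hu v hv huv => hinj u hu v hv huv), wlL, Finset.mul_sum]
    exact Finset.sum_congr rfl hL
  have h2 : (c - 1) * wlL χ ψ h d = 0 := by rw [sub_mul, one_mul, ← h1, sub_self]
  exact (mul_eq_zero.1 h2).resolve_left (sub_ne_zero.2 hc)

theorem wl_mod_dvd (s u : F[X]) : s ∣ u - u %ₘ s := by
  have := modByMonic_add_div u s
  exact ⟨u /ₘ s, by linear_combination -this⟩

theorem wlL_zero (χ : MulChar F ℂ) (ψ : AddChar F ℂ) (h s : F[X]) (hh : h.Monic) (hs : s.Monic)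
    (hhs : ∃ k, h ∣ s ^ k)
    (hnt : ψ ≠ 1 ∨ ¬ ∃ k : F[X], k.Monic ∧ h = k ^ (orderOf χ))
    (d : ℕ) (hd : s.natDegree < d) : wlL χ ψ h d = 0 := by
  classical
  by_cases hψ : ψ = 1
  · subst hψ
    by_cases hv : ∃ v : F[X], IsCoprime v s ∧ χ (wlRes h v) ≠ 1
    · obtain ⟨v, hvs, hv1⟩ := hv
      have hdeg : ∀ w : F[X], (w %ₘ s).degree < d := fun w =>
        (degree_modByMonic_lt w hs).trans_le (by
          rw [degree_eq_natDegree hs.ne_zero]; exact_mod_cast hd.le)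
      refine wlL_zero_of_map χ 1 h d (fun u => u + ((v * u) %ₘ s - u %ₘ s)) _ hv1 ?_ ?_ ?_
      · intro u hu
        obtain ⟨h1, h2⟩ := (mem_wlM F).1 hu
        have hud : u.degree = d := by rw [degree_eq_natDegree h1.ne_zero, h2]
        have hlt : ((v * u) %ₘ s - u %ₘ s).degree < u.degree := by
          rw [hud]
          exact (degree_sub_le _ _).trans_lt (max_lt (hdeg _) (hdeg _))
        rw [mem_wlM]
        exact ⟨h1.add_of_left hlt, by rw [natDegree_add_eq_left_of_degree_lt hlt, h2]⟩
      · intro u hu w hw huw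
        have hd1 : s ∣ v * (u - w) := by
          have e1 := wl_mod_dvd s (v * u)
          have e2 := wl_mod_dvd s (v * w)
          have e3 := wl_mod_dvd s u
          have e4 := wl_mod_dvd s w
          have : v * (u - w) = (v * u - (v * u) %ₘ s) - (v * w - (v * w) %ₘ s)
            - (u - u %ₘ s) + (w - w %ₘ s) := by linear_combination huw
          rw [this]
          exact dvd_add (dvd_sub (dvd_sub e1 e2) e3) e4
        have hd2 : s ∣ u - w := hvs.symm.dvd_of_dvd_mul_left hd1
        have m1 : u %ₘ s = w %ₘ s := by
          rw [← sub_eq_zero, ← sub_modByMonic, modByMonic_eq_zero_iff_dvd hs]; exact hd2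
        have m2 : (v * u) %ₘ s = (v * w) %ₘ s := by
          rw [← sub_eq_zero, ← sub_modByMonic, modByMonic_eq_zero_iff_dvd hs, ← mul_sub]
          exact hd1
        rw [m1, m2] at huw
        exact add_right_cancel huw
      · intro u hu
        unfold wlLam
        rw [wlRes_congr F h s _ (v * u) hh hhs, wlRes_mul F _ _ _ hh, map_mul]
        · simp only [AddChar.one_apply]; ring
        · have e1 := wl_mod_dvd s (v * u)
          have e3 := wl_mod_dvd s u
          have : u + ((v * u) %ₘ s - u %ₘ s) - v * u =
            (u - u %ₘ s) - (v * u - (v * u) %ₘ s) := by ring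
          rw [this]; exact dvd_sub e3 e1
    · exfalso
      push Not at hv
      obtain ⟨c, μ₀, hb⟩ := wlS_bound χ 1 h hh hnt
      set Q := Fintype.card F with hQ
      have hQ2 : (2 : ℝ) ≤ Q := by exact_mod_cast (Fintype.one_lt_card : 1 < Fintype.card F)
      set D := s.natDegree
      have hlow : ∀ μ, 0 < μ → (Q : ℝ) ^ (2 * μ) - 2 * D ≤ ‖wlS χ 1 h (2 * μ)‖ := by
        intro μ hμ
        have hν : 2 * μ ≠ 0 := by omega
        set A := algebraMap F (AlgebraicClosure F)
        set B := (wlE F (AlgebraicClosure F) (2 * μ)).filter fun x => aeval x s = 0 with hB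
        have hBc : B.card ≤ D := by
          have : B ⊆ (s.map A).roots.toFinset := by
            intro x hx
            rw [hB, Finset.mem_filter] at hx
            rw [Multiset.mem_toFinset, mem_roots (hs.map _).ne_zero, IsRoot, eval_map]
            exact hx.2
          calc B.card ≤ _ := Finset.card_le_card this
            _ ≤ Multiset.card (s.map A).roots := Multiset.toFinset_card_le _
            _ ≤ (s.map A).natDegree := card_roots' _
            _ = D := natDegree_map _
        have hgood : ∀ x ∈ wlE F (AlgebraicClosure F) (2 * μ), aeval x s ≠ 0 →
            wlLam χ 1 h (wlc F (2 * μ) x) = 1 := by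
          intro x hx hxs
          have hx' := (mem_wlE F hν).1 hx
          unfold wlLam
          rw [hv, AddChar.one_apply, mul_one]
          rw [← isCoprime_map A, wlc_map F hν hx']
          unfold wlcE
          refine IsCoprime.prod_left fun i _ => ?_
          refine (irreducible_X_sub_C _).coprime_iff_not_dvd.2 ?_
          rw [dvd_iff_isRoot, IsRoot, eval_map, ← aeval_def, wl_aeval_pow]
          exact pow_ne_zero _ hxs
        have hS : wlS χ 1 h (2 * μ) = ((Q : ℂ) ^ (2 * μ)) - ∑ x ∈ B, (1 - wlLam χ 1 h (wlc F (2 * μ) x)) := by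
          rw [eq_sub_iff_add_eq, hB, Finset.sum_filter]
          unfold wlS
          rw [← Finset.sum_add_distrib, Finset.sum_congr rfl (g := fun _ => (1:ℂ))]
          · simp [card_wlE F hν, hQ]
          · intro x hx
            split_ifs with h0
            · ring
            · rw [hgood x hx h0]; ring
        have hle : ‖∑ x ∈ B, (1 - wlLam χ 1 h (wlc F (2 * μ) x))‖ ≤ 2 * D := by
          calc _ ≤ ∑ x ∈ B, (2 : ℝ) := by
                refine norm_sum_le_of_le _ fun x _ => ?_
                refine (norm_sub_le _ _).trans ?_
                unfold wlLam
                rw [AddChar.one_apply, mul_one, norm_one]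
                have := wl_mulChar_norm χ (wlRes h (wlc F (2 * μ) x))
                linarith
            _ = 2 * B.card := by rw [Finset.sum_const, nsmul_eq_mul]; ring
            _ ≤ 2 * D := by
                have : (B.card : ℝ) ≤ D := by exact_mod_cast hBc
                linarith
        have := norm_sub_norm_le ((Q : ℂ) ^ (2 * μ)) (∑ x ∈ B, (1 - wlLam χ 1 h (wlc F (2 * μ) x)))
        rw [← hS, norm_pow, Complex.norm_natCast] at this
        linarith
      have hex : ∃ μ, μ₀ ≤ μ ∧ 0 < μ ∧ c + 2 * D + 1 < (Q : ℝ) ^ μ := by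
        obtain ⟨k, hk⟩ := pow_unbounded_of_one_lt (c + 2 * D + 1) (by linarith : (1:ℝ) < Q)
        refine ⟨k + μ₀ + 1, by omega, by omega, hk.trans_le ?_⟩
        exact pow_le_pow_right₀ (by linarith) (by omega)
      obtain ⟨μ, h1, h2, h3⟩ := hex
      have h4 := hlow μ h2
      have h5 := hb μ h1
      rw [mul_comm 2 μ, pow_mul, sq] at h4
      rw [mul_comm 2 μ] at h5
      have h6 : (1 : ℝ) ≤ (Q : ℝ) ^ μ := one_le_pow₀ (by linarith)
      have h7 : (0 : ℝ) ≤ D := Nat.cast_nonneg _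
      have h8 := h4.trans h5
      nlinarith
  · obtain ⟨a, ha⟩ := (AddChar.ne_one_iff).1 hψ
    have hdeg : (C a * X ^ (d - 1 - s.natDegree) * s : F[X]).degree < (d : WithBot ℕ) := by
      have e1 : (C a * X ^ (d - 1 - s.natDegree) * s).degree ≤
          ((d - 1 - s.natDegree : ℕ) : WithBot ℕ) + (s.natDegree : WithBot ℕ) :=
        (degree_mul_le _ _).trans (add_le_add (degree_C_mul_X_pow_le _ _) degree_le_natDegree)
      refine e1.trans_lt ?_
      norm_cast
      omega
    refine wlL_zero_of_map χ ψ h d (fun u => u + C a * X ^ (d - 1 - s.natDegree) * s) (ψ (-a)) ?_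
      ?_ ?_ ?_
    · intro h1
      apply ha
      have : ψ a * ψ (-a) = 1 := by rw [← AddChar.map_add_eq_mul]; simp
      rwa [h1, mul_one] at this
    · intro u hu
      obtain ⟨h1, h2⟩ := (mem_wlM F).1 hu
      have hlt := hdeg
      rw [← h2, ← degree_eq_natDegree h1.ne_zero] at hlt
      rw [mem_wlM]
      subst h2
      exact ⟨h1.add_of_left hlt, by rw [natDegree_add_eq_left_of_degree_lt hlt]⟩
    · intro u _ v _ huv
      exact add_right_cancel huv
    · intro u hu
      obtain ⟨h1, h2⟩ := (mem_wlM F).1 hu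
      have hlt := hdeg
      rw [← h2, ← degree_eq_natDegree h1.ne_zero] at hlt
      subst h2
      unfold wlLam
      rw [wlRes_congr F h s _ u hh hhs]
      · have hn : (u + C a * X ^ (u.natDegree - 1 - s.natDegree) * s).nextCoeff = u.nextCoeff + a := by
          rw [nextCoeff_of_natDegree_pos, nextCoeff_of_natDegree_pos (by omega),
            natDegree_add_eq_left_of_degree_lt hlt, coeff_add, mul_assoc, coeff_C_mul,
            show u.natDegree - 1 = s.natDegree + (u.natDegree - 1 - s.natDegree) by omega]
          · simp only [Nat.add_sub_cancel_left]
            rw [coeff_X_pow_mul, coeff_natDegree, hs.leadingCoeff, mul_one]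
          · rw [natDegree_add_eq_left_of_degree_lt hlt]; omega
        rw [hn, neg_add, AddChar.map_add_eq_mul]
        ring
      · simp only [add_sub_cancel_left]
        exact dvd_mul_left _ _
end


theorem wl_radius {ι : Type} [Fintype ι] (η : ι → ℂ) (c B : ℝ) (hB : 0 < B) (μ₀ : ℕ)
    (hb : ∀ μ ≥ μ₀, ‖∑ i, η i ^ μ‖ ≤ c * B ^ μ) (i₀ : ι) : ‖η i₀‖ ≤ B := by
  classical
  set Z := (Finset.univ.image η).erase (η i₀) with hZ
  set p : ℂ[X] := ∏ z ∈ Z, (X - C z) with hp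
  have hp0 : p.eval (η i₀) ≠ 0 := by
    rw [hp, eval_prod, Finset.prod_ne_zero_iff]
    intro z hz
    rw [eval_sub, eval_X, eval_C, sub_ne_zero]
    exact (Finset.ne_of_mem_erase hz).symm
  have hp1 : ∀ i, η i ≠ η i₀ → p.eval (η i) = 0 := by
    intro i hi
    rw [hp, eval_prod]
    refine Finset.prod_eq_zero (i := η i) ?_ (by simp)
    rw [hZ, Finset.mem_erase]
    exact ⟨hi, Finset.mem_image_of_mem _ (Finset.mem_univ _)⟩
  set m := (Finset.univ.filter fun i => η i = η i₀).card with hm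
  have hm1 : 1 ≤ m := Finset.card_pos.2 ⟨i₀, by simp⟩
  have key : ∀ μ, ∑ i, p.eval (η i) * η i ^ μ = m * (p.eval (η i₀) * η i₀ ^ μ) := by
    intro μ
    rw [hm, ← nsmul_eq_mul, ← Finset.sum_const, Finset.sum_filter]
    refine Finset.sum_congr rfl fun i _ => ?_
    split_ifs with h
    · rw [h]
    · rw [hp1 i h, zero_mul]
  have key2 : ∀ μ, ∑ i, p.eval (η i) * η i ^ μ =
      ∑ k ∈ Finset.range (p.natDegree + 1), p.coeff k * ∑ i, η i ^ (μ + k) := by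
    intro μ
    simp only [eval_eq_sum_range, Finset.sum_mul, Finset.mul_sum]
    rw [Finset.sum_comm]
    refine Finset.sum_congr rfl fun k _ => Finset.sum_congr rfl fun i _ => ?_
    rw [pow_add]; ring
  set C' : ℝ := ∑ k ∈ Finset.range (p.natDegree + 1), ‖p.coeff k‖ * (c * B ^ k) with hC'
  have key3 : ∀ μ ≥ μ₀, ‖p.eval (η i₀)‖ * ‖η i₀‖ ^ μ ≤ C' * B ^ μ := by
    intro μ hμ
    have h1 : ‖p.eval (η i₀)‖ * ‖η i₀‖ ^ μ ≤ ‖(m : ℂ) * (p.eval (η i₀) * η i₀ ^ μ)‖ := by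
      rw [norm_mul, norm_mul, norm_pow, Complex.norm_natCast]
      refine le_mul_of_one_le_left (by positivity) (by exact_mod_cast hm1)
    refine h1.trans ?_
    rw [← key, key2, hC', Finset.sum_mul]
    refine norm_sum_le_of_le _ fun k _ => ?_
    rw [norm_mul, mul_assoc, mul_assoc c, ← pow_add, add_comm k]
    exact mul_le_mul_of_nonneg_left (hb _ (by omega)) (norm_nonneg _)
  by_contra hlt
  push Not at hlt
  have hpp : 0 < ‖p.eval (η i₀)‖ := norm_pos_iff.2 hp0
  obtain ⟨k, hk⟩ := pow_unbounded_of_one_lt (C' / ‖p.eval (η i₀)‖) ((one_lt_div hB).2 hlt)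
  have h2 : C' / ‖p.eval (η i₀)‖ < (‖η i₀‖ / B) ^ (k + μ₀) :=
    hk.trans_le (pow_le_pow_right₀ ((one_lt_div hB).2 hlt).le (by omega))
  have h3 := key3 (k + μ₀) (by omega)
  rw [div_pow, div_lt_div_iff₀ hpp (by positivity)] at h2
  linarith

theorem wl_newton_roots (L S : ℕ → ℂ) (D : ℕ) (hL0 : L 0 = 1) (hLD : ∀ d, D < d → L d = 0)
    (hN : ∀ d : ℕ, (d : ℂ) * L d = ∑ j ∈ Finset.Icc 1 d, S j * L (d - j)) :
    ∃ ω : Fin D → ℂ, ∀ j, 0 < j → S j = - ∑ i, ω i ^ j := by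
  classical
  set P : ℂ[X] := X ^ D + ∑ i : Fin D, C (L (D - i)) * X ^ (i : ℕ) with hP
  have hlt : (∑ i : Fin D, C (L (D - i)) * X ^ (i : ℕ) : ℂ[X]).degree < D := by
    refine (degree_sum_le _ _).trans_lt ?_
    rw [Finset.sup_lt_iff (by exact WithBot.bot_lt_coe D)]
    intro k _
    refine (degree_C_mul_X_pow_le _ _).trans_lt ?_
    exact_mod_cast k.2
  have hPm : P.Monic := monic_X_pow_add hlt
  have hPd : P.natDegree = D := by
    rw [hP, natDegree_add_eq_left_of_degree_lt (by rwa [degree_X_pow]), natDegree_X_pow]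
  have hPc : ∀ k ≤ D, P.coeff (D - k) = L k := by
    intro k hk
    rw [hP, coeff_add, finset_sum_coeff, coeff_X_pow]
    simp only [coeff_C_mul, coeff_X_pow]
    rcases Nat.eq_zero_or_pos k with rfl | hk0
    · rw [if_pos (by omega), hL0, Finset.sum_eq_zero, add_zero]
      intro i _
      rw [if_neg (by have := i.2; omega), mul_zero]
    · rw [if_neg (by omega), zero_add, Finset.sum_eq_single ⟨D - k, by omega⟩]
      · simp [show D - (D - k) = k by omega]
      · intro b _ hb
        rw [if_neg, mul_zero]
        intro h; apply hb; ext; simp [h]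
      · simp
  have hcard : Multiset.card P.roots = D := by
    rw [splits_iff_card_roots.1 (IsAlgClosed.splits P), hPd]
  obtain ⟨l, hl⟩ : ∃ l : List ℂ, (l : Multiset ℂ) = P.roots := Quot.exists_rep _
  have hlen : l.length = D := by rw [← hcard, ← hl]; simp
  subst hlen
  refine ⟨fun i => l.get i, ?_⟩
  set ω : Fin l.length → ℂ := fun i => l.get i with hω
  have hval : (Finset.univ.val.map ω : Multiset ℂ) = P.roots := by
    rw [← hl, Fin.univ_val_map, hω]; congr 1; exact List.ofFn_get l
  have hprod : (P.roots.map fun t => X - C t).prod = P :=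
    (prod_multiset_X_sub_C_of_monic_of_roots_card_eq hPm (by rw [hcard, hPd]))
  have hes : ∀ k, MvPolynomial.aeval ω (MvPolynomial.esymm (Fin l.length) ℂ k) = (-1) ^ k * L k := by
    intro k
    rw [MvPolynomial.aeval_esymm_eq_multiset_esymm, hval]
    by_cases hk : k ≤ l.length
    · have h1 := Multiset.prod_X_sub_C_coeff P.roots (k := l.length - k) (by rw [hcard]; omega)
      rw [hprod, hPc k hk, hcard, show l.length - (l.length - k) = k by omega] at h1
      rw [h1, ← mul_assoc, ← mul_pow]; simp
    · rw [hLD k (by omega), mul_zero, Multiset.esymm, Multiset.powersetCard_eq_empty]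
      · simp
      · rw [hcard]; omega
  have hps : ∀ k, MvPolynomial.aeval ω (MvPolynomial.psum (Fin l.length) ℂ k) = ∑ i, ω i ^ k := by
    intro k; simp [MvPolynomial.psum]
  have hN2 : ∀ d : ℕ, (d : ℂ) * L d = ∑ j ∈ Finset.Icc 1 d, (-∑ i, ω i ^ j) * L (d - j) := by
    intro k
    have h1 := congrArg (MvPolynomial.aeval ω) (MvPolynomial.mul_esymm_eq_sum (Fin l.length) ℂ k)
    simp only [map_mul, map_sum, map_pow, map_neg, map_one, hes, hps, map_natCast] at h1
    have hsq : ((-1 : ℂ) ^ k) * (-1) ^ k = 1 := by rw [← mul_pow]; simp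
    have h2 : (k : ℂ) * L k = (-1) ^ k * ((k : ℂ) * ((-1) ^ k * L k)) := by
      linear_combination (-(k : ℂ) * L k) * hsq
    rw [h2, h1, ← mul_assoc, pow_succ, ← mul_assoc, hsq, one_mul, Finset.mul_sum]
    symm
    refine Finset.sum_bij (fun j _ => (k - j, j)) ?_ ?_ ?_ ?_
    · intro j hj
      rw [Finset.mem_Icc] at hj
      simp only [Finset.mem_filter, Finset.HasAntidiagonal.mem_antidiagonal]; omega
    · intro a _ b _ hab
      simp only [Prod.mk.injEq] at hab; exact hab.2
    · rintro ⟨a, b⟩ hab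
      simp only [Finset.mem_filter, Finset.HasAntidiagonal.mem_antidiagonal] at hab
      refine ⟨b, ?_, ?_⟩
      · rw [Finset.mem_Icc]; omega
      · ext <;> simp; omega
    · intro j hj
      have h3 : ((-1 : ℂ) ^ (k - j)) * (-1) ^ (k - j) = 1 := by rw [← mul_pow]; simp
      simp only
      linear_combination ((∑ i, ω i ^ j) * L (k - j)) * h3
  intro j
  induction j using Nat.strong_induction_on with
  | _ j ih =>
    intro hj
    have h1 := (hN j).symm.trans (hN2 j)
    have hm : j ∈ Finset.Icc 1 j := by rw [Finset.mem_Icc]; omega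
    rw [← Finset.add_sum_erase _ _ hm, ← Finset.add_sum_erase _ _ hm, Nat.sub_self, hL0,
      Finset.sum_congr rfl (g := fun x => (-∑ i, ω i ^ x) * L (j - x))] at h1
    · simpa using h1
    · intro x hx
      rw [Finset.mem_erase, Finset.mem_Icc] at hx
      rw [ih x (by omega) (by omega)]

section
variable {F : Type} [Field F] [Fintype F]

theorem wlL_0 (χ : MulChar F ℂ) (ψ : AddChar F ℂ) (h : F[X]) (hh : h.Monic) :
    wlL χ ψ h 0 = 1 := by
  have : wlM F 0 = {1} := by
    ext u
    rw [mem_wlM, Finset.mem_singleton]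
    constructor
    · rintro ⟨h1, h2⟩; exact h1.natDegree_eq_zero.1 h2
    · rintro rfl; exact ⟨monic_one, natDegree_one⟩
  unfold wlL
  rw [this, Finset.sum_singleton, wlLam, wlRes_one F h hh]
  simp [nextCoeff]

theorem wlS_one (χ : MulChar F ℂ) (ψ : AddChar F ℂ) (h : F[X]) (hh : h.Monic) :
    ∃ c : ℂ, ‖c‖ = 1 ∧ wlS χ ψ h 1 = c * ∑ a : F, χ (h.eval a) * ψ a := by
  classical
  set A := algebraMap F (AlgebraicClosure F) with hA
  have hAi : Function.Injective A := A.injective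
  refine ⟨χ ((-1) ^ h.natDegree), ?_, ?_⟩
  · rw [map_pow, norm_pow]
    have : (χ (-1)) ^ 2 = 1 := by rw [← map_pow]; simp
    rw [Complex.norm_eq_one_of_pow_eq_one this (by norm_num), one_pow]
  · unfold wlS
    rw [Finset.mul_sum]
    symm
    refine Finset.sum_bij (fun a _ => A a) ?_ ?_ ?_ ?_
    · intro a _
      rw [mem_wlE F one_ne_zero, ← map_pow, pow_one, FiniteField.pow_card]
    · intro a _ b _ hab; exact hAi hab
    · intro x hx
      rw [mem_wlE F one_ne_zero, pow_one] at hx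
      obtain ⟨a, ha⟩ := wl_fixed F x hx
      exact ⟨a, Finset.mem_univ _, ha⟩
    · intro a _
      have hx : (A a) ^ (Fintype.card F ^ 1) = A a := by
        rw [← map_pow, pow_one, FiniteField.pow_card]
      have hc : wlc F 1 (A a) = X - C a := by
        apply Polynomial.map_injective A hAi
        rw [hA, wlc_map F one_ne_zero hx]
        simp [wlcE, hA]
      rw [hc, wlLam]
      have hR : wlRes h (X - C a) = (-1) ^ h.natDegree * h.eval a := by
        apply hAi
        rw [hA, wlRes_eq F h _ hh, ← hA]
        have hs := IsAlgClosed.splits (h.map A)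
        have e1 : A (h.eval a) = ((h.map A).roots.map fun z => A a - z).prod := by
          rw [← eval_map_apply, hs.eval_eq_prod_roots_of_monic (hh.map _)]
        have hcard : Multiset.card (h.map A).roots = h.natDegree := by
          rw [splits_iff_card_roots.1 hs, natDegree_map]
        rw [map_mul, e1, map_pow, map_neg, map_one, ← hcard]
        generalize (h.map A).roots = M
        induction M using Multiset.induction_on with
        | empty => simp
        | cons z M ih =>
          rw [Multiset.map_cons, Multiset.prod_cons, ih, Multiset.map_cons, Multiset.prod_cons,
            Multiset.card_cons, pow_succ]
          simp only [map_sub, aeval_X, aeval_C]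
          rw [← hA]
          ring
      rw [hR, map_mul, nextCoeff_X_sub_C, neg_neg]
      ring

/-- Weil's bound. -/
theorem wl_weil (χ : MulChar F ℂ) (ψ : AddChar F ℂ) (h s : F[X]) (hh : h.Monic) (hs : s.Monic)
    (hhs : ∃ k, h ∣ s ^ k)
    (hnt : ψ ≠ 1 ∨ ¬ ∃ k : F[X], k.Monic ∧ h = k ^ (orderOf χ)) :
    ‖∑ a : F, χ (h.eval a) * ψ a‖ ≤ s.natDegree * Real.sqrt (Fintype.card F) := by
  obtain ⟨ω, hω⟩ := wl_newton_roots (wlL χ ψ h) (wlS χ ψ h) s.natDegree (wlL_0 χ ψ h hh)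
    (fun d hd => wlL_zero χ ψ h s hh hs hhs hnt d hd) (wl_newton χ ψ h hh)
  obtain ⟨c, μ₀, hb⟩ := wlS_bound χ ψ h hh hnt
  have hQ : (0 : ℝ) < Fintype.card F := by exact_mod_cast Fintype.card_pos
  have hbd : ∀ i, ‖ω i‖ ≤ Real.sqrt (Fintype.card F) := by
    intro i
    have h1 := wl_radius (fun i => ω i ^ 2) c (Fintype.card F) hQ (μ₀ + 1) (by
      intro μ hμ
      have := hb μ (by omega)
      rw [hω (2 * μ) (by omega), norm_neg] at this
      simpa only [← pow_mul] using this) i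
    rw [norm_pow] at h1
    exact Real.le_sqrt_of_sq_le h1
  obtain ⟨c0, hc0, h1⟩ := wlS_one χ ψ h hh
  have h2 : ‖∑ a : F, χ (h.eval a) * ψ a‖ = ‖wlS χ ψ h 1‖ := by rw [h1, norm_mul, hc0, one_mul]
  rw [h2, hω 1 one_pos, norm_neg]
  refine (norm_sum_le_of_le _ (fun i _ => ?_ : ∀ i ∈ Finset.univ, ‖ω i ^ 1‖ ≤ Real.sqrt (Fintype.card F))).trans ?_
  · rw [pow_one]; exact hbd i
  · simp
end


section
variable {F : Type} [Field F] [Fintype F]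

theorem wl_gen : ∃ χ₀ : MulChar F ℂ, orderOf χ₀ = Fintype.card F - 1 ∧
    ∀ χ : MulChar F ℂ, ∃ a, 1 ≤ a ∧ a ≤ Fintype.card F - 1 ∧ χ = χ₀ ^ a := by
  classical
  have hQ : 1 < Fintype.card F := Fintype.one_lt_card
  have hζ := Complex.isPrimitiveRoot_exp (Fintype.card F - 1) (by omega)
  obtain ⟨χ₀, h0⟩ := MulChar.exists_mulChar_orderOf F dvd_rfl hζ
  refine ⟨χ₀, h0, fun χ => ?_⟩
  have hcard : Nat.card (MulChar F ℂ) = Fintype.card F - 1 := by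
    rw [MulChar.card_eq_card_units_of_hasEnoughRootsOfUnity, Nat.card_eq_fintype_card,
      Fintype.card_units]
  have hz : Subgroup.zpowers χ₀ = ⊤ := by
    apply Subgroup.eq_top_of_card_eq
    rw [Nat.card_zpowers, h0, hcard]
  have hm : χ ∈ Subgroup.zpowers χ₀ := by rw [hz]; trivial
  rw [← mem_powers_iff_mem_zpowers, mem_powers_iff_mem_range_orderOf, Finset.mem_image] at hm
  obtain ⟨a, ha, rfl⟩ := hm
  rw [Finset.mem_range, h0] at ha
  rcases Nat.eq_zero_or_pos a with rfl | hp
  · exact ⟨Fintype.card F - 1, by omega, le_rfl, by rw [← h0, pow_orderOf_eq_one, pow_zero]⟩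
  · exact ⟨a, hp, ha.le, rfl⟩

theorem wl_mult_mul {p a b : F[X]} (hp : Prime p) (ha : a ≠ 0) (hb : b ≠ 0) :
    multiplicity p (a * b) = multiplicity p a + multiplicity p b :=
  multiplicity_mul hp (FiniteMultiplicity.of_prime_left hp (mul_ne_zero ha hb))

theorem wl_mult_pow {p a : F[X]} (hp : Prime p) (ha : a ≠ 0) (k : ℕ) :
    multiplicity p (a ^ k) = k * multiplicity p a :=
  FiniteMultiplicity.multiplicity_pow hp (FiniteMultiplicity.of_prime_left hp ha)

/-- valuation argument: `X^a g₁^b g₂^c` is not an `N`-th power. -/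
theorem wl_not_pow (N a b c : ℕ) (hbc : b + c = 2 * N) (hab : ¬ (N ∣ a ∧ N ∣ b))
    (g₁ g₂ g : F[X]) (h1 : g₁.Monic) (h2 : g₂.Monic) (hcop : IsCoprime g₁ g₂)
    (k : ℕ) (hgm : g.Monic) (hgi : Irreducible g) (hgX : g ≠ X)
    (hgk : Nat.gcd k N = 1) (hd : g ^ k ∣ g₁ * g₂) (hnd : ¬ g ^ (k + 1) ∣ g₁ * g₂) :
    ¬ ∃ w : F[X], w.Monic ∧ X ^ a * g₁ ^ b * g₂ ^ c = w ^ N := by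
  rintro ⟨w, hw, heq⟩
  have hval : ∀ p : F[X], Prime p → N ∣ a * multiplicity p X + b * multiplicity p g₁ +
      c * multiplicity p g₂ := by
    intro p hp
    have := congrArg (multiplicity p) heq
    rw [wl_mult_mul hp (mul_ne_zero (pow_ne_zero _ X_ne_zero) (pow_ne_zero _ h1.ne_zero))
      (pow_ne_zero _ h2.ne_zero), wl_mult_mul hp (pow_ne_zero _ X_ne_zero)
      (pow_ne_zero _ h1.ne_zero), wl_mult_pow hp X_ne_zero, wl_mult_pow hp h1.ne_zero,
      wl_mult_pow hp h2.ne_zero, wl_mult_pow hp hw.ne_zero] at this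
    exact ⟨_, this⟩
  have hgp := hgi.prime
  have hgX0 : multiplicity g X = 0 := by
    rw [multiplicity_eq_zero]
    intro hdv
    exact hgX (eq_of_monic_of_associated hgm monic_X
      (hgi.associated_of_dvd irreducible_X hdv))
  have hk : multiplicity g g₁ + multiplicity g g₂ = k := by
    rw [← wl_mult_mul hgp h1.ne_zero h2.ne_zero]
    exact multiplicity_eq_of_dvd_of_not_dvd hd hnd
  have hz : multiplicity g g₁ = 0 ∨ multiplicity g g₂ = 0 := by
    rw [multiplicity_eq_zero, multiplicity_eq_zero]
    by_contra hc
    push Not at hc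
    exact hgp.not_unit (hcop.isUnit_of_dvd' hc.1 hc.2)
  have hkN : Nat.Coprime N k := Nat.Coprime.symm hgk
  have hb : N ∣ b := by
    have h3 := hval g hgp
    rw [hgX0, mul_zero, zero_add] at h3
    rcases hz with hz | hz
    · rw [hz, mul_zero, zero_add, show multiplicity g g₂ = k by omega] at h3
      have : N ∣ c := hkN.dvd_of_dvd_mul_right h3
      exact (Nat.dvd_add_left this).1 (by rw [hbc]; exact dvd_mul_left _ _)
    · rw [hz, mul_zero, add_zero, show multiplicity g g₁ = k by omega] at h3
      exact hkN.dvd_of_dvd_mul_right h3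
  have hc : N ∣ c := (Nat.dvd_add_right hb).1 (by rw [hbc]; exact dvd_mul_left _ _)
  apply hab
  refine ⟨?_, hb⟩
  have h3 := hval X prime_X
  rw [multiplicity_self, mul_one] at h3
  exact (Nat.dvd_add_left (hb.mul_right _)).1 ((Nat.dvd_add_left (hc.mul_right _)).1 h3)

theorem wl_app (m₁ m₂ : ℕ) (f₁ f₂ : F[X]) (hf₁ : f₁.natDegree ≤ m₁) (hf₂ : f₂.natDegree ≤ m₂)
    (h10 : f₁ ≠ 0) (h20 : f₂ ≠ 0) (hcop : IsCoprime f₁ f₂)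
    (k : ℕ) (g : F[X]) (hgm : g.Monic) (hgi : Irreducible g) (hgX : g ≠ X)
    (hgk : Nat.gcd k (Fintype.card F - 1) = 1) (hd : g ^ k ∣ f₁ * f₂)
    (hnd : ¬ g ^ (k + 1) ∣ f₁ * f₂)
    (χ₁ χ₂ : MulChar F ℂ) (ψ : AddChar F ℂ) (hnt : ¬ (χ₁ = 1 ∧ χ₂ = 1 ∧ ψ = 1)) :
    ‖∑ x : F, χ₁ x * χ₂ (f₁.eval x / f₂.eval x) * ψ x‖ ≤
      (m₁ + m₂ + 1) * Real.sqrt (Fintype.card F) := by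
  classical
  obtain ⟨χ₀, h0, hgen⟩ := wl_gen (F := F)
  set N := Fintype.card F - 1 with hN
  obtain ⟨a, ha1, ha2, rfl⟩ := hgen χ₁
  obtain ⟨b, hb1, hb2, rfl⟩ := hgen χ₂
  obtain ⟨c, hbc⟩ : ∃ c, b + c = 2 * N := ⟨2 * N - b, by omega⟩
  have hc1 : 1 ≤ c := by omega
  set u₁ := f₁.leadingCoeff
  set u₂ := f₂.leadingCoeff
  have hu1 : u₁ ≠ 0 := leadingCoeff_ne_zero.2 h10
  have hu2 : u₂ ≠ 0 := leadingCoeff_ne_zero.2 h20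
  obtain ⟨g₁, hg1m, hg1⟩ : ∃ g₁ : F[X], g₁.Monic ∧ f₁ = C u₁ * g₁ := by
    refine ⟨f₁ * C u₁⁻¹, monic_mul_leadingCoeff_inv h10, ?_⟩
    rw [mul_comm f₁, ← mul_assoc, ← C_mul, mul_inv_cancel₀ hu1, C_1, one_mul]
  obtain ⟨g₂, hg2m, hg2⟩ : ∃ g₂ : F[X], g₂.Monic ∧ f₂ = C u₂ * g₂ := by
    refine ⟨f₂ * C u₂⁻¹, monic_mul_leadingCoeff_inv h20, ?_⟩
    rw [mul_comm f₂, ← mul_assoc, ← C_mul, mul_inv_cancel₀ hu2, C_1, one_mul]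
  have hU1 : IsUnit (C u₁) := isUnit_C.2 hu1.isUnit
  have hU2 : IsUnit (C u₂) := isUnit_C.2 hu2.isUnit
  have hcop' : IsCoprime g₁ g₂ := by
    rw [hg1, hg2] at hcop
    rwa [isCoprime_mul_unit_left_left hU1, isCoprime_mul_unit_left_right hU2] at hcop
  have hdv : ∀ w : F[X], w ∣ f₁ * f₂ ↔ w ∣ g₁ * g₂ := by
    intro w
    rw [hg1, hg2, show C u₁ * g₁ * (C u₂ * g₂) = (C u₁ * C u₂) * (g₁ * g₂) by ring]
    exact (hU1.mul hU2).dvd_mul_left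
  rw [hdv] at hd hnd
  have hnp : ψ ≠ 1 ∨ ¬ ∃ w : F[X], w.Monic ∧ X ^ a * g₁ ^ b * g₂ ^ c = w ^ (orderOf χ₀) := by
    by_cases hψ : ψ = 1
    · right
      rw [h0]
      refine wl_not_pow N a b c hbc ?_ g₁ g₂ g hg1m hg2m hcop' k hgm hgi hgX hgk hd hnd
      rintro ⟨⟨a', ha'⟩, ⟨b', hb'⟩⟩
      apply hnt
      refine ⟨?_, ?_, hψ⟩
      · rw [ha', ← h0, pow_mul, pow_orderOf_eq_one, one_pow]
      · rw [hb', ← h0, pow_mul, pow_orderOf_eq_one, one_pow]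
    · exact Or.inl hψ
  have hweil := wl_weil χ₀ ψ (X ^ a * g₁ ^ b * g₂ ^ c) (X * g₁ * g₂)
    (((monic_X_pow a).mul (hg1m.pow b)).mul (hg2m.pow c)) ((monic_X.mul hg1m).mul hg2m)
    ⟨a + b + c, by
      rw [mul_pow, mul_pow]
      exact mul_dvd_mul (mul_dvd_mul (pow_dvd_pow _ (by omega)) (pow_dvd_pow _ (by omega)))
        (pow_dvd_pow _ (by omega))⟩ hnp
  have hdeg : (X * g₁ * g₂).natDegree ≤ m₁ + m₂ + 1 := by
    rw [(monic_X.mul hg1m).natDegree_mul hg2m, monic_X.natDegree_mul hg1m, natDegree_X]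
    have e1 : f₁.natDegree = g₁.natDegree := by rw [hg1, natDegree_C_mul hu1]
    have e2 : f₂.natDegree = g₂.natDegree := by rw [hg2, natDegree_C_mul hu2]
    omega
  have hsum : ∑ x : F, (χ₀ ^ a) x * (χ₀ ^ b) (f₁.eval x / f₂.eval x) * ψ x =
      χ₀ (u₁ ^ b * u₂ ^ c) * ∑ x : F, χ₀ ((X ^ a * g₁ ^ b * g₂ ^ c).eval x) * ψ x := by
    rw [Finset.mul_sum]
    refine Finset.sum_congr rfl fun x _ => ?_
    rw [← mul_assoc, ← map_mul]
    congr 1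
    rw [MulChar.pow_apply' _ (by omega), MulChar.pow_apply' _ (by omega), ← map_pow, ← map_pow,
      ← map_mul]
    simp only [eval_mul, eval_pow, eval_X]
    have hev1 : f₁.eval x = u₁ * g₁.eval x := by conv_lhs => rw [hg1]; simp
    have hev2 : f₂.eval x = u₂ * g₂.eval x := by conv_lhs => rw [hg2]; simp
    rw [show u₁ ^ b * u₂ ^ c * (x ^ a * g₁.eval x ^ b * g₂.eval x ^ c) =
      x ^ a * (f₁.eval x ^ b * f₂.eval x ^ c) by rw [hev1, hev2]; ring]
    congr 2
    by_cases hz : f₂.eval x = 0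
    · rw [hz, div_zero, zero_pow (by omega), zero_pow (by omega), mul_zero]
    · have hfe : (f₂.eval x) ^ (b + c) = 1 := by
        rw [hbc, mul_comm, pow_mul, FiniteField.pow_card_sub_one_eq_one _ hz, one_pow]
      rw [div_pow, div_eq_iff (pow_ne_zero _ hz), mul_assoc, ← pow_add, add_comm c b, hfe, mul_one]
  rw [hsum, norm_mul]
  calc _ ≤ 1 * ((X * g₁ * g₂).natDegree * Real.sqrt (Fintype.card F)) :=
        mul_le_mul (wl_mulChar_norm _ _) hweil (norm_nonneg _) zero_le_one
    _ ≤ _ := by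
        rw [one_mul]
        refine mul_le_mul_of_nonneg_right ?_ (Real.sqrt_nonneg _)
        exact_mod_cast hdeg
end


section
variable {X' ι G : Type} [DecidableEq ι] [CommGroup G] [DecidableEq G]

theorem sv_M (D : Finset X') (ev : G → X' → ℂ) (Wl : ℝ)
    (hev1 : ∀ x ∈ D, ev 1 x = 1) (hevm : ∀ x ∈ D, ∀ a b, ev (a * b) x = ev a x * ev b x)
    (hW : ∀ γ, γ ≠ 1 → ‖∑ x ∈ D, ev γ x‖ ≤ Wl)
    (I : Finset ι) (H : ι → Finset G) (H1 : ∀ i ∈ I, 1 ∈ H i)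
    (hind : ∀ T ⊆ I, ∀ γ : ι → G, (∀ i ∈ T, γ i ∈ H i) → ∏ i ∈ T, γ i = 1 → ∀ i ∈ T, γ i = 1)
    (T : Finset ι) (hT : T ⊆ I) (hne : T.Nonempty) :
    ‖∑ x ∈ D, ∏ i ∈ T, ∑ γ ∈ (H i).erase 1, ev γ x‖ ≤ Wl * ∏ i ∈ T, (((H i).card : ℝ) - 1) := by
  have hprod : ∀ x ∈ D, ∀ (S : Finset {i // i ∈ T}) (γ : {i // i ∈ T} → G),
      ∏ i ∈ S, ev (γ i) x = ev (∏ i ∈ S, γ i) x := by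
    intro x hx S γ
    classical
    induction S using Finset.induction_on with
    | empty => simp [hev1 x hx]
    | insert i S hi ih => rw [Finset.prod_insert hi, Finset.prod_insert hi, ih, hevm x hx]
  have h1 : ∑ x ∈ D, ∏ i ∈ T, ∑ γ ∈ (H i).erase 1, ev γ x =
      ∑ p ∈ T.pi fun i => (H i).erase 1, ∑ x ∈ D, ev (∏ i ∈ T.attach, p i.1 i.2) x := by
    rw [Finset.sum_comm]
    refine Finset.sum_congr rfl fun x hx => ?_
    rw [Finset.prod_sum]
    refine Finset.sum_congr rfl fun p _ => ?_
    exact hprod x hx _ (fun i => p i.1 i.2)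
  rw [h1]
  calc _ ≤ ∑ p ∈ T.pi fun i => (H i).erase 1, Wl := by
        refine norm_sum_le_of_le _ fun p hp => hW _ ?_
        intro he
        rw [Finset.mem_pi] at hp
        have h2 : ∏ i ∈ T, (if h : i ∈ T then p i h else 1) = 1 := by
          rw [← he, ← Finset.prod_attach T]
          refine Finset.prod_congr rfl fun i _ => ?_
          rw [dif_pos i.2]
        obtain ⟨i, hi⟩ := hne
        have h3 := hind T hT (fun i => if h : i ∈ T then p i h else 1) (by
          intro i hi
          simp only [dif_pos hi]
          exact Finset.mem_of_mem_erase (hp i hi)) h2 i hi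
        simp only [dif_pos hi] at h3
        exact Finset.ne_of_mem_erase (hp i hi) h3
    _ = Wl * ∏ i ∈ T, (((H i).card : ℝ) - 1) := by
        rw [Finset.sum_const, Finset.card_pi, nsmul_eq_mul, mul_comm]
        push_cast
        congr 1
        refine Finset.prod_congr rfl fun i hi => ?_
        have h1 := H1 i (hT hi)
        rw [Finset.card_erase_of_mem h1, Nat.cast_sub (Finset.card_pos.2 ⟨1, h1⟩), Nat.cast_one]

theorem sieve (D : Finset X') (ev : G → X' → ℂ) (Wl : ℝ) (hWl : 0 ≤ Wl)
    (hev1 : ∀ x ∈ D, ev 1 x = 1) (hevm : ∀ x ∈ D, ∀ a b, ev (a * b) x = ev a x * ev b x)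
    (hW : ∀ γ, γ ≠ 1 → ‖∑ x ∈ D, ev γ x‖ ≤ Wl)
    (I₀ J : Finset ι) (hIJ : Disjoint I₀ J) (H : ι → Finset G) (H1 : ∀ i ∈ I₀ ∪ J, 1 ∈ H i)
    (H2 : ∀ i ∈ I₀ ∪ J, 2 ≤ (H i).card)
    (hind : ∀ T ⊆ I₀ ∪ J, ∀ γ : ι → G, (∀ i ∈ T, γ i ∈ H i) → ∏ i ∈ T, γ i = 1 →
      ∀ i ∈ T, γ i = 1)
    (cond : ι → X' → Prop) (hcond : ∀ i ∈ I₀ ∪ J, ∀ x ∈ D, cond i x →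
      ∑ γ ∈ H i, ev γ x = (H i).card)
    (hncond : ∀ i ∈ I₀ ∪ J, ∀ x ∈ D, ¬ cond i x → ∑ γ ∈ H i, ev γ x = 0)
    (δ : ℝ) (hδ : 0 < δ) (hδd : δ = 1 - ∑ j ∈ J, 1 / ((H j).card : ℝ))
    (hmain : 2 ^ I₀.card * Wl * (((J.card : ℝ) - 1) / δ + 2) - Wl < D.card) :
    ∃ x ∈ D, ∀ i ∈ I₀ ∪ J, ¬ cond i x := by
  classical
  set E : ι → X' → ℂ := fun i x => ∑ γ ∈ (H i).erase 1, ev γ x with hE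
  set h : ι → ℝ := fun i => (H i).card with hh
  have hpos : ∀ i ∈ I₀ ∪ J, 2 ≤ h i := fun i hi => by
    simp only [hh]; exact_mod_cast H2 i hi
  have hEeq : ∀ i ∈ I₀ ∪ J, ∀ x ∈ D, E i x = (∑ γ ∈ H i, ev γ x) - 1 := by
    intro i hi x hx
    rw [eq_sub_iff_add_eq, ← hev1 x hx]
    exact Finset.sum_erase_add _ _ (H1 i hi)
  -- indicators
  have hgood : ∀ i ∈ I₀ ∪ J, ∀ x ∈ D, (if cond i x then (0 : ℂ) else 1) =
      (1 - 1 / h i : ℝ) + ((-(1 / h i) : ℝ) : ℂ) * E i x := by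
    intro i hi x hx
    have h0 : ((h i : ℝ) : ℂ) ≠ 0 := by
      have := hpos i hi
      exact_mod_cast (by linarith : (0:ℝ) < h i).ne'
    rw [hEeq i hi x hx]
    split_ifs with hc
    · rw [hcond i hi x hx hc]
      have : ((H i).card : ℂ) = ((h i : ℝ) : ℂ) := by simp [hh]
      rw [this]; push_cast; field_simp; ring
    · rw [hncond i hi x hx hc]
      push_cast; field_simp; ring
  have hbad : ∀ i ∈ I₀ ∪ J, ∀ x ∈ D, (if cond i x then (1 : ℂ) else 0) =
      ((1 / h i : ℝ) : ℂ) + ((1 / h i : ℝ) : ℂ) * E i x := by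
    intro i hi x hx
    have := hgood i hi x hx
    have h2 : (if cond i x then (1 : ℂ) else 0) = 1 - (if cond i x then (0 : ℂ) else 1) := by
      split_ifs <;> simp
    rw [h2, this]; push_cast; ring
  set θ : ι → ℝ := fun i => 1 - 1 / h i with hθ
  have hθpos : ∀ i ∈ I₀ ∪ J, 0 < θ i := by
    intro i hi
    have := hpos i hi
    have : 1 / h i < 1 := by rw [div_lt_one] <;> linarith
    simp only [hθ]; linarith
  set θ₀ := ∏ i ∈ I₀, θ i with hθ₀
  have hsub : I₀ ⊆ I₀ ∪ J := Finset.subset_union_left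
  have hθ₀pos : 0 < θ₀ := Finset.prod_pos fun i hi => hθpos i (hsub hi)
  have hMb := sv_M D ev Wl hev1 hevm hW (I₀ ∪ J) H H1 hind
  set N : Finset X' := D.filter fun x => ∀ i ∈ I₀, ¬ cond i x with hNdef
  have hexp : ∀ x ∈ D, (if ∀ i ∈ I₀, ¬ cond i x then (1 : ℂ) else 0) =
      ∑ T ∈ I₀.powerset, ((∏ i ∈ T, (-(1 / h i)) : ℝ) : ℂ) * ((∏ i ∈ I₀ \ T, θ i : ℝ) : ℂ) *
        ∏ i ∈ T, E i x := by
    intro x hx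
    have e1 : (if ∀ i ∈ I₀, ¬ cond i x then (1 : ℂ) else 0) =
        ∏ i ∈ I₀, (if cond i x then (0 : ℂ) else 1) := by
      split_ifs with hc
      · rw [Finset.prod_eq_one]
        intro i hi; rw [if_neg (hc i hi)]
      · push Not at hc
        obtain ⟨i, hi, hci⟩ := hc
        rw [Finset.prod_eq_zero hi]; rw [if_pos hci]
    rw [e1, Finset.prod_congr rfl fun i hi => hgood i (hsub hi) x hx]
    rw [Finset.prod_congr rfl fun i _ => add_comm _ _, Finset.prod_add]
    refine Finset.sum_congr rfl fun T _ => ?_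
    rw [Finset.prod_mul_distrib]
    push_cast
    simp only [hθ]
    push_cast
    ring
  have hcoef : ∀ T ∈ I₀.powerset, |∏ i ∈ T, (-(1 / h i))| * |∏ i ∈ I₀ \ T, θ i| *
      ∏ i ∈ T, (h i - 1) = θ₀ := by
    intro T hT
    rw [Finset.mem_powerset] at hT
    rw [Finset.abs_prod, Finset.abs_prod, hθ₀, ← Finset.prod_sdiff hT, mul_comm (∏ i ∈ T, _), mul_assoc,
      ← Finset.prod_mul_distrib]
    congr 1
    · refine Finset.prod_congr rfl fun i hi => abs_of_pos (hθpos i (hsub ?_))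
      exact (Finset.mem_sdiff.1 hi).1
    · refine Finset.prod_congr rfl fun i hi => ?_
      have := hpos i (hsub (hT hi))
      rw [abs_neg, abs_of_pos (by positivity)]
      simp only [hθ]; field_simp
  -- N lower bound
  have hN1 : (N.card : ℂ) = ∑ T ∈ I₀.powerset, ((∏ i ∈ T, (-(1 / h i)) : ℝ) : ℂ) *
      ((∏ i ∈ I₀ \ T, θ i : ℝ) : ℂ) * ∑ x ∈ D, ∏ i ∈ T, E i x := by
    rw [hNdef, Finset.card_filter]
    push_cast
    rw [Finset.sum_congr rfl hexp, Finset.sum_comm]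
    refine Finset.sum_congr rfl fun T _ => ?_
    rw [Finset.mul_sum]
    push_cast
    rfl
  have hNlow : θ₀ * (D.card - (2 ^ I₀.card - 1) * Wl) ≤ N.card := by
    have hem : ∅ ∈ I₀.powerset := Finset.empty_mem_powerset _
    rw [← Finset.add_sum_erase _ _ hem] at hN1
    simp only [Finset.prod_empty, Finset.sdiff_empty, Finset.sum_const, nsmul_eq_mul, mul_one,
      Complex.ofReal_one, one_mul] at hN1
    have hrest : ‖∑ T ∈ I₀.powerset.erase ∅, ((∏ i ∈ T, (-(1 / h i)) : ℝ) : ℂ) *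
      ((∏ i ∈ I₀ \ T, θ i : ℝ) : ℂ) * ∑ x ∈ D, ∏ i ∈ T, E i x‖ ≤ (2 ^ I₀.card - 1) * (θ₀ * Wl) := by
      calc _ ≤ ∑ T ∈ I₀.powerset.erase ∅, θ₀ * Wl := by
            refine norm_sum_le_of_le _ fun T hT => ?_
            have hT' := Finset.mem_of_mem_erase hT
            have hTs := Finset.mem_powerset.1 hT'
            rw [norm_mul, norm_mul, Complex.norm_real, Complex.norm_real, Real.norm_eq_abs,
              Real.norm_eq_abs]
            refine (mul_le_mul_of_nonneg_left (hMb T (hTs.trans hsub)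
              (Finset.nonempty_iff_ne_empty.2 (Finset.ne_of_mem_erase hT))) (by positivity)).trans ?_
            rw [← hcoef T hT']
            apply le_of_eq
            ring
        _ = _ := by
            rw [Finset.sum_const, Finset.card_erase_of_mem hem, Finset.card_powerset, nsmul_eq_mul,
              Nat.cast_sub Nat.one_le_two_pow]
            push_cast; ring
    have hre := congrArg Complex.re hN1
    rw [Complex.add_re, Complex.natCast_re, ← hθ₀] at hre
    have h3 := (abs_le.1 ((Complex.abs_re_le_norm _).trans hrest)).1
    rw [show ((θ₀ : ℂ) * (D.card : ℂ)) = ((θ₀ * D.card : ℝ) : ℂ) by push_cast; ring,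
      Complex.ofReal_re] at hre
    nlinarith
  -- N_j upper bound
  have hNj : ∀ j ∈ J, ((N.filter fun x => cond j x).card : ℝ) ≤
      1 / h j * N.card + θ j * θ₀ * 2 ^ I₀.card * Wl := by
    intro j hj
    have hjI : j ∈ I₀ ∪ J := Finset.mem_union_right _ hj
    have hj0 : j ∉ I₀ := fun h0 => (Finset.disjoint_left.1 hIJ h0) hj
    have e1 : (((N.filter fun x => cond j x).card : ℕ) : ℂ) = ((1 / h j : ℝ) : ℂ) * N.card +
        ∑ T ∈ I₀.powerset, ((1 / h j : ℝ) : ℂ) * (((∏ i ∈ T, (-(1 / h i)) : ℝ) : ℂ) *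
      ((∏ i ∈ I₀ \ T, θ i : ℝ) : ℂ)) * ∑ x ∈ D, ∏ i ∈ insert j T, E i x := by
      rw [Finset.card_filter]
      push_cast
      have e2 : ∀ x ∈ N, (if cond j x then (1 : ℂ) else 0) =
        ((1 / h j : ℝ) : ℂ) + ((1 / h j : ℝ) : ℂ) * E j x :=
        fun x hx => hbad j hjI x (Finset.mem_filter.1 hx).1
      rw [Finset.sum_congr rfl e2, Finset.sum_add_distrib, Finset.sum_const, nsmul_eq_mul]
      congr 1
      · push_cast; ring
      rw [hNdef, Finset.sum_filter]
      have e3 : ∀ x ∈ D, (if ∀ i ∈ I₀, ¬ cond i x then ((1 / h j : ℝ) : ℂ) * E j x else 0) =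
          ∑ T ∈ I₀.powerset, ((1 / h j : ℝ) : ℂ) * (((∏ i ∈ T, (-(1 / h i)) : ℝ) : ℂ) *
            ((∏ i ∈ I₀ \ T, θ i : ℝ) : ℂ)) * ∏ i ∈ insert j T, E i x := by
        intro x hx
        have : (if ∀ i ∈ I₀, ¬ cond i x then ((1 / h j : ℝ) : ℂ) * E j x else 0) =
          ((1 / h j : ℝ) : ℂ) * E j x * (if ∀ i ∈ I₀, ¬ cond i x then (1 : ℂ) else 0) := by
          split_ifs <;> simp
        rw [this, hexp x hx, Finset.mul_sum]
        refine Finset.sum_congr rfl fun T hT => ?_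
        rw [Finset.prod_insert (fun h0 => hj0 (Finset.mem_powerset.1 hT h0))]
        ring
      rw [Finset.sum_congr rfl e3, Finset.sum_comm]
      refine Finset.sum_congr rfl fun T _ => ?_
      rw [Finset.mul_sum]
      push_cast
      rfl
    have hrest : ‖∑ T ∈ I₀.powerset, ((1 / h j : ℝ) : ℂ) * (((∏ i ∈ T, (-(1 / h i)) : ℝ) : ℂ) *
      ((∏ i ∈ I₀ \ T, θ i : ℝ) : ℂ)) * ∑ x ∈ D, ∏ i ∈ insert j T, E i x‖ ≤
        θ j * θ₀ * 2 ^ I₀.card * Wl := by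
      calc _ ≤ ∑ T ∈ I₀.powerset, θ j * θ₀ * Wl := by
            refine norm_sum_le_of_le _ fun T hT => ?_
            have hTs := Finset.mem_powerset.1 hT
            rw [norm_mul, norm_mul, norm_mul, Complex.norm_real, Complex.norm_real,
              Complex.norm_real, Real.norm_eq_abs, Real.norm_eq_abs, Real.norm_eq_abs]
            refine (mul_le_mul_of_nonneg_left (hMb (insert j T) (Finset.insert_subset hjI
              (hTs.trans hsub)) (Finset.insert_nonempty _ _)) (by positivity)).trans ?_
            rw [Finset.prod_insert (fun h0 => hj0 (hTs h0)), ← hcoef T hT]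
            have := hpos j hjI
            rw [abs_of_pos (by positivity : 0 < 1 / h j)]
            have e4 : θ j = 1 / h j * (h j - 1) := by simp only [hθ]; field_simp
            rw [e4]
            apply le_of_eq
            ring
        _ = _ := by
            rw [Finset.sum_const, Finset.card_powerset, nsmul_eq_mul]
            push_cast; ring
    have hre := congrArg Complex.re e1
    rw [Complex.add_re, Complex.natCast_re] at hre
    have h3 := (abs_le.1 ((Complex.abs_re_le_norm _).trans hrest)).2
    rw [show ((1 / h j : ℝ) : ℂ) * (N.card : ℂ) = ((1 / h j * N.card : ℝ) : ℂ) by push_cast; ring,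
      Complex.ofReal_re] at hre
    linarith
  by_contra hcon
  push Not at hcon
  have hcover : N ⊆ J.biUnion fun j => N.filter fun x => cond j x := by
    intro x hx
    rw [hNdef, Finset.mem_filter] at hx
    obtain ⟨i, hi, hci⟩ := hcon x hx.1
    rw [Finset.mem_biUnion]
    rcases Finset.mem_union.1 hi with hi | hi
    · exact absurd hci (hx.2 i hi)
    · exact ⟨i, hi, by rw [Finset.mem_filter, hNdef, Finset.mem_filter]; exact ⟨hx, hci⟩⟩
  have hle : (N.card : ℝ) ≤ ∑ j ∈ J, (1 / h j * N.card + θ j * θ₀ * 2 ^ I₀.card * Wl) := by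
    have h1 : N.card ≤ ∑ j ∈ J, (N.filter fun x => cond j x).card :=
      (Finset.card_le_card hcover).trans Finset.card_biUnion_le
    have h2 : (N.card : ℝ) ≤ ∑ j ∈ J, ((N.filter fun x => cond j x).card : ℝ) := by
      exact_mod_cast h1
    exact h2.trans (Finset.sum_le_sum hNj)
  have hs1 : ∑ j ∈ J, 1 / h j = 1 - δ := by rw [hδd]; simp only [hh]; ring
  have hs2 : ∑ j ∈ J, θ j = J.card - 1 + δ := by
    simp only [hθ, Finset.sum_sub_distrib, hs1]
    simp; ring
  rw [Finset.sum_add_distrib, ← Finset.sum_mul, ← Finset.sum_mul, ← Finset.sum_mul,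
    ← Finset.sum_mul, hs1, hs2] at hle
  have h5 : δ * N.card ≤ (J.card - 1 + δ) * θ₀ * 2 ^ I₀.card * Wl := by linarith
  have h6 : δ * (D.card - (2 ^ I₀.card - 1) * Wl) ≤ (J.card - 1 + δ) * 2 ^ I₀.card * Wl := by
    have : θ₀ * (δ * (D.card - (2 ^ I₀.card - 1) * Wl)) ≤
        θ₀ * ((J.card - 1 + δ) * 2 ^ I₀.card * Wl) := by
      have := mul_le_mul_of_nonneg_left hNlow hδ.le
      linarith
    exact le_of_mul_le_mul_left this hθ₀pos
  have h7 : δ * (2 ^ I₀.card * Wl * (((J.card : ℝ) - 1) / δ + 2) - Wl) =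
      2 ^ I₀.card * Wl * (J.card - 1 + 2 * δ) - δ * Wl := by field_simp
  have h8 := mul_lt_mul_of_pos_left hmain hδ
  rw [h7] at h8
  linarith
end


section
variable (K L : Type) [Field K] [Fintype K] [Field L] [Fintype L] [Algebra K L]

noncomputable def svPhi : Module.End K L := (FiniteField.frobeniusAlgHom K L).toLinearMap

theorem svPhi_pow (i : ℕ) (y : L) : (svPhi K L ^ i) y = y ^ (Fintype.card K ^ i) := by
  induction i with
  | zero => simp
  | succ i ih =>
    rw [pow_succ', Module.End.mul_apply, ih, pow_succ, pow_mul]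
    simp [svPhi]

theorem sv_aeval (c : K[X]) (y : L) :
    (aeval (svPhi K L) c) y =
      ∑ i ∈ Finset.range (c.natDegree + 1), c.coeff i • y ^ (Fintype.card K ^ i) := by
  rw [aeval_eq_sum_range, LinearMap.sum_apply]
  refine Finset.sum_congr rfl fun i _ => ?_
  rw [LinearMap.smul_apply, svPhi_pow]

theorem sv_ker_le (c : K[X]) (hc : c ≠ 0) :
    Module.finrank K (aeval (svPhi K L) c).ker ≤ c.natDegree := by
  classical
  set q := Fintype.card K with hq
  have hq1 : 1 < q := Fintype.one_lt_card
  have : Module.Finite K L := Module.Finite.of_finite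
  set p : L[X] := ∑ i ∈ Finset.range (c.natDegree + 1), C (algebraMap K L (c.coeff i)) * X ^ (q ^ i)
    with hp
  have hpd : p.natDegree ≤ q ^ c.natDegree := by
    refine natDegree_sum_le_of_forall_le _ _ fun i hi => ?_
    refine (natDegree_C_mul_X_pow_le _ _).trans ?_
    exact Nat.pow_le_pow_right hq1.le (Nat.lt_succ_iff.1 (Finset.mem_range.1 hi))
  have hp0 : p ≠ 0 := by
    intro h0
    have h1 := congrArg (fun r => coeff r (q ^ c.natDegree)) h0
    simp only [hp, finset_sum_coeff, coeff_C_mul, coeff_X_pow, coeff_zero] at h1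
    rw [Finset.sum_eq_single c.natDegree] at h1
    · simp [hc] at h1
    · intro b _ hb
      rw [if_neg, mul_zero]
      intro h2
      exact hb (Nat.pow_right_injective hq1 h2).symm
    · simp
  have hcard : Nat.card (aeval (svPhi K L) c).ker ≤ q ^ c.natDegree := by
    have h1 : ((aeval (svPhi K L) c).ker : Set L) ⊆ (p.roots.toFinset : Set L) := by
      intro y hy
      have hy : (aeval (svPhi K L) c) y = 0 := hy
      rw [sv_aeval] at hy
      rw [Finset.mem_coe, Multiset.mem_toFinset, mem_roots hp0, IsRoot, hp, eval_finset_sum, ← hy]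
      refine Finset.sum_congr rfl fun i _ => ?_
      simp [Algebra.smul_def, hq]
    have h2 : Nat.card (aeval (svPhi K L) c).ker = ((aeval (svPhi K L) c).ker : Set L).ncard := rfl
    rw [h2]
    calc _ ≤ ((p.roots.toFinset : Set L)).ncard := Set.ncard_le_ncard h1
      _ = p.roots.toFinset.card := Set.ncard_coe_finset _
      _ ≤ Multiset.card p.roots := Multiset.toFinset_card_le _
      _ ≤ p.natDegree := card_roots' _
      _ ≤ _ := hpd
  rw [Module.natCard_eq_pow_finrank (K := K), Nat.card_eq_fintype_card] at hcard
  exact (Nat.pow_le_pow_iff_right hq1).1 hcard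


theorem sv_finrank {n : ℕ} (hn : 0 < n) (hL : Fintype.card L = Fintype.card K ^ n)
    : Module.finrank K L = n := by
  have : Module.Finite K L := Module.Finite.of_finite
  have h1 := Module.natCard_eq_pow_finrank (K := K) (V := L)
  rw [Nat.card_eq_fintype_card, Nat.card_eq_fintype_card, hL] at h1
  exact (Nat.pow_right_injective (Fintype.one_lt_card : 1 < Fintype.card K) h1).symm

theorem sv_Xn {n : ℕ} (hn : 0 < n) (hL : Fintype.card L = Fintype.card K ^ n)
    : aeval (svPhi K L) (X ^ n - 1 : K[X]) = 0 := by
  ext y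
  rw [map_sub, map_pow, aeval_X, map_one, LinearMap.sub_apply, svPhi_pow, ← hL, FiniteField.pow_card]
  simp

theorem sv_ker_range {n : ℕ} (hn : 0 < n) (hL : Fintype.card L = Fintype.card K ^ n)
    (c d : K[X]) (hcd : c * d = X ^ n - 1) :
    Module.finrank K (aeval (svPhi K L) c).ker = c.natDegree ∧
    (aeval (svPhi K L) d).range = (aeval (svPhi K L) c).ker := by
  have : Module.Finite K L := Module.Finite.of_finite
  have hm : (X ^ n - 1 : K[X]).Monic := monic_X_pow_sub_C (1 : K) hn.ne'
  have hc : c ≠ 0 := by rintro rfl; rw [zero_mul] at hcd; exact hm.ne_zero hcd.symm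
  have hd : d ≠ 0 := by rintro rfl; rw [mul_zero] at hcd; exact hm.ne_zero hcd.symm
  have hdeg : c.natDegree + d.natDegree = n := by
    rw [← natDegree_mul hc hd, hcd]; exact natDegree_X_pow_sub_C (r := (1 : K))
  have h1 := sv_ker_le K L c hc
  have h2 := sv_ker_le K L d hd
  have h3 := LinearMap.finrank_range_add_finrank_ker (aeval (svPhi K L) d)
  rw [sv_finrank K L hn hL] at h3
  have hle : (aeval (svPhi K L) d).range ≤ (aeval (svPhi K L) c).ker := by
    rintro _ ⟨y, rfl⟩
    rw [LinearMap.mem_ker, ← Module.End.mul_apply, ← map_mul, hcd, sv_Xn K L hn hL]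
    rfl
  have h4 := Submodule.finrank_mono hle
  refine ⟨by omega, Submodule.eq_of_le_of_finrank_le hle (by omega)⟩

theorem sv_normal {n : ℕ} (hn : 0 < n) (hL : Fintype.card L = Fintype.card K ^ n)
    (α : L) (hα : ∀ P : K[X], P.Monic → Irreducible P → P ∣ X ^ n - 1 →
      α ∉ (aeval (svPhi K L) P).range) :
    LinearIndependent K (fun i : Fin n => α ^ Fintype.card K ^ (i : ℕ)) ∧
    Submodule.span K (Set.range fun i : Fin n => α ^ Fintype.card K ^ (i : ℕ)) = ⊤ := by
  classical
  have : Module.Finite K L := Module.Finite.of_finite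
  have hli : LinearIndependent K (fun i : Fin n => α ^ Fintype.card K ^ (i : ℕ)) := by
    rw [Fintype.linearIndependent_iff]
    intro c hc
    by_contra hne
    push Not at hne
    obtain ⟨i₀, hi₀⟩ := hne
    set w : K[X] := ∑ i : Fin n, C (c i) * X ^ (i : ℕ) with hw
    have hwα : (aeval (svPhi K L) w) α = 0 := by
      rw [hw, map_sum, LinearMap.sum_apply, ← hc]
      refine Finset.sum_congr rfl fun i _ => ?_
      rw [map_mul, map_pow, aeval_X, aeval_C, Module.End.mul_apply, svPhi_pow,
        Module.algebraMap_end_apply]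
    have hw0 : w ≠ 0 := by
      intro h0
      have h1 := congrArg (fun r => coeff r (i₀ : ℕ)) h0
      simp only [hw, finset_sum_coeff, coeff_C_mul, coeff_X_pow, coeff_zero] at h1
      rw [Finset.sum_eq_single i₀] at h1
      · simp [hi₀] at h1
      · intro b _ hb
        rw [if_neg, mul_zero]
        intro h2; exact hb (Fin.ext h2.symm)
      · simp
    have hwd : w.natDegree < n := by
      refine lt_of_le_of_lt (natDegree_sum_le_of_forall_le (n := n - 1) _ _ fun i _ => ?_) (by omega)
      refine (natDegree_C_mul_X_pow_le _ _).trans ?_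
      have := i.2; omega
    have hm : (X ^ n - 1 : K[X]).Monic := monic_X_pow_sub_C (1 : K) hn.ne'
    set c' := EuclideanDomain.gcd w (X ^ n - 1) with hc'
    obtain ⟨d, hd⟩ := EuclideanDomain.gcd_dvd_right w (X ^ n - 1)
    have hcα : (aeval (svPhi K L) c') α = 0 := by
      rw [hc', EuclideanDomain.gcd_eq_gcd_ab, map_add, LinearMap.add_apply, mul_comm w, map_mul,
        Module.End.mul_apply, hwα, map_mul, sv_Xn K L hn hL]
      simp
    have hcd : c'.natDegree < n :=
      (natDegree_le_of_dvd (EuclideanDomain.gcd_dvd_left w _) hw0).trans_lt hwd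
    have hdu : ¬ IsUnit d := by
      intro hu
      have h1 : (X ^ n - 1 : K[X]).natDegree = n := natDegree_X_pow_sub_C (r := (1 : K))
      have h2 := natDegree_mul_le (p := c') (q := d)
      rw [← hd, h1, natDegree_eq_zero_of_isUnit hu] at h2
      omega
    obtain ⟨P, hPm2, hPi2, e, rfl⟩ := exists_monic_irreducible_factor d hdu
    refine hα P hPm2 hPi2 ?_ ?_
    · rw [hd]; exact (dvd_mul_right P e).mul_left _
    · have h1 : α ∈ (aeval (svPhi K L) (P * e)).range := by
        rw [(sv_ker_range K L hn hL c' (P * e) hd.symm).2]; exact hcα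
      obtain ⟨y, hy⟩ := h1
      rw [map_mul, Module.End.mul_apply] at hy
      exact ⟨_, hy⟩
  refine ⟨hli, ?_⟩
  apply hli.span_eq_top_of_card_eq_finrank'
  rw [sv_finrank K L hn hL, Fintype.card_fin]

/-- the additive characters trivial on the image of `P(φ)` -/
theorem sv_add {n : ℕ} (hn : 0 < n) (hL : Fintype.card L = Fintype.card K ^ n)
    (P : K[X]) (hP : P ∣ X ^ n - 1) :
    ∃ H : Finset (AddChar L ℂ), 1 ∈ H ∧ H.card = Fintype.card K ^ P.natDegree ∧
      (∀ ψ ∈ H, ∀ y, ψ ((aeval (svPhi K L) P) y) = 1) ∧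
      (∀ x ∈ (aeval (svPhi K L) P).range, ∑ ψ ∈ H, ψ x = H.card) ∧
      (∀ x ∉ (aeval (svPhi K L) P).range, ∑ ψ ∈ H, ψ x = 0) := by
  classical
  have : Module.Finite K L := Module.Finite.of_finite
  set V := (aeval (svPhi K L) P).range with hV
  have : Finite (L ⧸ V) := inferInstance
  have := Fintype.ofFinite (L ⧸ V)
  let mk : L →+ L ⧸ V := V.mkQ.toAddMonoidHom
  have hmk : Function.Surjective mk := V.mkQ_surjective
  let Θ : AddChar (L ⧸ V) ℂ → AddChar L ℂ := fun ψ => ψ.compAddMonoidHom mk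
  have hΘ : Function.Injective Θ := by
    intro a b hab
    ext y
    obtain ⟨z, rfl⟩ := hmk y
    exact DFunLike.congr_fun hab z
  have hmk0 : ∀ x, mk x = 0 ↔ x ∈ V := fun x => Submodule.Quotient.mk_eq_zero V
  have hsum : ∀ x, ∑ ψ ∈ Finset.univ.image Θ, ψ x =
      if mk x = 0 then (Fintype.card (L ⧸ V) : ℂ) else 0 := by
    intro x
    rw [Finset.sum_image (fun a _ b _ hab => hΘ hab), ← AddChar.sum_apply_eq_ite]
    rfl
  have hcard : (Finset.univ.image Θ).card = Fintype.card (L ⧸ V) := by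
    rw [Finset.card_image_of_injective _ hΘ, Finset.card_univ, AddChar.card_eq]
  refine ⟨Finset.univ.image Θ, ?_, ?_, ?_, ?_, ?_⟩
  · rw [Finset.mem_image]
    exact ⟨1, Finset.mem_univ _, by ext; rfl⟩
  · rw [hcard, ← Nat.card_eq_fintype_card, Module.natCard_eq_pow_finrank (K := K),
      Nat.card_eq_fintype_card]
    congr 1
    obtain ⟨d, hd⟩ := hP
    have h1 := (sv_ker_range K L hn hL P d hd.symm).1
    have h2 := LinearMap.finrank_range_add_finrank_ker (aeval (svPhi K L) P)
    have h3 := Submodule.finrank_quotient_add_finrank V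
    rw [← hV] at h2
    omega
  · intro ψ hψ y
    obtain ⟨a, -, rfl⟩ := Finset.mem_image.1 hψ
    change a (mk _) = 1
    rw [(hmk0 _).2 ⟨y, rfl⟩, AddChar.map_zero_eq_one]
  · intro x hx
    rw [hsum, if_pos ((hmk0 x).2 hx), hcard]
  · intro x hx
    rw [hsum, if_neg (fun h => hx ((hmk0 x).1 h))]
end

section
variable {F : Type} [Field F] [Fintype F]

theorem sv_mul (p : ℕ) (hp : p.Prime) (hpN : p ∣ Fintype.card F - 1) :
    ∃ H : Finset (MulChar F ℂ), 1 ∈ H ∧ H.card = p ∧ (∀ χ ∈ H, χ ^ p = 1) ∧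
      (∀ x : F, x ≠ 0 → x ^ ((Fintype.card F - 1) / p) = 1 → ∑ χ ∈ H, χ x = H.card) ∧
      (∀ x : F, x ≠ 0 → x ^ ((Fintype.card F - 1) / p) ≠ 1 → ∑ χ ∈ H, χ x = 0) := by
  classical
  obtain ⟨χ₀, h0, hgen⟩ := wl_gen (F := F)
  have hQ : 1 < Fintype.card F := Fintype.one_lt_card
  set N := Fintype.card F - 1 with hN
  obtain ⟨e, he⟩ := hpN
  have he0 : 0 < e := Nat.pos_of_ne_zero (by rintro rfl; omega)
  have hdiv : N / p = e := by rw [he, Nat.mul_div_cancel_left _ hp.pos]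
  rw [hdiv]
  have hfaith : ∀ y : F, y ≠ 0 → χ₀ y = 1 → y = 1 := by
    intro y hy hy1
    by_contra hne
    obtain ⟨χ, hχ⟩ := MulChar.exists_apply_ne_one_of_hasEnoughRootsOfUnity F ℂ hne
    obtain ⟨a, ha, -, rfl⟩ := hgen χ
    apply hχ
    rw [MulChar.pow_apply' _ (by omega), hy1, one_pow]
  have hinj : Set.InjOn (fun i => χ₀ ^ (i * e)) (Finset.range p : Set ℕ) := by
    intro i hi j hj hij
    rw [Finset.mem_coe, Finset.mem_range] at hi hj
    have := pow_injOn_Iio_orderOf (x := χ₀) (x₁ := i * e) (x₂ := j * e) (by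
      rw [Set.mem_Iio, h0, he]; exact Nat.mul_lt_mul_of_pos_right hi he0) (by
      rw [Set.mem_Iio, h0, he]; exact Nat.mul_lt_mul_of_pos_right hj he0) hij
    exact Nat.eq_of_mul_eq_mul_right he0 this
  have hcard : ((Finset.range p).image fun i => χ₀ ^ (i * e)).card = p := by
    rw [Finset.card_image_of_injOn hinj, Finset.card_range]
  have hsum : ∀ x : F, x ≠ 0 → ∑ χ ∈ (Finset.range p).image fun i => χ₀ ^ (i * e), χ x =
      ∑ i ∈ Finset.range p, (χ₀ (x ^ e)) ^ i := by
    intro x hx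
    rw [Finset.sum_image hinj]
    refine Finset.sum_congr rfl fun i _ => ?_
    have := MulChar.pow_apply_coe χ₀ (i * e) (Units.mk0 x hx)
    rw [Units.val_mk0] at this
    rw [this, map_pow, ← pow_mul, mul_comm]
  refine ⟨(Finset.range p).image fun i => χ₀ ^ (i * e), ?_, hcard, ?_, ?_, ?_⟩
  · exact Finset.mem_image.2 ⟨0, Finset.mem_range.2 hp.pos, by simp⟩
  · intro χ hχ
    obtain ⟨i, -, rfl⟩ := Finset.mem_image.1 hχ
    rw [← pow_mul, mul_assoc, mul_comm e, ← he, mul_comm, pow_mul, ← h0, pow_orderOf_eq_one, one_pow]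
  · intro x hx hxe
    rw [hsum x hx, hxe, hcard]; simp
  · intro x hx hxe
    rw [hsum x hx]
    have h1 : χ₀ (x ^ e) ≠ 1 := fun h => hxe (hfaith _ (pow_ne_zero _ hx) h)
    rw [geom_sum_eq h1, ← map_pow, ← pow_mul, mul_comm, ← he, FiniteField.pow_card_sub_one_eq_one x hx,
      map_one, sub_self, zero_div]
end


theorem sv_ind_mul {G : Type} [CommGroup G] (T : Finset ℕ) (γ : ℕ → G)
    (hp : ∀ p ∈ T, p.Prime) (hg : ∀ p ∈ T, γ p ^ p = 1) (h1 : ∏ p ∈ T, γ p = 1) :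
    ∀ p ∈ T, γ p = 1 := by
  classical
  intro p hpT
  have e1 : γ p ^ (∏ r ∈ T.erase p, r) = 1 := by
    have : (∏ r ∈ T, γ r) ^ (∏ r ∈ T.erase p, r) = 1 := by rw [h1, one_pow]
    rw [← Finset.mul_prod_erase T γ hpT, mul_pow, ← Finset.prod_pow] at this
    have h3 : ∏ x ∈ T.erase p, γ x ^ (∏ r ∈ T.erase p, r) = 1 := by
      apply Finset.prod_eq_one
      intro r hr
      obtain ⟨c, hc⟩ := Finset.dvd_prod_of_mem (fun r : ℕ => r) hr
      rw [hc, pow_mul, hg r (Finset.mem_of_mem_erase hr), one_pow]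
    rwa [h3, mul_one] at this
  have hcop : Nat.Coprime p (∏ r ∈ T.erase p, r) := by
    apply Nat.Coprime.prod_right
    intro r hr
    rw [Nat.coprime_primes (hp p hpT) (hp r (Finset.mem_of_mem_erase hr))]
    exact (Finset.ne_of_mem_erase hr).symm
  have h2 := Nat.dvd_gcd (orderOf_dvd_of_pow_eq_one (hg p hpT)) (orderOf_dvd_of_pow_eq_one e1)
  rw [hcop] at h2
  exact orderOf_eq_one_iff.mp (Nat.dvd_one.mp h2)

theorem sv_ind_add {K L : Type} [Field K] [Field L] [Algebra K L] (φ : Module.End K L)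
    (T : Finset K[X]) (γ : K[X] → AddChar L ℂ)
    (hm : ∀ P ∈ T, P.Monic) (hi : ∀ P ∈ T, Irreducible P)
    (hg : ∀ P ∈ T, ∀ y, γ P ((aeval φ P) y) = 1) (h1 : ∏ P ∈ T, γ P = 1) :
    ∀ P ∈ T, γ P = 1 := by
  classical
  intro P hP
  set R := ∏ r ∈ T.erase P, r with hR
  have e1 : ∀ y, γ P ((aeval φ R) y) = 1 := by
    intro y
    have : (∏ r ∈ T, γ r) ((aeval φ R) y) = 1 := by rw [h1]; rfl
    rw [AddChar.prod_apply, ← Finset.mul_prod_erase T _ hP, Finset.prod_eq_one (s := T.erase P),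
      mul_one] at this
    · exact this
    · intro r hr
      obtain ⟨c, hc⟩ := Finset.dvd_prod_of_mem (fun r : K[X] => r) hr
      rw [hR, hc, map_mul, Module.End.mul_apply]
      exact hg r (Finset.mem_of_mem_erase hr) _
  have hcop : IsCoprime P R := by
    apply IsCoprime.prod_right
    intro r hr
    have hrT := Finset.mem_of_mem_erase hr
    rw [(hi P hP).coprime_iff_not_dvd]
    intro hd
    have := (hi P hP).associated_of_dvd (hi r hrT) hd
    exact (Finset.ne_of_mem_erase hr) (eq_of_monic_of_associated (hm r hrT) (hm P hP) this.symm)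
  obtain ⟨u, v, huv⟩ := hcop
  ext y
  have : y = (aeval φ P) ((aeval φ u) y) + (aeval φ R) ((aeval φ v) y) := by
    rw [← Module.End.mul_apply, ← Module.End.mul_apply, ← map_mul, ← map_mul, ← LinearMap.add_apply,
      ← map_add, mul_comm P, mul_comm R, huv]; simp
  rw [this, AddChar.map_add_eq_mul, hg P hP, e1]; simp

theorem sv_Wnat (ℓ : ℕ) (h0 : ℓ ≠ 0) :
    2 ^ ℓ.primeFactors.card ≤ (ℓ.divisors.filter Squarefree).card := by
  have := Nat.sum_divisors_filter_squarefree h0 (f := fun _ => 1)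
  simp only [Finset.sum_const, smul_eq_mul, mul_one, Finset.card_powerset] at this
  rw [this]
  apply le_of_eq
  rw [Nat.factors_eq]; rfl

theorem sv_monic_fin {K : Type} [Field K] [Fintype K] (g : K[X]) (h0 : g ≠ 0) :
    {h : K[X] | h.Monic ∧ h ∣ g}.Finite := by
  classical
  apply Set.Finite.subset (((Finset.range (g.natDegree + 1)).biUnion (wlM K)).finite_toSet)
  rintro h ⟨hm, hd⟩
  simp only [Finset.coe_biUnion, Set.mem_iUnion, Finset.mem_coe, Finset.mem_range]
  exact ⟨h.natDegree, Nat.lt_succ_of_le (natDegree_le_of_dvd hd h0), (mem_wlM K).2 ⟨hm, rfl⟩⟩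

theorem sv_Wpoly {K : Type} [Field K] [Fintype K] (g : K[X]) (h0 : g ≠ 0) (G0 : Finset K[X])
    (hG : ∀ P ∈ G0, P.Monic ∧ Irreducible P ∧ P ∣ g) :
    2 ^ G0.card ≤ Nat.card {h : K[X] // h.Monic ∧ Squarefree h ∧ h ∣ g} := by
  classical
  have hfin : Finite {h : K[X] // h.Monic ∧ Squarefree h ∧ h ∣ g} :=
    Set.Finite.to_subtype ((sv_monic_fin g h0).subset fun h hh => ⟨hh.1, hh.2.2⟩)
  have hcop : ∀ P ∈ G0, ∀ P' ∈ G0, P ≠ P' → IsCoprime P P' := by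
    intro P hP P' hP' hne
    rw [(hG P hP).2.1.coprime_iff_not_dvd]
    intro hd
    have := (hG P hP).2.1.associated_of_dvd (hG P' hP').2.1 hd
    exact hne (eq_of_monic_of_associated (hG P hP).1 (hG P' hP').1 this)
  have key : ∀ T ∈ G0.powerset, (∏ P ∈ T, P).Monic ∧ Squarefree (∏ P ∈ T, P) ∧ (∏ P ∈ T, P) ∣ g := by
    intro T hT
    have hT := Finset.mem_powerset.mp hT
    refine ⟨monic_prod_of_monic _ _ fun P hP => (hG P (hT hP)).1, ?_, ?_⟩
    · apply Finset.squarefree_prod_of_pairwise_isCoprime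
      · intro P hP P' hP' hne
        exact (hcop P (hT hP) P' (hT hP') hne).isRelPrime
      · intro P hP
        exact (hG P (hT hP)).2.1.squarefree
    · apply Finset.prod_dvd_of_coprime
      · intro P hP P' hP' hne
        exact hcop P (hT hP) P' (hT hP') hne
      · intro P hP
        exact (hG P (hT hP)).2.2
  rw [← Finset.card_powerset, ← Fintype.card_coe, ← Nat.card_eq_fintype_card]
  refine Nat.card_le_card_of_injective
    (fun T : G0.powerset => ⟨∏ P ∈ T.1, P, key T.1 T.2⟩) ?_
  have hsub : ∀ T₁ ∈ G0.powerset, ∀ T₂ ∈ G0.powerset, ∏ P ∈ T₁, P = ∏ P ∈ T₂, P → T₁ ⊆ T₂ := by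
    intro T₁ h₁ T₂ h₂ he P hP
    have h₁ := Finset.mem_powerset.mp h₁
    have h₂ := Finset.mem_powerset.mp h₂
    have hd : P ∣ ∏ P ∈ T₂, P := he ▸ Finset.dvd_prod_of_mem (fun r : K[X] => r) hP
    obtain ⟨P', hP', hd⟩ := ((hG P (h₁ hP)).2.1.prime.dvd_finsetProd_iff _).1 hd
    by_contra hn
    have hne : P ≠ P' := fun e => hn (e ▸ hP')
    exact ((hG P (h₁ hP)).2.1.coprime_iff_not_dvd.1 (hcop P (h₁ hP) P' (h₂ hP') hne)) hd
  rintro ⟨T₁, h₁⟩ ⟨T₂, h₂⟩ he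
  have he := congrArg Subtype.val he
  exact Subtype.ext ((hsub T₁ h₁ T₂ h₂ he).antisymm (hsub T₂ h₂ T₁ h₁ he.symm))

theorem sv_prim {L : Type} [Field L] [Fintype L] (x : L) (hx : x ≠ 0)
    (h : ∀ p : ℕ, p.Prime → p ∣ Fintype.card L - 1 → x ^ ((Fintype.card L - 1) / p) ≠ 1) :
    orderOf x = Fintype.card L - 1 := by
  have : 1 < Fintype.card L := Fintype.one_lt_card
  exact orderOf_eq_of_pow_and_pow_div_prime (by omega)
    (FiniteField.pow_card_sub_one_eq_one x hx) h

theorem sv_rat {F : Type} [Field F] (f : RatFunc F) (f₁ f₂ : F[X]) (h2 : f₂ ≠ 0)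
    (hf : f = algebraMap F[X] (RatFunc F) f₁ / algebraMap F[X] (RatFunc F) f₂) (x : F)
    (hx : f₂.eval x ≠ 0) : f.eval (RingHom.id F) x = f₁.eval x / f₂.eval x := by
  have h2' : algebraMap F[X] (RatFunc F) f₂ ≠ 0 := by
    simpa using h2
  have hd : f.denom ∣ f₂ := by rw [hf]; exact RatFunc.denom_div_dvd f₁ f₂
  have hdx : f.denom.eval₂ (RingHom.id F) x ≠ 0 := by
    intro h0
    obtain ⟨c, hc⟩ := hd
    apply hx
    rw [hc, eval_mul]
    have : f.denom.eval x = 0 := h0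
    rw [this, zero_mul]
  have hmul : f * algebraMap F[X] (RatFunc F) f₂ = algebraMap F[X] (RatFunc F) f₁ := by
    rw [hf, div_mul_cancel₀ _ h2']
  have := RatFunc.eval_mul (f := RingHom.id F) (a := x) (x := f)
    (y := algebraMap F[X] (RatFunc F) f₂) hdx (by simp)
  rw [hmul] at this
  rw [RatFunc.eval_algebraMap, RatFunc.eval_algebraMap] at this
  rw [eq_div_iff hx]
  exact this.symm


theorem sv_core (K L : Type) [Field K] [Fintype K] [Field L] [Fintype L] [Algebra K L]
    {n : ℕ} (hn : 0 < n) (hL : Fintype.card L = Fintype.card K ^ n)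
    (A R : Finset ℕ) (hAR : Disjoint A R)
    (hAp : ∀ p ∈ A ∪ R, p.Prime ∧ p ∣ Fintype.card L - 1)
    (G0 S : Finset K[X]) (hGS : Disjoint G0 S)
    (hGp : ∀ P : K[X], (P ∈ G0 ∨ P ∈ S) → P.Monic ∧ Irreducible P ∧ P ∣ X ^ n - 1)
    (D : Finset L) (f : L → L) (hD : ∀ x ∈ D, x ≠ 0) (hfD : ∀ x ∈ D, f x ≠ 0)
    (Wl : ℝ) (hWl : 0 ≤ Wl)
    (hW : ∀ (χ₁ χ₂ : MulChar L ℂ) (ψ : AddChar L ℂ), ¬ (χ₁ = 1 ∧ χ₂ = 1 ∧ ψ = 1) →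
      ‖∑ x ∈ D, χ₁ x * χ₂ (f x) * ψ x‖ ≤ Wl)
    (δ : ℝ) (hδ : 0 < δ)
    (hδd : δ = 1 - 2 * ∑ p ∈ R, (1 : ℝ) / p -
      ∑ P ∈ S, (1 : ℝ) / (Fintype.card K : ℝ) ^ P.natDegree)
    (hmain : (2 : ℝ) ^ (A.card + (A.card + G0.card)) * Wl *
      ((2 * (R.card : ℝ) + S.card - 1) / δ + 2) - Wl < D.card) :
    ∃ x ∈ D, (∀ p ∈ A ∪ R, x ^ ((Fintype.card L - 1) / p) ≠ 1) ∧
      (∀ p ∈ A ∪ R, (f x) ^ ((Fintype.card L - 1) / p) ≠ 1) ∧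
      (∀ P : K[X], (P ∈ G0 ∨ P ∈ S) → x ∉ (aeval (svPhi K L) P).range) := by
  classical
  have hm : ∀ p : ℕ, ∃ H : Finset (MulChar L ℂ), p ∈ A ∪ R → (1 ∈ H ∧ H.card = p ∧
      (∀ χ ∈ H, χ ^ p = 1) ∧
      (∀ x : L, x ≠ 0 → x ^ ((Fintype.card L - 1) / p) = 1 → ∑ χ ∈ H, χ x = (H.card : ℂ)) ∧
      (∀ x : L, x ≠ 0 → x ^ ((Fintype.card L - 1) / p) ≠ 1 → ∑ χ ∈ H, χ x = 0)) := by
    intro p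
    by_cases hp : p ∈ A ∪ R
    · obtain ⟨H, hH⟩ := sv_mul (F := L) p (hAp p hp).1 (hAp p hp).2
      exact ⟨H, fun _ => hH⟩
    · exact ⟨∅, fun h => absurd h hp⟩
  have ha : ∀ P : K[X], ∃ H : Finset (AddChar L ℂ), (P ∈ G0 ∨ P ∈ S) → (1 ∈ H ∧
      H.card = Fintype.card K ^ P.natDegree ∧
      (∀ ψ ∈ H, ∀ y, ψ ((aeval (svPhi K L) P) y) = 1) ∧
      (∀ x ∈ (aeval (svPhi K L) P).range, ∑ ψ ∈ H, ψ x = (H.card : ℂ)) ∧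
      (∀ x, x ∉ (aeval (svPhi K L) P).range → ∑ ψ ∈ H, ψ x = 0)) := by
    intro P
    by_cases hP : P ∈ G0 ∨ P ∈ S
    · obtain ⟨H, hH⟩ := sv_add K L hn hL P (hGp P hP).2.2
      exact ⟨H, fun _ => hH⟩
    · exact ⟨∅, fun h => absurd h hP⟩
  choose Hm hHm using hm
  choose Ha hHa using ha
  let i1 : MulChar L ℂ ↪ (MulChar L ℂ × MulChar L ℂ × AddChar L ℂ) := ⟨fun χ => (χ, 1, 1), fun a b h => (Prod.ext_iff.1 h).1⟩
  let i2 : MulChar L ℂ ↪ (MulChar L ℂ × MulChar L ℂ × AddChar L ℂ) := ⟨fun χ => (1, χ, 1),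
    fun a b h => (Prod.ext_iff.1 (Prod.ext_iff.1 h).2).1⟩
  let i3 : AddChar L ℂ ↪ (MulChar L ℂ × MulChar L ℂ × AddChar L ℂ) := ⟨fun ψ => (1, 1, ψ),
    fun a b h => (Prod.ext_iff.1 (Prod.ext_iff.1 h).2).2⟩
  let H : ℕ ⊕ ℕ ⊕ K[X] → Finset (MulChar L ℂ × MulChar L ℂ × AddChar L ℂ) := fun i => match i with
    | Sum.inl p => (Hm p).map i1
    | Sum.inr (Sum.inl p) => (Hm p).map i2
    | Sum.inr (Sum.inr P) => (Ha P).map i3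
  let cond : ℕ ⊕ ℕ ⊕ K[X] → L → Prop := fun i x => match i with
    | Sum.inl p => x ^ ((Fintype.card L - 1) / p) = 1
    | Sum.inr (Sum.inl p) => (f x) ^ ((Fintype.card L - 1) / p) = 1
    | Sum.inr (Sum.inr P) => x ∈ (aeval (svPhi K L) P).range
  let ev : (MulChar L ℂ × MulChar L ℂ × AddChar L ℂ) → L → ℂ := fun γ x => γ.1 x * γ.2.1 (f x) * γ.2.2 x
  set I₀ := A.disjSum (A.disjSum G0) with hI₀
  set J := R.disjSum (R.disjSum S) with hJ
  have mem1 : ∀ p, Sum.inl p ∈ I₀ ∪ J ↔ p ∈ A ∪ R := by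
    intro p; simp [hI₀, hJ]
  have mem2 : ∀ p, Sum.inr (Sum.inl p) ∈ I₀ ∪ J ↔ p ∈ A ∪ R := by
    intro p; simp [hI₀, hJ]
  have mem3 : ∀ P, Sum.inr (Sum.inr P) ∈ I₀ ∪ J ↔ (P ∈ G0 ∨ P ∈ S) := by
    intro p; simp [hI₀, hJ]
  have hu1 : ∀ (χ : MulChar L ℂ), χ = 1 → ∀ x : L, x ≠ 0 → χ x = 1 := by
    rintro _ rfl x hx
    exact MulChar.one_apply (isUnit_iff_ne_zero.2 hx)
  have hone : ∀ x : L, x ≠ 0 → (1 : MulChar L ℂ) x = 1 := hu1 1 rfl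
  have hKc : 1 < Fintype.card K := Fintype.one_lt_card
  have k1 : ∀ x ∈ D, ∀ χ, ev (i1 χ) x = χ x := by
    intro x hx χ
    change χ x * (1 : MulChar L ℂ) (f x) * (1 : AddChar L ℂ) x = χ x
    rw [hone _ (hfD x hx), AddChar.one_apply]; ring
  have k2 : ∀ x ∈ D, ∀ χ, ev (i2 χ) x = χ (f x) := by
    intro x hx χ
    change (1 : MulChar L ℂ) x * χ (f x) * (1 : AddChar L ℂ) x = χ (f x)
    rw [hone _ (hD x hx), AddChar.one_apply]; ring
  have k3 : ∀ x ∈ D, ∀ ψ, ev (i3 ψ) x = ψ x := by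
    intro x hx ψ
    change (1 : MulChar L ℂ) x * (1 : MulChar L ℂ) (f x) * ψ x = ψ x
    rw [hone _ (hD x hx), hone _ (hfD x hx)]; ring
  suffices hkey : ∃ x ∈ D, ∀ i ∈ I₀ ∪ J, ¬ cond i x by
    obtain ⟨x, hxD, hx⟩ := hkey
    refine ⟨x, hxD, fun p hp => ?_, fun p hp => ?_, fun P hP => ?_⟩
    · exact hx (Sum.inl p) ((mem1 p).2 hp)
    · exact hx (Sum.inr (Sum.inl p)) ((mem2 p).2 hp)
    · exact hx (Sum.inr (Sum.inr P)) ((mem3 P).2 hP)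
  refine sieve (X' := L) (ι := ℕ ⊕ ℕ ⊕ K[X]) (G := (MulChar L ℂ × MulChar L ℂ × AddChar L ℂ)) D ev Wl hWl ?_ ?_ ?_ I₀ J
    ?_ H ?_ ?_ ?_ cond ?_ ?_ δ hδ ?_ ?_
  · intro x hx
    simp [ev, hone x (hD x hx), hone _ (hfD x hx)]
  · intro x hx a b
    simp only [ev, Prod.fst_mul, Prod.snd_mul, MulChar.mul_apply, AddChar.mul_apply]
    ring
  · rintro ⟨χ₁, χ₂, ψ⟩ hne
    apply hW
    rintro ⟨rfl, rfl, rfl⟩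
    exact hne rfl
  · rw [Finset.disjoint_left]
    rintro (p | p | P) h1 h2
    · simp only [hI₀, hJ, Finset.inl_mem_disjSum] at h1 h2
      exact Finset.disjoint_left.1 hAR h1 h2
    · simp only [hI₀, hJ, Finset.inr_mem_disjSum, Finset.inl_mem_disjSum] at h1 h2
      exact Finset.disjoint_left.1 hAR h1 h2
    · simp only [hI₀, hJ, Finset.inr_mem_disjSum] at h1 h2
      exact Finset.disjoint_left.1 hGS h1 h2
  · rintro (p | p | P) h1
    · exact Finset.mem_map.2 ⟨1, (hHm p ((mem1 p).1 h1)).1, rfl⟩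
    · exact Finset.mem_map.2 ⟨1, (hHm p ((mem2 p).1 h1)).1, rfl⟩
    · exact Finset.mem_map.2 ⟨1, (hHa P ((mem3 P).1 h1)).1, rfl⟩
  · rintro (p | p | P) h1
    · have h1 := (mem1 p).1 h1
      simp only [H, Finset.card_map, (hHm p h1).2.1]
      exact (hAp p h1).1.two_le
    · have h1 := (mem2 p).1 h1
      simp only [H, Finset.card_map, (hHm p h1).2.1]
      exact (hAp p h1).1.two_le
    · have h1 := (mem3 P).1 h1
      simp only [H, Finset.card_map, (hHa P h1).2.1]
      have hd : P.natDegree ≠ 0 := (hGp P h1).2.1.natDegree_pos.ne'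
      calc 2 ≤ Fintype.card K := hKc
        _ ≤ _ := Nat.le_self_pow hd _
  · intro T hT γ hγ h1
    have e1 : ∏ p ∈ T.toLeft, (γ (Sum.inl p)).1 = 1 := by
      have := congrArg Prod.fst h1
      rw [Prod.fst_prod, ← Finset.toLeft_disjSum_toRight (u := T), Finset.prod_disjSum] at this
      rw [Finset.prod_eq_one (s := T.toRight), mul_one] at this
      · exact this
      · rintro (p | P) hp
        · have := hγ _ (Finset.mem_toRight.1 hp)
          obtain ⟨χ, _, h⟩ := Finset.mem_map.1 this
          rw [← h]; rfl
        · have := hγ _ (Finset.mem_toRight.1 hp)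
          obtain ⟨χ, _, h⟩ := Finset.mem_map.1 this
          rw [← h]; rfl
    have e2 : ∏ p ∈ T.toRight.toLeft, (γ (Sum.inr (Sum.inl p))).2.1 = 1 := by
      have := congrArg (fun z : (MulChar L ℂ × MulChar L ℂ × AddChar L ℂ) => z.2.1) h1
      simp only [Prod.snd_prod, Prod.fst_prod] at this
      rw [← Finset.toLeft_disjSum_toRight (u := T), Finset.prod_disjSum,
        ← Finset.toLeft_disjSum_toRight (u := T.toRight), Finset.prod_disjSum,
        Finset.prod_eq_one (s := T.toLeft), one_mul,
        Finset.prod_eq_one (s := T.toRight.toRight), mul_one] at this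
      · exact this
      · intro P hp
        have := hγ _ (Finset.mem_toRight.1 (Finset.mem_toRight.1 hp))
        obtain ⟨χ, _, h⟩ := Finset.mem_map.1 this
        rw [← h]; rfl
      · intro P hp
        have := hγ _ (Finset.mem_toLeft.1 hp)
        obtain ⟨χ, _, h⟩ := Finset.mem_map.1 this
        rw [← h]; rfl
    have e3 : ∏ p ∈ T.toRight.toRight, (γ (Sum.inr (Sum.inr p))).2.2 = 1 := by
      have := congrArg (fun z : (MulChar L ℂ × MulChar L ℂ × AddChar L ℂ) => z.2.2) h1
      simp only [Prod.snd_prod] at this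
      rw [← Finset.toLeft_disjSum_toRight (u := T), Finset.prod_disjSum,
        ← Finset.toLeft_disjSum_toRight (u := T.toRight), Finset.prod_disjSum,
        Finset.prod_eq_one (s := T.toLeft), one_mul,
        Finset.prod_eq_one (s := T.toRight.toLeft), one_mul] at this
      · exact this
      · intro P hp
        have := hγ _ (Finset.mem_toRight.1 (Finset.mem_toLeft.1 hp))
        obtain ⟨χ, _, h⟩ := Finset.mem_map.1 this
        rw [← h]; rfl
      · intro P hp
        have := hγ _ (Finset.mem_toLeft.1 hp)
        obtain ⟨χ, _, h⟩ := Finset.mem_map.1 this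
        rw [← h]; rfl
    have m1 : ∀ p ∈ T.toLeft, p ∈ A ∪ R := fun p hp => (mem1 p).1 (hT (Finset.mem_toLeft.1 hp))
    have m2 : ∀ p ∈ T.toRight.toLeft, p ∈ A ∪ R := fun p hp =>
      (mem2 p).1 (hT (Finset.mem_toRight.1 (Finset.mem_toLeft.1 hp)))
    have m3 : ∀ p ∈ T.toRight.toRight, (p ∈ G0 ∨ p ∈ S) := fun p hp =>
      (mem3 p).1 (hT (Finset.mem_toRight.1 (Finset.mem_toRight.1 hp)))
    have r1 := sv_ind_mul T.toLeft (fun p => (γ (Sum.inl p)).1) (fun p hp => (hAp p (m1 p hp)).1)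
      (by
        intro p hp
        obtain ⟨χ, hχ, h⟩ := Finset.mem_map.1 (hγ _ (Finset.mem_toLeft.1 hp))
        simp only [← h]
        exact (hHm p (m1 p hp)).2.2.1 χ hχ) e1
    have r2 := sv_ind_mul T.toRight.toLeft (fun p => (γ (Sum.inr (Sum.inl p))).2.1)
      (fun p hp => (hAp p (m2 p hp)).1)
      (by
        intro p hp
        obtain ⟨χ, hχ, h⟩ := Finset.mem_map.1
          (hγ _ (Finset.mem_toRight.1 (Finset.mem_toLeft.1 hp)))
        simp only [← h]
        exact (hHm p (m2 p hp)).2.2.1 χ hχ) e2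
    have r3 := sv_ind_add (svPhi K L) T.toRight.toRight (fun p => (γ (Sum.inr (Sum.inr p))).2.2)
      (fun p hp => (hGp p (m3 p hp)).1) (fun p hp => (hGp p (m3 p hp)).2.1)
      (by
        intro p hp
        obtain ⟨χ, hχ, h⟩ := Finset.mem_map.1
          (hγ _ (Finset.mem_toRight.1 (Finset.mem_toRight.1 hp)))
        simp only [← h]
        exact (hHa p (m3 p hp)).2.2.1 χ hχ) e3
    rintro (p | p | P) hp
    · have h2 := r1 p (Finset.mem_toLeft.2 hp)
      obtain ⟨χ, hχ, h⟩ := Finset.mem_map.1 (hγ _ hp)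
      simp only [← h] at h2 ⊢
      have h2 : χ = 1 := h2
      rw [h2]; rfl
    · have h2 := r2 p (Finset.mem_toLeft.2 (Finset.mem_toRight.2 hp))
      obtain ⟨χ, hχ, h⟩ := Finset.mem_map.1 (hγ _ hp)
      simp only [← h] at h2 ⊢
      have h2 : χ = 1 := h2
      rw [h2]; rfl
    · have h2 := r3 P (Finset.mem_toRight.2 (Finset.mem_toRight.2 hp))
      obtain ⟨χ, hχ, h⟩ := Finset.mem_map.1 (hγ _ hp)
      simp only [← h] at h2 ⊢
      have h2 : χ = 1 := h2
      rw [h2]; rfl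
  · rintro (p | p | P) h1 x hx hc
    · have := (hHm p ((mem1 p).1 h1)).2.2.2.1 x (hD x hx) hc
      simp only [H, Finset.sum_map, Finset.card_map]
      rw [Finset.sum_congr rfl fun χ _ => k1 x hx χ]
      exact this
    · have := (hHm p ((mem2 p).1 h1)).2.2.2.1 (f x) (hfD x hx) hc
      simp only [H, Finset.sum_map, Finset.card_map]
      rw [Finset.sum_congr rfl fun χ _ => k2 x hx χ]
      exact this
    · have := (hHa P ((mem3 P).1 h1)).2.2.2.1 x hc
      simp only [H, Finset.sum_map, Finset.card_map]
      rw [Finset.sum_congr rfl fun χ _ => k3 x hx χ]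
      exact this
  · rintro (p | p | P) h1 x hx hc
    · have := (hHm p ((mem1 p).1 h1)).2.2.2.2 x (hD x hx) hc
      simp only [H, Finset.sum_map, Finset.card_map]
      rw [Finset.sum_congr rfl fun χ _ => k1 x hx χ]
      exact this
    · have := (hHm p ((mem2 p).1 h1)).2.2.2.2 (f x) (hfD x hx) hc
      simp only [H, Finset.sum_map, Finset.card_map]
      rw [Finset.sum_congr rfl fun χ _ => k2 x hx χ]
      exact this
    · have := (hHa P ((mem3 P).1 h1)).2.2.2.2 x hc
      simp only [H, Finset.sum_map, Finset.card_map]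
      rw [Finset.sum_congr rfl fun χ _ => k3 x hx χ]
      exact this
  · rw [hδd, hJ, Finset.sum_disjSum, Finset.sum_disjSum]
    have s1 : ∑ p ∈ R, (1 : ℝ) / p = ∑ p ∈ R, 1 / ((Hm p).card : ℝ) :=
      Finset.sum_congr rfl fun p hp => by rw [(hHm p (Finset.mem_union_right _ hp)).2.1]
    have s2 : ∑ P ∈ S, (1 : ℝ) / (Fintype.card K : ℝ) ^ P.natDegree =
        ∑ P ∈ S, 1 / ((Ha P).card : ℝ) :=
      Finset.sum_congr rfl fun p hp => by rw [(hHa p (Or.inr hp)).2.1]; push_cast; rfl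
    simp only [H, Finset.card_map]
    rw [s1, s2]; ring
  · have c1 : I₀.card = A.card + (A.card + G0.card) := by
      simp [hI₀, Finset.card_disjSum]
    have c2 : (J.card : ℝ) = 2 * (R.card : ℝ) + S.card := by
      simp [hJ, Finset.card_disjSum]; ring
    rw [c1, c2]
    exact hmain

theorem stmt3 (q n m₁ m₂ : ℕ) (hq : IsPrimePow q) (hn : 3 ≤ n)
    (hm₁ : 0 < m₁) (hm₂ : 0 < m₂)
    (K L : Type) [Field K] [Field L] [Fintype K] [Fintype L] [Algebra K L]
    (hK : Fintype.card K = q) (hL : Fintype.card L = q ^ n)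
    (ℓ : ℕ) (hℓ : ℓ ∣ q ^ n - 1)
    (R : Finset ℕ) (hR : ∀ p : ℕ, p ∈ R ↔ p.Prime ∧ p ∣ q ^ n - 1 ∧ ¬ p ∣ ℓ)
    (g : Polynomial K) (hgdvd : g ∣ X ^ n - 1)
    (S : Finset (Polynomial K))
    (hS : ∀ P : Polynomial K, P ∈ S ↔ P.Monic ∧ Irreducible P ∧ P ∣ X ^ n - 1 ∧ ¬ P ∣ g)
    (δ : ℝ)
    (hδdef : δ = 1 - 2 * ∑ p ∈ R, (1 : ℝ) / p - ∑ P ∈ S, (1 : ℝ) / (q : ℝ) ^ P.natDegree)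
    (hδ : 0 < δ)
    (Δ : ℝ) (hΔdef : Δ = (2 * (R.card : ℝ) + S.card - 1) / δ + 2)
    (h : (q : ℝ) ^ ((n : ℝ) / 2) ≥ (m₁ + m₂ + 1) * (Wnat ℓ : ℝ) ^ 2 * Wpoly g * Δ) :
    ∀ f ∈ Upsilon L m₁ m₂, ∃ α : L,
      IsPrimitiveElem α ∧ IsNormalElem K n α ∧ IsPrimitiveElem (ratEval f α) := by
  classical
  rintro f ⟨f₁, f₂, h20, hf, hd1, hd2, hcop, k, g', hk, hgm, hgi, hgX, hgk, hgd, hgnd⟩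
  have h10 : f₁ ≠ 0 := by
    rintro rfl
    exact hgnd (by simp)
  have hq1 : 1 < q := hq.one_lt
  have hQ1 : 1 < q ^ n := Nat.one_lt_pow (by omega) hq1
  have hℓ0 : ℓ ≠ 0 := by
    rintro rfl
    have := Nat.eq_zero_of_zero_dvd hℓ
    omega
  have hg0 : g ≠ 0 := by
    rintro rfl
    exact (X_pow_sub_C_ne_zero (by omega : 0 < n) (1 : K)) (by simpa using zero_dvd_iff.1 hgdvd)
  have hLK : Fintype.card L = Fintype.card K ^ n := by rw [hL, hK]
  have hfin : {P : K[X] | P.Monic ∧ Irreducible P ∧ P ∣ g}.Finite :=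
    (sv_monic_fin g hg0).subset fun P hP => ⟨hP.1, hP.2.2⟩
  set G0 : Finset K[X] := hfin.toFinset with hG0def
  have hG0 : ∀ P, P ∈ G0 ↔ P.Monic ∧ Irreducible P ∧ P ∣ g := by
    intro P; simp [hG0def]
  set A := ℓ.primeFactors with hA
  have hAm : ∀ p, p ∈ A ↔ p.Prime ∧ p ∣ ℓ := by
    intro p; simp [hA, hℓ0]
  set D : Finset L := Finset.univ.filter fun x => x ≠ 0 ∧ f₁.eval x / f₂.eval x ≠ 0 with hDdef
  have hDm : ∀ x, x ∈ D ↔ x ≠ 0 ∧ f₁.eval x / f₂.eval x ≠ 0 := by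
    intro x; simp [hDdef]
  have hDc : (q : ℝ) ^ n - (m₁ + m₂ + 1) ≤ D.card := by
    have hsub : (Finset.univ : Finset L) ⊆ D ∪ ({0} ∪ (f₁.roots.toFinset ∪ f₂.roots.toFinset)) := by
      intro x _
      by_cases hx : x ∈ D
      · exact Finset.mem_union_left _ hx
      · apply Finset.mem_union_right
        rw [hDm] at hx
        simp only [Finset.mem_union, Finset.mem_singleton, Multiset.mem_toFinset, mem_roots h10,
          mem_roots h20, IsRoot.def]
        by_contra hc
        push Not at hc
        exact hx ⟨hc.1, div_ne_zero hc.2.1 hc.2.2⟩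
    have h1 := Finset.card_le_card hsub
    rw [Finset.card_univ, hL] at h1
    have h2 := Finset.card_union_le D ({0} ∪ (f₁.roots.toFinset ∪ f₂.roots.toFinset))
    have h3 := Finset.card_union_le ({0} : Finset L) (f₁.roots.toFinset ∪ f₂.roots.toFinset)
    have h4 := Finset.card_union_le f₁.roots.toFinset f₂.roots.toFinset
    have h5 := (Multiset.toFinset_card_le f₁.roots).trans (card_roots' f₁)
    have h6 := (Multiset.toFinset_card_le f₂.roots).trans (card_roots' f₂)
    rw [Finset.card_singleton] at h3
    have h7 : q ^ n ≤ D.card + (m₁ + m₂ + 1) := by omega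
    have h8 : (q : ℝ) ^ n ≤ D.card + (m₁ + m₂ + 1) := by exact_mod_cast h7
    linarith
  set M : ℝ := m₁ + m₂ + 1 with hM
  have hM0 : 0 < M := by positivity
  set s : ℝ := Real.sqrt (Fintype.card L) with hs
  have hcL : ((Fintype.card L : ℕ) : ℝ) = (q : ℝ) ^ n := by rw [hL]; push_cast; rfl
  have hss : s * s = (q : ℝ) ^ n := by
    rw [hs, hcL]; exact Real.mul_self_sqrt (by positivity)
  have hsq : (q : ℝ) ^ ((n : ℝ) / 2) = s := by
    rw [hs, hcL, Real.sqrt_eq_rpow, ← Real.rpow_natCast, ← Real.rpow_mul (by positivity)]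
    congr 1; ring
  have hs1 : 1 < s := by
    rw [hs, hcL]
    apply Real.lt_sqrt_of_sq_lt
    have : (1 : ℝ) < (q : ℝ) ^ n := by exact_mod_cast hQ1
    simpa using this
  have hΔ : 0 < Δ := by
    rw [hΔdef]
    by_cases hc : 2 * R.card + S.card = 0
    · have hR0 : R = ∅ := Finset.card_eq_zero.1 (by omega)
      have hS0 : S = ∅ := Finset.card_eq_zero.1 (by omega)
      rw [hR0, hS0] at hδdef
      simp at hδdef
      rw [hδdef, hR0, hS0]; norm_num
    · have h1 : (1 : ℝ) ≤ 2 * (R.card : ℝ) + S.card := by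
        have : 1 ≤ 2 * R.card + S.card := by omega
        exact_mod_cast this
      have : 0 ≤ (2 * (R.card : ℝ) + S.card - 1) / δ := div_nonneg (by linarith) hδ.le
      linarith
  have hpow : (2 : ℝ) ^ (A.card + (A.card + G0.card)) ≤ (Wnat ℓ : ℝ) ^ 2 * Wpoly g := by
    have h1 : 2 ^ A.card ≤ Wnat ℓ := sv_Wnat ℓ hℓ0
    have h2 : 2 ^ G0.card ≤ Wpoly g := sv_Wpoly g hg0 G0 fun P hP => (hG0 P).1 hP
    have h3 : 2 ^ (A.card + (A.card + G0.card)) ≤ Wnat ℓ ^ 2 * Wpoly g := by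
      rw [pow_add, pow_add, sq, mul_assoc]
      exact Nat.mul_le_mul h1 (Nat.mul_le_mul h1 h2)
    exact_mod_cast h3
  have hsge : M * (2 : ℝ) ^ (A.card + (A.card + G0.card)) * Δ ≤ s := by
    rw [← hsq]
    refine le_trans ?_ h
    rw [mul_assoc M ((Wnat ℓ : ℝ) ^ 2)]
    exact mul_le_mul_of_nonneg_right (mul_le_mul_of_nonneg_left hpow hM0.le) hΔ.le
  have hmain : (2 : ℝ) ^ (A.card + (A.card + G0.card)) * (M * s) *
      ((2 * (R.card : ℝ) + S.card - 1) / δ + 2) - M * s < D.card := by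
    rw [← hΔdef]
    have h1 := mul_le_mul_of_nonneg_right hsge (by linarith : 0 ≤ s)
    rw [hss] at h1
    have h2 : M < M * s := by nlinarith
    nlinarith
  have hnp : 0 < n := by omega
  obtain ⟨x, hxD, hx1, hx2, hx3⟩ := sv_core K L hnp hLK A R
    (Finset.disjoint_left.2 fun p hp hp' => ((hR p).1 hp').2.2 ((hAm p).1 hp).2)
    (by
      intro p hp
      rw [hL]
      rcases Finset.mem_union.1 hp with hp | hp
      · exact ⟨((hAm p).1 hp).1, ((hAm p).1 hp).2.trans hℓ⟩
      · exact ⟨((hR p).1 hp).1, ((hR p).1 hp).2.1⟩) G0 S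
    (Finset.disjoint_left.2 fun p hp hp' => ((hS p).1 hp').2.2.2 ((hG0 p).1 hp).2.2)
    (by
      rintro P (hP | hP)
      · have := (hG0 P).1 hP
        exact ⟨this.1, this.2.1, this.2.2.trans hgdvd⟩
      · have := (hS P).1 hP
        exact ⟨this.1, this.2.1, this.2.2.1⟩) D (fun x => f₁.eval x / f₂.eval x)
    (fun x hx => ((hDm x).1 hx).1) (fun x hx => ((hDm x).1 hx).2) (M * s) (by positivity)
    (by
      intro χ₁ χ₂ ψ hne
      have h1 := wl_app m₁ m₂ f₁ f₂ hd1 hd2 h10 h20 hcop k g' hgm hgi hgX hgk hgd hgnd χ₁ χ₂ ψ hne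
      refine le_trans (le_of_eq ?_) h1
      congr 1
      apply Finset.sum_subset (Finset.subset_univ _)
      intro x _ hx
      rw [hDm] at hx
      by_cases hx0 : x = 0
      · rw [hx0, MulChar.map_zero]; ring
      · have : f₁.eval x / f₂.eval x = 0 := by
          by_contra hc; exact hx ⟨hx0, hc⟩
        rw [this, MulChar.map_zero]; ring) δ hδ (by rw [hK]; exact hδdef) hmain
  obtain ⟨hx0, hfx⟩ := (hDm x).1 hxD
  have hpm : ∀ p : ℕ, p.Prime → p ∣ Fintype.card L - 1 → p ∈ A ∪ R := by
    intro p hp hpd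
    rw [hL] at hpd
    by_cases hpl : p ∣ ℓ
    · exact Finset.mem_union_left _ ((hAm p).2 ⟨hp, hpl⟩)
    · exact Finset.mem_union_right _ ((hR p).2 ⟨hp, hpd, hpl⟩)
  have h2x : f₂.eval x ≠ 0 := fun h0 => hfx (by rw [h0, div_zero])
  refine ⟨x, sv_prim x hx0 fun p hp hpd => hx1 p (hpm p hp hpd), ?_, ?_⟩
  · apply sv_normal K L hnp hLK x
    intro P hPm hPi hPd
    apply hx3
    by_cases hPg : P ∣ g
    · exact Or.inl ((hG0 P).2 ⟨hPm, hPi, hPg⟩)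
    · exact Or.inr ((hS P).2 ⟨hPm, hPi, hPd, hPg⟩)
  · have he : ratEval f x = f₁.eval x / f₂.eval x := sv_rat f f₁ f₂ h20 hf x h2x
    rw [he]
    exact sv_prim _ hfx fun p hp hpd => hx2 p (hpm p hp hpd)
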